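/- Let ⟨S | R⟩ be a classical C'(1/6) presentation with group G, and let α be a geodesic in Cay(G,S). Define ρ(r) := the supremum of diam_{d_S}(Γ0 ∩ α) over all embedded relator cycles Γ0 with |Γ0| ≤ r and Γ0 ∩ α ≠ ∅. Then α is Morse if and only if ρ is sublinear. -/

import Mathlib

/- Common definitions: words, classical C'(1/6) presentations, word metrics,
   contraction, Morse property, etc. -/

namespace GSC

open Filter

/-- A word over the alphabet `S`: a list of letters with an exponent `±1`
(`true` = the letter, `false` = its formal inverse). -/
abbrev Word (S : Type) := List (S × Bool)

/-- The formal inverse of a word. -/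
def wordInv {S : Type} (w : Word S) : Word S := (w.map fun l => (l.1, !l.2)).reverse

/-- A word is (freely) reduced if no letter is followed by its formal inverse. -/
def Reduced {S : Type} (w : Word S) : Prop :=
  List.Chain' (fun a b => a.1 ≠ b.1 ∨ a.2 = b.2) w

/-- A word is cyclically reduced if its square is reduced. -/
def CyclicallyReduced {S : Type} (w : Word S) : Prop := Reduced (w ++ w)

/-- A piece with respect to a set of relators `R`: a word occurring as a prefix of
two distinct elements of `R`. -/
def IsPiece {S : Type} (R : Set (Word S)) (p : Word S) : Prop :=
  ∃ r₁ ∈ R, ∃ r₂ ∈ R, r₁ ≠ r₂ ∧ p <+: r₁ ∧ p <+: r₂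

/-- Closure of a set of words under inversion and cyclic permutation. -/
def symmClosure {S : Type} (R : Set (Word S)) : Set (Word S) :=
  {w | ∃ r ∈ R, ∃ n : ℕ, w = r.rotate n ∨ w = wordInv (r.rotate n)}

/-- A classical `C'(1/den)` collection of cyclically reduced words: after closing under
inversion and cyclic permutation, every piece `p` contained in a relator `r` satisfies
`den * |p| < |r|`. -/
def CprimeCollection {S : Type} (den : ℕ) (R : Set (Word S)) : Prop :=
  (∀ r ∈ R, CyclicallyReduced r) ∧
  ∀ r ∈ symmClosure R, ∀ p : Word S, p <+: r → IsPiece (symmClosure R) p →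
    den * p.length < r.length

/-- A classical `C'(1/6)` presentation: a set of cyclically reduced relators, closed under
inversion and cyclic permutation, in which every piece contained in a relator `r` has
length `< |r|/6`. -/
structure C6Presentation (S : Type) where
  rels : Set (Word S)
  cyclically_reduced : ∀ r ∈ rels, CyclicallyReduced r
  inv_mem : ∀ r ∈ rels, wordInv r ∈ rels
  rotate_mem : ∀ r ∈ rels, ∀ n : ℕ, r.rotate n ∈ rels
  small_cancellation : ∀ r ∈ rels, ∀ p : Word S, p <+: r → IsPiece rels p →
    6 * p.length < r.length

/-- The element of the free group represented by a word. -/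
def wordVal {S : Type} (w : Word S) : FreeGroup S :=
  (w.map fun l => (FreeGroup.of l.1) ^ (if l.2 then (1 : ℤ) else -1)).prod

/-- The group defined by a `C'(1/6)` presentation. -/
abbrev C6Presentation.Grp {S : Type} (P : C6Presentation S) : Type :=
  PresentedGroup (wordVal '' P.rels)

/-- The generating set of the presented group (the images of the letters of `S`). -/
def C6Presentation.gens {S : Type} (P : C6Presentation S) : Set P.Grp :=
  Set.range fun a : S => (PresentedGroup.of a : P.Grp)

/-- The element of the presented group represented by a word. -/
def C6Presentation.elt {S : Type} (P : C6Presentation S) (w : Word S) : P.Grp :=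
  (w.map fun l => (PresentedGroup.of l.1 : P.Grp) ^ (if l.2 then (1 : ℤ) else -1)).prod

/-- The word length of `g` with respect to a generating set `S ⊆ G`: the least `n`
such that `g` is a product of `n` elements of `S ∪ S⁻¹`. -/
noncomputable def wordLength {G : Type*} [Group G] (S : Set G) (g : G) : ℕ :=
  sInf {n : ℕ | ∃ l : List G, l.length = n ∧ (∀ x ∈ l, x ∈ S ∨ x⁻¹ ∈ S) ∧ l.prod = g}

/-- The word metric on `G` with respect to `S`, as a real-valued function. -/
noncomputable def wdist {G : Type*} [Group G] (S : Set G) (g h : G) : ℝ :=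
  (wordLength S (g⁻¹ * h) : ℝ)

/-- Distance from a point to a subset, in the word metric. -/
noncomputable def setDist {G : Type*} [Group G] (S : Set G) (x : G) (Y : Set G) : ℝ :=
  sInf (wdist S x '' Y)

/-- Closest point projection to a subset `Y`, in the word metric. -/
def proj {G : Type*} [Group G] (S : Set G) (Y : Set G) (x : G) : Set G :=
  {y ∈ Y | wdist S x y = setDist S x Y}

/-- Diameter of a subset, in the word metric. -/
noncomputable def setDiam {G : Type*} [Group G] (S : Set G) (A : Set G) : ℝ :=
  sSup {d : ℝ | ∃ x ∈ A, ∃ y ∈ A, d = wdist S x y}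

/-- Admissibility of a pair of contraction gauges `(ρ₁, ρ₂)`: both non-decreasing and
eventually non-negative, `ρ₁ r ≤ r`, `ρ₁` unbounded, and `ρ₂/ρ₁ → 0` at infinity. -/
def Admissible (ρ₁ ρ₂ : ℝ → ℝ) : Prop :=
  Monotone ρ₁ ∧ Monotone ρ₂ ∧
  (∀ᶠ r in atTop, 0 ≤ ρ₁ r) ∧ (∀ᶠ r in atTop, 0 ≤ ρ₂ r) ∧
  (∀ r : ℝ, ρ₁ r ≤ r) ∧ (∀ M : ℝ, ∃ r : ℝ, M ≤ ρ₁ r) ∧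
  Tendsto (fun r => ρ₂ r / ρ₁ r) atTop (nhds 0)

/-- `Y` is `(ρ₁,ρ₂)`-contracting inside the subspace `X` (with the metric induced by the
word metric of `S`): whenever `x, x' ∈ X` satisfy `d(x,x') ≤ ρ₁(d(x,Y))`, the projections
`π(x) ∪ π(x')` have diameter at most `ρ₂(d(x,Y))`. -/
def ContractingIn {G : Type*} [Group G] (S : Set G) (X Y : Set G) (ρ₁ ρ₂ : ℝ → ℝ) : Prop :=
  Admissible ρ₁ ρ₂ ∧
  ∀ x ∈ X, ∀ x' ∈ X, wdist S x x' ≤ ρ₁ (setDist S x Y) →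
    ∀ y ∈ proj S Y x ∪ proj S Y x', ∀ y' ∈ proj S Y x ∪ proj S Y x',
      wdist S y y' ≤ ρ₂ (setDist S x Y)

/-- `Y` is `(ρ₁,ρ₂)`-contracting in `Cay(G,S)`. -/
def ContractingWith {G : Type*} [Group G] (S : Set G) (ρ₁ ρ₂ : ℝ → ℝ) (Y : Set G) : Prop :=
  ContractingIn S Set.univ Y ρ₁ ρ₂

/-- `Y` is strongly contracting: `(r, C)`-contracting for some constant `C`. -/
def StronglyContracting {G : Type*} [Group G] (S : Set G) (Y : Set G) : Prop :=
  ∃ C : ℝ, ContractingWith S (fun r => r) (fun _ => C) Y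

/-- A sublinear function: non-decreasing, eventually non-negative, `f(r)/r → 0`. -/
def Sublinear (f : ℝ → ℝ) : Prop :=
  Monotone f ∧ (∀ᶠ r in atTop, 0 ≤ f r) ∧ Tendsto (fun r => f r / r) atTop (nhds 0)

/-- `f ⪯ g`: there are constants `C₁, C₂ > 0` and `C₃, C₄ ≥ 0` with
`f(x) ≤ C₁ g(C₂ x + C₃) + C₄` for all `x`. -/
def Preceq (f g : ℝ → ℝ) : Prop :=
  ∃ C₁ C₂ C₃ C₄ : ℝ, 0 < C₁ ∧ 0 < C₂ ∧ 0 ≤ C₃ ∧ 0 ≤ C₄ ∧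
    ∀ x : ℝ, f x ≤ C₁ * g (C₂ * x + C₃) + C₄

/-- `f ≍ g`: `f ⪯ g` and `g ⪯ f`. -/
def Asymp (f g : ℝ → ℝ) : Prop := Preceq f g ∧ Preceq g f

/-- `α ⊆ G` is a geodesic of `Cay(G,S)`: the image of an isometric embedding of a
subinterval of `ℤ` into `(G, d_S)`. -/
def IsGeodesic {G : Type*} [Group G] (S : Set G) (α : Set G) : Prop :=
  ∃ (I : Set ℤ) (γ : ℤ → G), I.OrdConnected ∧
    (∀ m ∈ I, ∀ n ∈ I, wdist S (γ m) (γ n) = |(m : ℝ) - (n : ℝ)|) ∧ α = γ '' I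

/-- `α ⊆ G` is a bi-infinite geodesic of `Cay(G,S)`. -/
def IsBiInfGeodesic {G : Type*} [Group G] (S : Set G) (α : Set G) : Prop :=
  ∃ γ : ℤ → G, (∀ m n : ℤ, wdist S (γ m) (γ n) = |(m : ℝ) - (n : ℝ)|) ∧ α = Set.range γ

/-- `Y` is Morse: there is `μ` such that every `(L,A)`-quasi-geodesic with endpoints on
`Y` stays in the `μ(L,A)`-neighborhood of `Y`. -/
def IsMorse {G : Type*} [Group G] (S : Set G) (Y : Set G) : Prop :=
  ∃ μ : ℝ → ℝ → ℝ, ∀ L A : ℝ, 1 ≤ L → 0 ≤ A →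
    ∀ (q : ℤ → G) (m n : ℤ), m ≤ n → q m ∈ Y → q n ∈ Y →
    (∀ i j : ℤ, m ≤ i → i ≤ n → m ≤ j → j ≤ n →
      L⁻¹ * |(i : ℝ) - (j : ℝ)| - A ≤ wdist S (q i) (q j) ∧
      wdist S (q i) (q j) ≤ L * |(i : ℝ) - (j : ℝ)| + A) →
    ∀ i : ℤ, m ≤ i → i ≤ n → setDist S (q i) Y ≤ μ L A

/-- Two subsets are at finite Hausdorff distance in the word metric. -/
def FinHausdorffDist {G : Type*} [Group G] (S : Set G) (A B : Set G) : Prop :=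
  ∃ ε : ℝ, (∀ a ∈ A, ∃ b ∈ B, wdist S a b ≤ ε) ∧ ∀ b ∈ B, ∃ a ∈ A, wdist S a b ≤ ε

/-- The embedded relator cycle determined by `g ∈ G(Γ)` and a relator `r`:
the set `{g ⋅ p̄ : p a prefix of r}`. -/
def relatorCycle {S : Type} (P : C6Presentation S) (g : P.Grp) (r : Word S) :
    Set P.Grp :=
  {x | ∃ p : Word S, p <+: r ∧ x = g * P.elt p}

/-- A geodesic `α` is locally `(ρ₁,ρ₂)`-contracting: for every embedded relator cycle
`Γ₀` meeting `α`, the set `Γ₀ ∩ α` is `(ρ₁,ρ₂)`-contracting as a subspace of `Γ₀`. -/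
def LocallyContracting {S : Type} (P : C6Presentation S) (α : Set P.Grp)
    (ρ₁ ρ₂ : ℝ → ℝ) : Prop :=
  ∀ (g : P.Grp) (r : Word S), r ∈ P.rels → (relatorCycle P g r ∩ α).Nonempty →
    ContractingIn P.gens (relatorCycle P g r) (relatorCycle P g r ∩ α) ρ₁ ρ₂

/-- The generating set `S ∪ W` of the coned-off space: `W` is the set of elements
represented by subwords of cyclic permutations of relators (equivalently, by prefixes
of relators, since the relator set is closed under cyclic permutation). -/
def conedGens {S : Type} (P : C6Presentation S) : Set P.Grp :=
  P.gens ∪ {x | ∃ r ∈ P.rels, ∃ p : Word S, p <+: r ∧ x = P.elt p}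

/-- The exponential growth rate of `(G,S)`. -/
noncomputable def growthRate {G : Type*} [Group G] (S : Set G) : ℝ :=
  limsup (fun n : ℕ => Real.log (Nat.card {g : G // wordLength S g ≤ n}) / (n : ℝ)) atTop

/-- Quasi-isometry of marked groups `(G,S)` and `(H,T)` via word metrics. -/
def QIsom {G H : Type*} [Group G] [Group H] (S : Set G) (T : Set H) : Prop :=
  ∃ (f : G → H) (L A : ℝ), 1 ≤ L ∧ 0 ≤ A ∧
    (∀ x y : G, L⁻¹ * wdist S x y - A ≤ wdist T (f x) (f y) ∧
      wdist T (f x) (f y) ≤ L * wdist S x y + A) ∧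
    ∀ h : H, ∃ x : G, wdist T (f x) h ≤ A

/-- A subgroup is virtually cyclic if it contains a cyclic subgroup of finite index. -/
def VirtuallyCyclic {G : Type*} [Group G] (E : Subgroup G) : Prop :=
  ∃ g : G, Subgroup.zpowers g ≤ E ∧ ((Subgroup.zpowers g).subgroupOf E).index ≠ 0

end GSC

namespace GSC

open Filter

/-! ### Words and the word metric -/

section

/-- The formal inverse of a letter. -/
def flipLetter {S : Type} (l : S × Bool) : S × Bool := (l.1, !l.2)

@[simp] theorem flipLetter_flipLetter {S : Type} (l : S × Bool) :
    flipLetter (flipLetter l) = l := by simp [flipLetter]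

theorem flipLetter_ne {S : Type} (l : S × Bool) : flipLetter l ≠ l := by
  intro h
  have := congrArg Prod.snd h
  simp [flipLetter] at this

theorem wordInv_eq {S : Type} (w : Word S) : wordInv w = (w.map flipLetter).reverse := rfl

@[simp] theorem wordInv_nil {S : Type} : wordInv ([] : Word S) = [] := rfl

@[simp] theorem wordInv_append {S : Type} (u v : Word S) :
    wordInv (u ++ v) = wordInv v ++ wordInv u := by simp [wordInv_eq]

@[simp] theorem wordInv_cons {S : Type} (l : S × Bool) (v : Word S) :
    wordInv (l :: v) = wordInv v ++ [flipLetter l] := by simp [wordInv_eq]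

@[simp] theorem wordInv_wordInv {S : Type} (w : Word S) : wordInv (wordInv w) = w := by
  induction w with
  | nil => rfl
  | cons l w ih => rw [wordInv_cons, wordInv_append, ih]; simp [wordInv_eq]

@[simp] theorem length_wordInv {S : Type} (w : Word S) : (wordInv w).length = w.length := by
  simp [wordInv_eq]

theorem wordVal_eq_mk {S : Type} (w : Word S) : wordVal w = FreeGroup.mk w := by
  induction w with
  | nil => rfl
  | cons l w ih =>
    have : wordVal (l :: w) = (FreeGroup.of l.1) ^ (if l.2 then (1 : ℤ) else -1) * wordVal w := by
      simp [wordVal]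
    rw [this, ih]
    rcases l with ⟨a, b⟩
    cases b
    · simp only [Bool.false_eq_true, if_false, zpow_neg, zpow_one, FreeGroup.of,
        FreeGroup.inv_mk, FreeGroup.mul_mk]
      rfl
    · simp only [if_true, zpow_one, FreeGroup.of, FreeGroup.mul_mk]
      rfl

theorem wordVal_append {S : Type} (u v : Word S) :
    wordVal (u ++ v) = wordVal u * wordVal v := by simp [wordVal]

theorem wordVal_wordInv {S : Type} (w : Word S) : wordVal (wordInv w) = (wordVal w)⁻¹ := by
  rw [wordVal_eq_mk, wordVal_eq_mk, FreeGroup.inv_mk]; rfl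

namespace C6Presentation

variable {S : Type} (P : C6Presentation S)

/-- The group element represented by a letter. -/
def eltL (l : S × Bool) : P.Grp := (PresentedGroup.of l.1 : P.Grp) ^ (if l.2 then (1 : ℤ) else -1)

theorem eltL_flip (l : S × Bool) : P.eltL (flipLetter l) = (P.eltL l)⁻¹ := by
  rcases l with ⟨a, b⟩
  cases b <;> simp [eltL, flipLetter]

@[simp] theorem elt_nil : P.elt [] = 1 := rfl

@[simp] theorem elt_cons (l : S × Bool) (w : Word S) : P.elt (l :: w) = P.eltL l * P.elt w := by
  simp [elt, eltL]

@[simp] theorem elt_append (u v : Word S) : P.elt (u ++ v) = P.elt u * P.elt v := by simp [elt]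

@[simp] theorem elt_wordInv (w : Word S) : P.elt (wordInv w) = (P.elt w)⁻¹ := by
  induction w with
  | nil => simp
  | cons l w ih => simp [ih, eltL_flip]

theorem elt_eq_mk (w : Word S) : P.elt w = PresentedGroup.mk (wordVal '' P.rels) (wordVal w) := by
  induction w with
  | nil => simp [wordVal]
  | cons l w ih =>
    rw [elt_cons, ih]
    have : wordVal (l :: w) = (FreeGroup.of l.1) ^ (if l.2 then (1 : ℤ) else -1) * wordVal w := by
      simp [wordVal]
    rw [this, map_mul, map_zpow]; rfl

theorem elt_eq_one_iff (w : Word S) :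
    P.elt w = 1 ↔ wordVal w ∈ Subgroup.normalClosure (wordVal '' P.rels) := by
  rw [elt_eq_mk]; exact PresentedGroup.mk_eq_one_iff

theorem elt_rel {r : Word S} (hr : r ∈ P.rels) : P.elt r = 1 := by
  rw [elt_eq_one_iff]; exact Subgroup.subset_normalClosure ⟨r, hr, rfl⟩

theorem elt_surj (g : P.Grp) : ∃ w, P.elt w = g := by
  obtain ⟨x, rfl⟩ := PresentedGroup.mk_surjective _ g
  obtain ⟨w, rfl⟩ := Quot.exists_rep x
  exact ⟨w, by rw [elt_eq_mk, wordVal_eq_mk]; rfl⟩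

/-- Word length with respect to the standard generators. -/
noncomputable def len (g : P.Grp) : ℕ := wordLength P.gens g

theorem exists_list_iff (g : P.Grp) (n : ℕ) :
    (∃ l : List P.Grp, l.length = n ∧ (∀ x ∈ l, x ∈ P.gens ∨ x⁻¹ ∈ P.gens) ∧ l.prod = g) ↔
      ∃ w : Word S, w.length = n ∧ P.elt w = g := by
  constructor
  · rintro ⟨l, rfl, hl, rfl⟩
    induction l with
    | nil => exact ⟨[], rfl, rfl⟩
    | cons x l ih =>
      obtain ⟨w, hw, hw'⟩ := ih (fun y hy => hl y (List.mem_cons_of_mem _ hy))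
      rcases hl x List.mem_cons_self with ⟨a, ha⟩ | ⟨a, ha⟩
      · refine ⟨(a, true) :: w, by simp [hw], ?_⟩
        simp [hw', eltL, ← ha]
      · refine ⟨(a, false) :: w, by simp [hw], ?_⟩
        have : x = (PresentedGroup.of a : P.Grp)⁻¹ := by
          simp only at ha
          rw [ha, inv_inv]
        simp [hw', eltL, this]
  · rintro ⟨w, rfl, rfl⟩
    refine ⟨w.map P.eltL, by simp, ?_, rfl⟩
    intro x hx
    obtain ⟨⟨a, b⟩, -, rfl⟩ := List.mem_map.1 hx
    cases b
    · right; simp [eltL, gens]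
    · left; simp [eltL, gens]

theorem len_eq (g : P.Grp) : P.len g = sInf {n : ℕ | ∃ w : Word S, w.length = n ∧ P.elt w = g} := by
  unfold len wordLength
  congr 1
  ext n
  exact P.exists_list_iff g n

theorem len_elt_le (w : Word S) : P.len (P.elt w) ≤ w.length := by
  rw [len_eq]; exact Nat.sInf_le ⟨w, rfl, rfl⟩

theorem exists_word (g : P.Grp) : ∃ w : Word S, w.length = P.len g ∧ P.elt w = g := by
  have h : {n : ℕ | ∃ w : Word S, w.length = n ∧ P.elt w = g}.Nonempty := by
    obtain ⟨w, hw⟩ := P.elt_surj g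
    exact ⟨_, w, rfl, hw⟩
  have := Nat.sInf_mem h
  rwa [← len_eq] at this

@[simp] theorem len_one : P.len 1 = 0 := by
  simpa using P.len_elt_le []

theorem len_mul_le (g h : P.Grp) : P.len (g * h) ≤ P.len g + P.len h := by
  obtain ⟨u, hu, rfl⟩ := P.exists_word g
  obtain ⟨v, hv, rfl⟩ := P.exists_word h
  rw [← hu, ← hv, ← elt_append, ← List.length_append]
  exact P.len_elt_le _

@[simp] theorem len_inv (g : P.Grp) : P.len g⁻¹ = P.len g := by
  have key : ∀ g : P.Grp, P.len g⁻¹ ≤ P.len g := by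
    intro g
    obtain ⟨u, hu, rfl⟩ := P.exists_word g
    rw [← hu, ← elt_wordInv, ← length_wordInv u]
    exact P.len_elt_le _
  exact le_antisymm (key g) (by simpa using key g⁻¹)

/-- The word metric, with values in `ℕ`. -/
noncomputable def dst (g h : P.Grp) : ℕ := P.len (g⁻¹ * h)

theorem wdist_eq (g h : P.Grp) : wdist P.gens g h = P.dst g h := rfl

@[simp] theorem dst_self (g : P.Grp) : P.dst g g = 0 := by simp [dst]

theorem dst_comm (g h : P.Grp) : P.dst g h = P.dst h g := by
  rw [dst, dst, ← len_inv]; simp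

theorem dst_triangle (g h k : P.Grp) : P.dst g k ≤ P.dst g h + P.dst h k := by
  have := P.len_mul_le (g⁻¹ * h) (h⁻¹ * k)
  simpa [dst, mul_assoc] using this

theorem dst_mul_left (k g h : P.Grp) : P.dst (k * g) (k * h) = P.dst g h := by
  simp [dst, mul_assoc]

theorem dst_mul_elt_le (g : P.Grp) (w : Word S) : P.dst g (g * P.elt w) ≤ w.length := by
  simpa [dst] using P.len_elt_le w

theorem exists_word_dst (g h : P.Grp) :
    ∃ w : Word S, w.length = P.dst g h ∧ g * P.elt w = h := by
  obtain ⟨w, hw, hw'⟩ := P.exists_word (g⁻¹ * h)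
  exact ⟨w, hw, by simp [hw']⟩

end C6Presentation

/-- A word is geodesic if it is a shortest word for the element it represents. -/
def GeoWord {S : Type} (P : C6Presentation S) (w : Word S) : Prop := P.len (P.elt w) = w.length

theorem GeoWord.infix {S : Type} {P : C6Presentation S} {u v x : Word S}
    (h : GeoWord P (u ++ v ++ x)) : GeoWord P v := by
  unfold GeoWord at *
  have h1 := P.len_elt_le u
  have h2 := P.len_elt_le v
  have h3 := P.len_elt_le x
  have h4 := P.len_mul_le (P.elt u * P.elt v) (P.elt x)
  have h5 := P.len_mul_le (P.elt u) (P.elt v)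
  simp only [P.elt_append, List.length_append] at h
  omega

end

/-! ### Combinatorial maps on the sphere -/

section

/-- The data of a labelled combinatorial map: darts and vertices are natural numbers. -/
structure MapData (S G : Type) where
  inv : ℕ → ℕ
  lab : ℕ → S × Bool
  src : ℕ → ℕ
  pos : ℕ → G

/-- `c` is a path of darts from the vertex `a` to the vertex `b`. -/
def MapData.IsPath {S G : Type} (M : MapData S G) : ℕ → List ℕ → ℕ → Prop
  | a, [], b => a = b
  | a, d :: c, b => M.src d = a ∧ M.IsPath (M.src (M.inv d)) c b

theorem MapData.isPath_append {S G : Type} {M : MapData S G} {a b : ℕ} {u v : List ℕ} :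
    M.IsPath a (u ++ v) b ↔ ∃ m, M.IsPath a u m ∧ M.IsPath m v b := by
  induction u generalizing a with
  | nil => simp [IsPath]
  | cons d u ih => simp [IsPath, ih, and_assoc]

theorem MapData.IsPath.map {S G : Type} {M M' : MapData S G} (σ : ℕ → ℕ) {c : List ℕ}
    (h : ∀ d ∈ c, M'.src d = σ (M.src d) ∧ M'.src (M'.inv d) = σ (M.src (M.inv d)))
    {a b : ℕ} (hc : M.IsPath a c b) : M'.IsPath (σ a) c (σ b) := by
  induction c generalizing a with
  | nil => exact congrArg σ hc
  | cons d c ih =>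
    have h1 := h d List.mem_cons_self
    refine ⟨by rw [h1.1, hc.1], ?_⟩
    rw [h1.2]
    exact ih (fun e he => h e (List.mem_cons_of_mem _ he)) hc.2

theorem MapData.IsPath.sum {S G : Type} {M : MapData S G} {ω h : ℕ → ℚ} {c : List ℕ}
    (hω : ∀ d ∈ c, ω d = h (M.src (M.inv d)) - h (M.src d))
    {a b : ℕ} (hc : M.IsPath a c b) : (c.map ω).sum = h b - h a := by
  induction c generalizing a with
  | nil => cases hc; simp
  | cons d c ih =>
    rw [List.map_cons, List.sum_cons, ih (fun e he => hω e (List.mem_cons_of_mem _ he)) hc.2,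
      hω d List.mem_cons_self, hc.1]
    ring

/-- The darts of a collection of cycles. -/
def darts (cs : Multiset (List ℕ)) : Multiset ℕ := cs.bind fun c => (c : Multiset ℕ)

@[simp] theorem darts_zero : darts 0 = 0 := rfl

@[simp] theorem darts_cons (c : List ℕ) (cs : Multiset (List ℕ)) :
    darts (c ::ₘ cs) = (c : Multiset ℕ) + darts cs := by simp [darts]

theorem mem_darts {cs : Multiset (List ℕ)} {d : ℕ} : d ∈ darts cs ↔ ∃ c ∈ cs, d ∈ c := by
  simp [darts]

/-- A spherical map with vertices labelled by elements of the group; `exact` expresses the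
vanishing of the first cohomology. -/
structure IsMap {S : Type} (P : C6Presentation S) (M : MapData S P.Grp)
    (cs : Multiset (List ℕ)) : Prop where
  nodup : (darts cs).Nodup
  inv_mem : ∀ d ∈ darts cs, M.inv d ∈ darts cs
  inv_inv : ∀ d ∈ darts cs, M.inv (M.inv d) = d
  inv_ne : ∀ d ∈ darts cs, M.inv d ≠ d
  lab_inv : ∀ d ∈ darts cs, M.lab (M.inv d) = flipLetter (M.lab d)
  pos_inv : ∀ d ∈ darts cs, M.pos (M.src (M.inv d)) = M.pos (M.src d) * P.eltL (M.lab d)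
  closed : ∀ c ∈ cs, ∃ a, M.IsPath a c a
  exact : ∀ ω : ℕ → ℚ, (∀ d ∈ darts cs, ω (M.inv d) = - ω d) →
    (∀ c ∈ cs, (c.map ω).sum = 0) →
    ∃ h : ℕ → ℚ, ∀ d ∈ darts cs, ω d = h (M.src (M.inv d)) - h (M.src d)

variable {S : Type} {P : C6Presentation S} {M : MapData S P.Grp} {cs : Multiset (List ℕ)}

theorem MapData.IsPath.pos {c : List ℕ}
    (hω : ∀ d ∈ c, M.pos (M.src (M.inv d)) = M.pos (M.src d) * P.eltL (M.lab d))
    {a b : ℕ} (hc : M.IsPath a c b) : M.pos b = M.pos a * P.elt (c.map M.lab) := by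
  induction c generalizing a with
  | nil => cases hc; simp
  | cons d c ih =>
    rw [List.map_cons, P.elt_cons, ih (fun e he => hω e (List.mem_cons_of_mem _ he)) hc.2,
      hω d List.mem_cons_self, hc.1, mul_assoc]

theorem isMap_zero (M : MapData S P.Grp) : IsMap P M 0 := by
  constructor <;> simp

theorem IsMap.of_nil (h : IsMap P M ([] ::ₘ cs)) : IsMap P M cs := by
  obtain ⟨h1, h2, h3, h4, h5, h6, h7, h8⟩ := h
  simp only [darts_cons, Multiset.coe_nil, zero_add] at *
  refine ⟨h1, h2, h3, h4, h5, h6, fun c hc => h7 c (Multiset.mem_cons_of_mem hc), ?_⟩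
  intro ω hω hs
  refine h8 ω hω ?_
  intro c hc
  rcases Multiset.mem_cons.1 hc with rfl | hc
  · simp
  · exact hs c hc

theorem IsMap.add_nil (h : IsMap P M cs) : IsMap P M ([] ::ₘ cs) := by
  obtain ⟨h1, h2, h3, h4, h5, h6, h7, h8⟩ := h
  constructor <;> (try simp only [darts_cons, Multiset.coe_nil, zero_add]) <;> try assumption
  · intro c hc
    rcases Multiset.mem_cons.1 hc with rfl | hc
    · exact ⟨0, rfl⟩
    · exact h7 c hc
  · intro ω hω hs
    exact h8 ω hω (fun c hc => hs c (Multiset.mem_cons_of_mem hc))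

theorem IsMap.rotate {u v : List ℕ} (h : IsMap P M ((u ++ v) ::ₘ cs)) :
    IsMap P M ((v ++ u) ::ₘ cs) := by
  have e : darts ((v ++ u) ::ₘ cs) = darts ((u ++ v) ::ₘ cs) := by
    simp only [darts_cons, ← Multiset.coe_add, add_comm (u : Multiset ℕ)]
  obtain ⟨h1, h2, h3, h4, h5, h6, h7, h8⟩ := h
  constructor <;> (try rw [e]) <;> try assumption
  · intro c hc
    rcases Multiset.mem_cons.1 hc with rfl | hc
    · obtain ⟨a, ha⟩ := h7 _ (Multiset.mem_cons_self _ _)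
      obtain ⟨m, h1, h2⟩ := MapData.isPath_append.1 ha
      exact ⟨m, MapData.isPath_append.2 ⟨a, h2, h1⟩⟩
    · exact h7 c (Multiset.mem_cons_of_mem hc)
  · intro ω hω hs
    refine h8 ω hω ?_
    intro c hc
    rcases Multiset.mem_cons.1 hc with rfl | hc
    · have := hs _ (Multiset.mem_cons_self _ _)
      simp only [List.map_append, List.sum_append] at this ⊢
      linarith
    · exact hs c (Multiset.mem_cons_of_mem hc)

/-- Merging two faces along a common edge. -/
theorem IsMap.merge {d : ℕ} {u v : List ℕ}
    (h : IsMap P M ((d :: u) ::ₘ (M.inv d :: v) ::ₘ cs)) : IsMap P M ((v ++ u) ::ₘ cs) := by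
  obtain ⟨h1, h2, h3, h4, h5, h6, h7, h8⟩ := h
  have hmem : ∀ e, e ∈ darts ((d :: u) ::ₘ (M.inv d :: v) ::ₘ cs) ↔
      e = d ∨ e = M.inv d ∨ e ∈ darts ((v ++ u) ::ₘ cs) := by
    intro e; simp; tauto
  have hd : d ∈ darts ((d :: u) ::ₘ (M.inv d :: v) ::ₘ cs) := (hmem d).2 (Or.inl rfl)
  have hle : darts ((d :: u) ::ₘ (M.inv d :: v) ::ₘ cs) =
      d ::ₘ M.inv d ::ₘ darts ((v ++ u) ::ₘ cs) := by
    simp only [darts_cons, ← Multiset.cons_coe, ← Multiset.coe_add]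
    simp only [Multiset.cons_add, Multiset.add_cons]
    rw [Multiset.cons_swap]
    congr 2
    rw [← add_assoc, add_comm (v : Multiset ℕ)]
  rw [hle] at h1
  have h1' := Multiset.nodup_cons.1 h1
  have h1'' := Multiset.nodup_cons.1 h1'.2
  have hne : ∀ e ∈ darts ((v ++ u) ::ₘ cs), e ≠ d ∧ e ≠ M.inv d := by
    intro e he
    refine ⟨?_, ?_⟩
    · rintro rfl; exact h1'.1 (Multiset.mem_cons_of_mem he)
    · rintro rfl; exact h1''.1 he
  have hsub : ∀ e ∈ darts ((v ++ u) ::ₘ cs), e ∈ darts ((d :: u) ::ₘ (M.inv d :: v) ::ₘ cs) :=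
    fun e he => (hmem e).2 (Or.inr (Or.inr he))
  refine ⟨h1''.2, ?_, fun e he => h3 e (hsub e he), fun e he => h4 e (hsub e he),
    fun e he => h5 e (hsub e he), fun e he => h6 e (hsub e he), ?_, ?_⟩
  · intro e he
    rcases (hmem _).1 (h2 e (hsub e he)) with h | h | h
    · have := h3 e (hsub e he)
      rw [h] at this
      exact absurd this.symm (hne e he).2
    · have := h3 e (hsub e he)
      rw [h, h3 d hd] at this
      exact absurd this.symm (hne e he).1
    · exact h
  · intro c hc
    rcases Multiset.mem_cons.1 hc with rfl | hc
    · obtain ⟨a, ha⟩ := h7 (d :: u) (by simp)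
      obtain ⟨b, hb⟩ := h7 (M.inv d :: v) (by simp)
      refine ⟨a, MapData.isPath_append.2 ⟨b, ?_, ?_⟩⟩
      · have := hb.2
        rw [h3 d hd, ha.1] at this
        exact this
      · have := ha.2
        rw [hb.1] at this
        exact this
    · exact h7 c (by simp [hc])
  · intro ω hω hs
    set s := (v.map ω).sum with hsdef
    let ω' : ℕ → ℚ := fun e => if e = d then s else if e = M.inv d then -s else ω e
    have hid : M.inv d ≠ d := h4 d hd
    have hd1 : ω' d = s := by simp [ω']
    have hd2 : ω' (M.inv d) = -s := by simp [ω', hid]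
    have hold : ∀ e ∈ darts ((v ++ u) ::ₘ cs), ω' e = ω e := by
      intro e he
      have := hne e he
      simp [ω', this.1, this.2]
    have hmap : ∀ c : List ℕ, (∀ e ∈ c, e ∈ darts ((v ++ u) ::ₘ cs)) → c.map ω' = c.map ω := by
      intro c hc
      exact List.map_congr_left (fun e he => hold e (hc e he))
    have hclosed : ∀ e ∈ darts ((v ++ u) ::ₘ cs), M.inv e ∈ darts ((v ++ u) ::ₘ cs) := by
      intro e he
      rcases (hmem _).1 (h2 e (hsub e he)) with h | h | h
      · have := h3 e (hsub e he)
        rw [h] at this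
        exact absurd this.symm (hne e he).2
      · have := h3 e (hsub e he)
        rw [h, h3 d hd] at this
        exact absurd this.symm (hne e he).1
      · exact h
    suffices hx : (∀ e ∈ darts ((d :: u) ::ₘ (M.inv d :: v) ::ₘ cs), ω' (M.inv e) = - ω' e) ∧
        ∀ c ∈ (d :: u) ::ₘ (M.inv d :: v) ::ₘ cs, (c.map ω').sum = 0 by
      obtain ⟨g, hg⟩ := h8 ω' hx.1 hx.2
      exact ⟨g, fun e he => by rw [← hold e he, hg e (hsub e he)]⟩
    constructor
    · intro e he
      rcases (hmem e).1 he with rfl | rfl | he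
      · rw [hd1, hd2]
      · rw [h3 d hd, hd1, hd2, neg_neg]
      · rw [hold e he, hold _ (hclosed e he), hω e he]
    · intro c hc
      have hv : v.map ω' = v.map ω := hmap v (fun e he => by simp [he])
      have hu : u.map ω' = u.map ω := hmap u (fun e he => by simp [he])
      have hsum := hs (v ++ u) (by simp)
      simp only [List.map_append, List.sum_append] at hsum
      rcases Multiset.mem_cons.1 hc with rfl | hc
      · rw [List.map_cons, List.sum_cons, hd1, hu]
        linarith
      · rcases Multiset.mem_cons.1 hc with rfl | hc
        · rw [List.map_cons, List.sum_cons, hd2, hv]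
          linarith
        · rw [hmap c (fun e he => by
            simp only [darts_cons, Multiset.mem_add]
            exact Or.inr (mem_darts.2 ⟨c, hc, he⟩))]
          exact hs c (by simp [hc])

/-- Pinching: cutting a face along a closed subpath. -/
theorem IsMap.pinch {u v : List ℕ} (h : IsMap P M ((u ++ v) ::ₘ cs))
    (hu : P.elt (u.map M.lab) = 1) :
    ∃ M' : MapData S P.Grp, M'.lab = M.lab ∧ IsMap P M' (v ::ₘ u ::ₘ cs) := by
  have e : darts (v ::ₘ u ::ₘ cs) = darts ((u ++ v) ::ₘ cs) := by
    simp only [darts_cons, ← Multiset.coe_add, add_left_comm, add_assoc]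
  obtain ⟨h1, h2, h3, h4, h5, h6, h7, h8⟩ := h
  obtain ⟨m, hm⟩ := h7 (u ++ v) (by simp)
  obtain ⟨m', hm1, hm2⟩ := MapData.isPath_append.1 hm
  have hpos : M.pos m' = M.pos m := by
    rw [hm1.pos (fun d hd => h6 d (by simp [hd])), hu, mul_one]
  let σ : ℕ → ℕ := fun x => if x = m then m' else x
  have hσm : σ m = m' := by simp [σ]
  have hσm' : σ m' = m' := by simp [σ]
  have hσ : ∀ {T : Type} (f : ℕ → T), f m' = f m → ∀ x, f (σ x) = f x := by
    intro T f hf x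
    by_cases hx : x = m
    · subst hx; rw [hσm, hf]
    · simp [σ, hx]
  refine ⟨⟨M.inv, M.lab, fun d => σ (M.src d), M.pos⟩, rfl, ?_⟩
  constructor <;> (try rw [e]) <;> try assumption
  · intro d hd
    simp only [hσ M.pos hpos]
    exact h6 d hd
  · have key : ∀ {a b : ℕ} {c : List ℕ}, M.IsPath a c b → MapData.IsPath
        (⟨M.inv, M.lab, fun d => σ (M.src d), M.pos⟩ : MapData S P.Grp) (σ a) c (σ b) :=
      fun hc => MapData.IsPath.map σ (fun d _ => ⟨rfl, rfl⟩) hc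
    intro c hc
    rcases Multiset.mem_cons.1 hc with rfl | hc
    · exact ⟨m', by simpa [hσm, hσm'] using key hm2⟩
    · rcases Multiset.mem_cons.1 hc with rfl | hc
      · exact ⟨m', by simpa [hσm, hσm'] using key hm1⟩
      · obtain ⟨a, ha⟩ := h7 c (by simp [hc])
        exact ⟨σ a, key ha⟩
  · intro ω hω hs
    obtain ⟨g, hg⟩ := h8 ω hω (by
      intro c hc
      rcases Multiset.mem_cons.1 hc with rfl | hc
      · rw [List.map_append, List.sum_append, hs u (by simp), hs v (by simp), add_zero]
      · exact hs c (by simp [hc]))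
    have hgm : g m' = g m := by
      have := hm1.sum (fun d hd => hg d (by simp [hd]))
      rw [hs u (by simp)] at this
      linarith
    exact ⟨g, fun d hd => by simp only [hσ g hgm]; exact hg d hd⟩

end

/-! ### Folding and spurs -/

section

variable {S : Type} {P : C6Presentation S} {M : MapData S P.Grp} {cs : Multiset (List ℕ)}

theorem IsMap.inv_inj (h : IsMap P M cs) {d e : ℕ} (hd : d ∈ darts cs) (he : e ∈ darts cs)
    (hde : M.inv d = M.inv e) : d = e := by
  rw [← h.inv_inv d hd, hde, h.inv_inv e he]

/-- Folding two consecutive darts with inverse labels. -/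
theorem IsMap.fold {x y : ℕ} {v : List ℕ} (h : IsMap P M ((x :: y :: v) ::ₘ cs))
    (hl : M.lab y = flipLetter (M.lab x)) :
    ∃ M' : MapData S P.Grp, M'.lab = M.lab ∧ IsMap P M' (v ::ₘ cs) := by
  have hle : darts ((x :: y :: v) ::ₘ cs) = x ::ₘ y ::ₘ darts (v ::ₘ cs) := by
    simp only [darts_cons, ← Multiset.cons_coe, Multiset.cons_add]
  have hinj := fun d e => @h.inv_inj S P M _ d e
  obtain ⟨h1, h2, h3, h4, h5, h6, h7, h8⟩ := h
  rw [hle] at h1 h2 h3 h4 h5 h6 h8 hinj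
  have h1' := Multiset.nodup_cons.1 h1
  have h1'' := Multiset.nodup_cons.1 h1'.2
  have hxy : x ≠ y := by rintro rfl; exact h1'.1 (by simp)
  have hne : ∀ e ∈ darts (v ::ₘ cs), e ≠ x ∧ e ≠ y := by
    intro e he
    refine ⟨?_, ?_⟩
    · rintro rfl; exact h1'.1 (Multiset.mem_cons_of_mem he)
    · rintro rfl; exact h1''.1 he
  have hsub : ∀ e ∈ darts (v ::ₘ cs), e ∈ x ::ₘ y ::ₘ darts (v ::ₘ cs) :=
    fun e he => Multiset.mem_cons_of_mem (Multiset.mem_cons_of_mem he)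
  have hx : x ∈ x ::ₘ y ::ₘ darts (v ::ₘ cs) := by simp
  have hy : y ∈ x ::ₘ y ::ₘ darts (v ::ₘ cs) := by simp
  have hmem : ∀ e, e ∈ x ::ₘ y ::ₘ darts (v ::ₘ cs) → e = x ∨ e = y ∨ e ∈ darts (v ::ₘ cs) := by
    intro e he; simpa using he
  obtain ⟨a, ha⟩ := h7 (x :: y :: v) (by simp)
  obtain ⟨hax, hay, hav⟩ := ha
  have hcs : ∀ c ∈ v ::ₘ cs, ∀ e ∈ c, e ∈ darts (v ::ₘ cs) :=
    fun c hc e he => mem_darts.2 ⟨c, hc, he⟩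
  by_cases hc : M.inv x = y
  · have hcy : M.inv y = x := by rw [← hc, h3 x hx]
    have hcl : ∀ e ∈ darts (v ::ₘ cs), M.inv e ∈ darts (v ::ₘ cs) := by
      intro e he
      rcases hmem _ (h2 e (hsub e he)) with h | h | h
      · exact absurd (hinj e y (hsub e he) hy (by rw [h, hcy])) (hne e he).2
      · exact absurd (hinj e x (hsub e he) hx (by rw [h, hc])) (hne e he).1
      · exact h
    refine ⟨M, rfl, h1''.2, hcl, fun e he => h3 e (hsub e he), fun e he => h4 e (hsub e he),
      fun e he => h5 e (hsub e he), fun e he => h6 e (hsub e he), ?_, ?_⟩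
    · intro c hc'
      rcases Multiset.mem_cons.1 hc' with rfl | hc'
      · rw [hcy, hax] at hav
        exact ⟨a, hav⟩
      · exact h7 c (by simp [hc'])
    · intro ω hω hs
      let ω' : ℕ → ℚ := fun e => if e = x ∨ e = y then 0 else ω e
      have hold : ∀ e ∈ darts (v ::ₘ cs), ω' e = ω e := by
        intro e he
        have := hne e he
        simp [ω', this.1, this.2]
      have hx0 : ω' x = 0 := by simp [ω']
      have hy0 : ω' y = 0 := by simp [ω']
      have hmap : ∀ c ∈ v ::ₘ cs, (c.map ω').sum = 0 := by
        intro c hc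
        rw [List.map_congr_left (fun e he => hold e (hcs c hc e he)), hs c hc]
      obtain ⟨g, hg⟩ := h8 ω' (by
        intro e he
        rcases hmem e he with rfl | rfl | he
        · rw [hc, hx0, hy0, neg_zero]
        · rw [hcy, hx0, hy0, neg_zero]
        · rw [hold e he, hold _ (hcl e he), hω e he]) (by
        intro c hc
        rcases Multiset.mem_cons.1 hc with rfl | hc
        · simp [hx0, hy0, hmap v (by simp)]
        · exact hmap c (by simp [hc]))
      exact ⟨g, fun e he => by rw [← hold e he, hg e (hsub e he)]⟩
  · have hcy : M.inv y ≠ x := by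
      intro hh; apply hc; rw [← hh, h3 y hy]
    set b := M.src (M.inv y) with hb
    have hix : M.inv x ∈ darts (v ::ₘ cs) := by
      rcases hmem _ (h2 x hx) with h | h | h
      · exact absurd h (h4 x hx)
      · exact absurd h hc
      · exact h
    have hiy : M.inv y ∈ darts (v ::ₘ cs) := by
      rcases hmem _ (h2 y hy) with h | h | h
      · exact absurd h hcy
      · exact absurd h (h4 y hy)
      · exact h
    have hixy : M.inv x ≠ M.inv y := fun hh => hxy (hinj x y hx hy hh)
    have hother : ∀ e ∈ darts (v ::ₘ cs), e ≠ M.inv x → e ≠ M.inv y →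
        M.inv e ∈ darts (v ::ₘ cs) ∧ M.inv e ≠ M.inv x ∧ M.inv e ≠ M.inv y := by
      intro e he he1 he2
      refine ⟨?_, ?_, ?_⟩
      · rcases hmem _ (h2 e (hsub e he)) with h | h | h
        · exact absurd (by rw [← h, h3 e (hsub e he)]) he1
        · exact absurd (by rw [← h, h3 e (hsub e he)]) he2
        · exact h
      · intro hh; exact (hne e he).1 (hinj _ _ (hsub e he) hx hh)
      · intro hh; exact (hne e he).2 (hinj _ _ (hsub e he) hy hh)
    have hpos : M.pos b = M.pos a := by
      rw [hb, h6 y hy, hay, h6 x hx, hl, P.eltL_flip, hax, mul_inv_cancel_right]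
    let σ : ℕ → ℕ := fun z => if z = a then b else z
    have hσa : σ a = b := by simp [σ]
    have hσb : σ b = b := by simp [σ]
    have hσ : ∀ {T : Type} (f : ℕ → T), f b = f a → ∀ z, f (σ z) = f z := by
      intro T f hf z
      by_cases hz : z = a
      · subst hz; rw [hσa, hf]
      · simp [σ, hz]
    let M' : MapData S P.Grp := ⟨fun d => if d = M.inv x then M.inv y else
      if d = M.inv y then M.inv x else M.inv d, M.lab, fun d => σ (M.src d), M.pos⟩
    have hi1 : M'.inv (M.inv x) = M.inv y := by simp [M']
    have hi2 : M'.inv (M.inv y) = M.inv x := by simp [M', hixy.symm]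
    have hi3 : ∀ e, e ≠ M.inv x → e ≠ M.inv y → M'.inv e = M.inv e := by
      intro e h1 h2; simp [M', h1, h2]
    have htgt : ∀ e ∈ darts (v ::ₘ cs), M'.src (M'.inv e) = σ (M.src (M.inv e)) := by
      intro e he
      by_cases he1 : e = M.inv x
      · subst he1
        rw [hi1, h3 x hx, hax, hσa]; exact hσb
      · by_cases he2 : e = M.inv y
        · subst he2
          rw [hi2, h3 y hy, hay]
        · rw [hi3 e he1 he2]
    have hpath : ∀ c ∈ v ::ₘ cs, ∀ {p q : ℕ}, M.IsPath p c q → M'.IsPath (σ p) c (σ q) :=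
      fun c hc p q hp => MapData.IsPath.map σ
        (fun d hd => ⟨rfl, htgt d (hcs c hc d hd)⟩) hp
    refine ⟨M', rfl, h1''.2, ?_, ?_, ?_, ?_, ?_, ?_, ?_⟩
    · intro e he
      by_cases he1 : e = M.inv x
      · rw [he1, hi1]; exact hiy
      · by_cases he2 : e = M.inv y
        · rw [he2, hi2]; exact hix
        · rw [hi3 e he1 he2]; exact (hother e he he1 he2).1
    · intro e he
      by_cases he1 : e = M.inv x
      · rw [he1, hi1, hi2]
      · by_cases he2 : e = M.inv y
        · rw [he2, hi2, hi1]
        · have := hother e he he1 he2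
          rw [hi3 e he1 he2, hi3 _ this.2.1 this.2.2, h3 e (hsub e he)]
    · intro e he
      by_cases he1 : e = M.inv x
      · rw [he1, hi1]; exact hixy.symm
      · by_cases he2 : e = M.inv y
        · rw [he2, hi2]; exact hixy
        · rw [hi3 e he1 he2]; exact h4 e (hsub e he)
    · intro e he
      show M.lab (M'.inv e) = flipLetter (M.lab e)
      by_cases he1 : e = M.inv x
      · rw [he1, hi1, h5 y hy, h5 x hx, hl]
      · by_cases he2 : e = M.inv y
        · rw [he2, hi2, h5 y hy, h5 x hx, hl]; simp
        · rw [hi3 e he1 he2]; exact h5 e (hsub e he)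
    · intro e he
      rw [htgt e he]
      show M.pos (σ _) = M.pos (σ _) * _
      rw [hσ M.pos hpos, hσ M.pos hpos]
      exact h6 e (hsub e he)
    · intro c hc'
      rcases Multiset.mem_cons.1 hc' with rfl | hc''
      · have := hpath c hc' hav
        rw [hσa] at this
        rw [show σ (M.src (M.inv y)) = b from hσb] at this
        exact ⟨b, this⟩
      · obtain ⟨p, hp⟩ := h7 c (by simp [hc''])
        exact ⟨σ p, hpath c hc' hp⟩
    · intro ω hω hs
      let ω' : ℕ → ℚ := fun e => if e = x then - ω (M.inv x) else
        if e = y then - ω (M.inv y) else ω e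
      have hold : ∀ e ∈ darts (v ::ₘ cs), ω' e = ω e := by
        intro e he
        have := hne e he
        simp [ω', this.1, this.2]
      have hx0 : ω' x = - ω (M.inv x) := by simp [ω']
      have hy0 : ω' y = - ω (M.inv y) := by simp [ω', hxy.symm]
      have hxy0 : ω' x + ω' y = 0 := by
        have := hω _ hix
        rw [hi1] at this
        rw [hx0, hy0, this]; ring
      have hmap : ∀ c ∈ v ::ₘ cs, (c.map ω').sum = 0 := by
        intro c hc
        rw [List.map_congr_left (fun e he => hold e (hcs c hc e he)), hs c hc]
      obtain ⟨g, hg⟩ := h8 ω' (by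
        intro e he
        rcases hmem e he with rfl | rfl | he
        · rw [hold _ hix, hx0, neg_neg]
        · rw [hold _ hiy, hy0, neg_neg]
        · by_cases he1 : e = M.inv x
          · rw [he1, h3 x hx, hx0, hold _ hix]
          · by_cases he2 : e = M.inv y
            · rw [he2, h3 y hy, hy0, hold _ hiy]
            · have := hω e he
              rw [hi3 e he1 he2] at this
              rw [hold e he, hold _ (hother e he he1 he2).1, this]) (by
        intro c hc
        rcases Multiset.mem_cons.1 hc with rfl | hc
        · rw [List.map_cons, List.map_cons, List.sum_cons, List.sum_cons, ← add_assoc, hxy0,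
            hmap v (by simp), zero_add]
        · exact hmap c (by simp [hc]))
      have hgab : g b = g a := by
        have e1 := hg x hx
        have e2 := hg y hy
        rw [hay, ← hb] at e2
        rw [hax] at e1
        linarith
      refine ⟨g, fun e he => ?_⟩
      rw [htgt e he]
      show _ = g (σ _) - g (σ _)
      rw [hσ g hgab, hσ g hgab, ← hold e he, hg e (hsub e he)]

/-- Inserting a spur. -/
theorem IsMap.spur {v : List ℕ} (h : IsMap P M (v ::ₘ cs)) (l : S × Bool) :
    ∃ (M' : MapData S P.Grp) (x y : ℕ), M'.lab x = l ∧ M'.lab y = flipLetter l ∧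
      (∀ d ∈ darts (v ::ₘ cs), M'.lab d = M.lab d) ∧ IsMap P M' ((x :: y :: v) ::ₘ cs) := by
  obtain ⟨h1, h2, h3, h4, h5, h6, h7, h8⟩ := h
  obtain ⟨m, hm⟩ := h7 v (by simp)
  set T : ℕ := (darts (v ::ₘ cs)).toFinset.sum (fun d => d + M.src d) + m + 1 with hT
  have hbd : ∀ d ∈ darts (v ::ₘ cs), d < T ∧ M.src d < T := by
    intro d hd
    have := Finset.single_le_sum (f := fun d => d + M.src d) (fun i _ => Nat.zero_le _)
      (Multiset.mem_toFinset.2 hd)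
    omega
  have hmT : m < T := by omega
  have hle : darts ((T :: (T + 1) :: v) ::ₘ cs) = T ::ₘ (T + 1) ::ₘ darts (v ::ₘ cs) := by
    simp only [darts_cons, ← Multiset.cons_coe, Multiset.cons_add]
  let M' : MapData S P.Grp :=
    ⟨fun d => if d = T then T + 1 else if d = T + 1 then T else M.inv d,
     fun d => if d = T then l else if d = T + 1 then flipLetter l else M.lab d,
     fun d => if d = T then m else if d = T + 1 then T else M.src d,
     fun p => if p = T then M.pos m * P.eltL l else M.pos p⟩
  have hold : ∀ d ∈ darts (v ::ₘ cs), M'.inv d = M.inv d ∧ M'.lab d = M.lab d ∧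
      M'.src d = M.src d ∧ M'.pos (M.src d) = M.pos (M.src d) := by
    intro d hd
    have := hbd d hd
    have e1 : d ≠ T := by omega
    have e2 : d ≠ T + 1 := by omega
    have e3 : M.src d ≠ T := by omega
    simp [M', e1, e2, e3]
  have i1 : M'.inv T = T + 1 := by simp [M']
  have i2 : M'.inv (T + 1) = T := by simp [M']
  have l1 : M'.lab T = l := by simp [M']
  have l2 : M'.lab (T + 1) = flipLetter l := by simp [M']
  have s1 : M'.src T = m := by simp [M']
  have s2 : M'.src (T + 1) = T := by simp [M']
  have p1 : M'.pos T = M.pos m * P.eltL l := by simp [M']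
  have p2 : M'.pos m = M.pos m := by simp [M', hmT.ne]
  have hmem : ∀ e, e ∈ T ::ₘ (T + 1) ::ₘ darts (v ::ₘ cs) →
      e = T ∨ e = T + 1 ∨ e ∈ darts (v ::ₘ cs) := by
    intro e he; simpa using he
  have hsub : ∀ e ∈ darts (v ::ₘ cs), e ∈ T ::ₘ (T + 1) ::ₘ darts (v ::ₘ cs) :=
    fun e he => Multiset.mem_cons_of_mem (Multiset.mem_cons_of_mem he)
  have hcs : ∀ c ∈ v ::ₘ cs, ∀ e ∈ c, e ∈ darts (v ::ₘ cs) :=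
    fun c hc e he => mem_darts.2 ⟨c, hc, he⟩
  have htgt : ∀ e ∈ darts (v ::ₘ cs), M'.src (M'.inv e) = M.src (M.inv e) := by
    intro e he
    rw [(hold e he).1, (hold _ (h2 e he)).2.2.1]
  have hpath : ∀ c ∈ v ::ₘ cs, ∀ {p q : ℕ}, M.IsPath p c q → M'.IsPath p c q :=
    fun c hc p q hp => MapData.IsPath.map (M' := M') id
      (fun d hd => ⟨(hold d (hcs c hc d hd)).2.2.1, htgt d (hcs c hc d hd)⟩) hp
  refine ⟨M', T, T + 1, l1, l2, fun d hd => (hold d hd).2.1, ?_⟩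
  constructor <;> (try rw [hle])
  · rw [Multiset.nodup_cons, Multiset.nodup_cons]
    refine ⟨?_, ?_, h1⟩
    · intro hh
      rcases Multiset.mem_cons.1 hh with hh | hh
      · omega
      · exact absurd (hbd _ hh).1 (lt_irrefl _)
    · intro hh
      have := (hbd _ hh).1
      omega
  · intro e he
    rcases hmem e he with rfl | rfl | he
    · rw [i1]; simp
    · rw [i2]; simp
    · rw [(hold e he).1]; exact hsub _ (h2 e he)
  · intro e he
    rcases hmem e he with rfl | rfl | he
    · rw [i1, i2]
    · rw [i2, i1]
    · rw [(hold e he).1, (hold _ (h2 e he)).1, h3 e he]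
  · intro e he
    rcases hmem e he with rfl | rfl | he
    · rw [i1]; omega
    · rw [i2]; omega
    · rw [(hold e he).1]; exact h4 e he
  · intro e he
    rcases hmem e he with rfl | rfl | he
    · rw [i1, l1, l2]
    · rw [i2, l1, l2, flipLetter_flipLetter]
    · rw [(hold e he).1, (hold _ (h2 e he)).2.1, (hold e he).2.1, h5 e he]
  · intro e he
    rcases hmem e he with rfl | rfl | he
    · rw [i1, s1, s2, l1, p1, p2]
    · rw [i2, s1, s2, l2, p1, p2, P.eltL_flip, mul_inv_cancel_right]
    · rw [htgt e he, (hold _ (h2 e he)).2.2.2, (hold e he).2.2.1, (hold e he).2.2.2,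
        (hold e he).2.1, h6 e he]
  · intro c hc
    rcases Multiset.mem_cons.1 hc with rfl | hc
    · refine ⟨m, s1, ?_, ?_⟩
      · rw [i1]
      · rw [i2, s1]; exact hpath v (by simp) hm
    · obtain ⟨a, ha⟩ := h7 c (by simp [hc])
      exact ⟨a, hpath c (by simp [hc]) ha⟩
  · intro ω hω hs
    obtain ⟨g, hg⟩ := h8 ω (fun d hd => by
        have := hω d (hsub d hd)
        rwa [(hold d hd).1] at this) (by
      intro c hc
      rcases Multiset.mem_cons.1 hc with rfl | hc
      · have e1 := hs (T :: (T + 1) :: c) (by simp)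
        have e2 := hω T (by simp)
        rw [i1] at e2
        simp only [List.map_cons, List.sum_cons] at e1
        linarith
      · exact hs c (by simp [hc]))
    refine ⟨fun p => if p = T then g m + ω T else g p, ?_⟩
    intro e he
    have hmT' : m ≠ T := hmT.ne
    rcases hmem e he with rfl | rfl | he
    · simp only [i1, s1, s2, hmT', if_true, if_false]; ring
    · have e2 := hω T (by simp)
      rw [i1] at e2
      simp only [i2, s1, s2, hmT', if_true, if_false, e2]; ring
    · have e1 : M.src e ≠ T := (hbd e he).2.ne
      have e2 : M.src (M.inv e) ≠ T := (hbd _ (h2 e he)).2.ne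
      simp only [htgt e he, (hold e he).2.2.1, e1, e2, if_false]
      exact hg e he

end

/-! ### Van Kampen's lemma -/

section

variable {S : Type} {P : C6Presentation S}

/-- A multiset of words is realizable if it is the multiset of face labels of a spherical map. -/
def Realizable (P : C6Presentation S) (W : Multiset (Word S)) : Prop :=
  ∃ (M : MapData S P.Grp) (cs : Multiset (List ℕ)), IsMap P M cs ∧ cs.map (List.map M.lab) = W

theorem realizable_cons {w : Word S} {W : Multiset (Word S)} :
    Realizable P (w ::ₘ W) ↔ ∃ (M : MapData S P.Grp) (c : List ℕ) (cs : Multiset (List ℕ)),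
      IsMap P M (c ::ₘ cs) ∧ c.map M.lab = w ∧ cs.map (List.map M.lab) = W := by
  constructor
  · rintro ⟨M, cs, h, he⟩
    obtain ⟨c, hc, hcw, hcs⟩ := (Multiset.map_eq_cons _ _ _ _).2 he
    refine ⟨M, c, cs.erase c, ?_, hcw, hcs⟩
    rwa [Multiset.cons_erase hc]
  · rintro ⟨M, c, cs, h, rfl, rfl⟩
    exact ⟨M, _, h, by simp⟩

theorem Realizable.rotate {u v : Word S} {W : Multiset (Word S)}
    (h : Realizable P ((u ++ v) ::ₘ W)) : Realizable P ((v ++ u) ::ₘ W) := by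
  obtain ⟨M, c, cs, hm, hc, rfl⟩ := realizable_cons.1 h
  obtain ⟨c₁, c₂, rfl, rfl, rfl⟩ := List.map_eq_append_iff.1 hc
  exact realizable_cons.2 ⟨M, _, cs, hm.rotate, by simp, rfl⟩

theorem Realizable.of_nil {W : Multiset (Word S)}
    (h : Realizable P ([] ::ₘ W)) : Realizable P W := by
  obtain ⟨M, c, cs, hm, hc, rfl⟩ := realizable_cons.1 h
  rw [List.map_eq_nil_iff] at hc
  subst hc
  exact ⟨M, cs, hm.of_nil, rfl⟩

theorem Realizable.fold_head {v : Word S} {l : S × Bool} {W : Multiset (Word S)}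
    (h : Realizable P ((l :: flipLetter l :: v) ::ₘ W)) : Realizable P (v ::ₘ W) := by
  obtain ⟨M, c, cs, hm, hc, rfl⟩ := realizable_cons.1 h
  obtain ⟨x, c, rfl, hx, hc⟩ := List.map_eq_cons_iff.1 hc
  obtain ⟨y, c, rfl, hy, rfl⟩ := List.map_eq_cons_iff.1 hc
  obtain ⟨M', hM', h'⟩ := hm.fold (by rw [hx, hy])
  exact realizable_cons.2 ⟨M', c, cs, h', by rw [hM'], by rw [hM']⟩

theorem Realizable.spur_head {v : Word S} (l : S × Bool) {W : Multiset (Word S)}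
    (h : Realizable P (v ::ₘ W)) : Realizable P ((l :: flipLetter l :: v) ::ₘ W) := by
  obtain ⟨M, c, cs, hm, rfl, rfl⟩ := realizable_cons.1 h
  obtain ⟨M', x, y, hx, hy, hM', h'⟩ := hm.spur l
  refine realizable_cons.2 ⟨M', _, cs, h', ?_, ?_⟩
  · simp only [List.map_cons, hx, hy]
    congr 2
    exact List.map_congr_left (fun d hd => hM' d (by simp [hd]))
  · refine Multiset.map_congr rfl (fun c' hc' => ?_)
    exact List.map_congr_left (fun d hd => hM' d (by
      simp only [darts_cons, Multiset.mem_add]; exact Or.inr (mem_darts.2 ⟨c', hc', hd⟩)))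

theorem Realizable.pinch_head {u v : Word S} {W : Multiset (Word S)}
    (h : Realizable P ((u ++ v) ::ₘ W)) (hu : P.elt u = 1) :
    Realizable P (v ::ₘ u ::ₘ W) := by
  obtain ⟨M, c, cs, hm, hc, rfl⟩ := realizable_cons.1 h
  obtain ⟨c₁, c₂, rfl, rfl, rfl⟩ := List.map_eq_append_iff.1 hc
  obtain ⟨M', hM', h'⟩ := hm.pinch hu
  exact ⟨M', _, h', by simp [hM']⟩

theorem Realizable.fold {u v : Word S} {l : S × Bool} {W : Multiset (Word S)}
    (h : Realizable P ((u ++ l :: flipLetter l :: v) ::ₘ W)) : Realizable P ((u ++ v) ::ₘ W) := by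
  have h1 := h.rotate
  simp only [List.cons_append] at h1
  exact h1.fold_head.rotate

theorem Realizable.spur {u v : Word S} (l : S × Bool) {W : Multiset (Word S)}
    (h : Realizable P ((u ++ v) ::ₘ W)) : Realizable P ((u ++ l :: flipLetter l :: v) ::ₘ W) := by
  have h1 := h.rotate.spur_head l
  simp only [← List.cons_append] at h1
  exact h1.rotate

theorem Realizable.fold_word {u v w : Word S} {W : Multiset (Word S)}
    (h : Realizable P ((u ++ (w ++ wordInv w) ++ v) ::ₘ W)) : Realizable P ((u ++ v) ::ₘ W) := by
  induction w generalizing u v with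
  | nil => simpa using h
  | cons l w ih =>
    have h1 : Realizable P (((u ++ [l]) ++ (w ++ wordInv w) ++ ([flipLetter l] ++ v)) ::ₘ W) := by
      simpa using h
    have h2 := ih h1
    simp only [List.append_assoc, List.singleton_append] at h2
    exact h2.fold

theorem Realizable.spur_word {u v : Word S} (w : Word S) {W : Multiset (Word S)}
    (h : Realizable P ((u ++ v) ::ₘ W)) : Realizable P ((u ++ (w ++ wordInv w) ++ v) ::ₘ W) := by
  induction w generalizing u v with
  | nil => simpa using h
  | cons l w ih =>
    have h2 := ih (u := u ++ [l]) (v := [flipLetter l] ++ v) (by simpa using h.spur l)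
    simpa using h2

theorem Realizable.of_step {u v : Word S} {W : Multiset (Word S)} (hs : FreeGroup.Red.Step u v) :
    Realizable P (u ::ₘ W) ↔ Realizable P (v ::ₘ W) := by
  cases hs with
  | @not L₁ L₂ x b => exact ⟨fun h => h.fold (l := (x, b)), fun h => h.spur (x, b)⟩

theorem Realizable.of_red {u v : Word S} {W : Multiset (Word S)} (hs : FreeGroup.Red u v) :
    Realizable P (u ::ₘ W) ↔ Realizable P (v ::ₘ W) := by
  induction hs with
  | refl => rfl
  | tail _ h ih => exact ih.trans (of_step h)

theorem Realizable.of_wordVal {u v : Word S} {W : Multiset (Word S)}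
    (huv : wordVal u = wordVal v) (h : Realizable P (u ::ₘ W)) : Realizable P (v ::ₘ W) := by
  rw [wordVal_eq_mk, wordVal_eq_mk] at huv
  obtain ⟨w, h1, h2⟩ := FreeGroup.Red.exact.1 huv
  exact (of_red h2).2 ((of_red h1).1 h)

/-- Every element of the normal closure bounds a spherical map. -/
theorem exists_realizable [Nonempty S] {R₀ : Set (Word S)} (hR : R₀ ⊆ P.rels)
    (hinv : ∀ r ∈ R₀, wordInv r ∈ R₀) {w : Word S}
    (hw : wordVal w ∈ Subgroup.normalClosure (wordVal '' R₀)) :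
    ∃ W : Multiset (Word S), (∀ r ∈ W, r ∈ R₀) ∧ Realizable P (w ::ₘ W) := by
  suffices h : ∀ x ∈ Subgroup.normalClosure (wordVal '' R₀), ∀ w : Word S, wordVal w = x →
      ∃ W : Multiset (Word S), (∀ r ∈ W, r ∈ R₀) ∧ Realizable P (w ::ₘ W) from h _ hw w rfl
  have step : ∀ (x : FreeGroup S) (g r : Word S), r ∈ R₀ →
      (∀ w : Word S, wordVal w = x →
        ∃ W : Multiset (Word S), (∀ r ∈ W, r ∈ R₀) ∧ Realizable P (w ::ₘ W)) →
      ∀ w : Word S, wordVal w = x * (wordVal g * wordVal r * (wordVal g)⁻¹) →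
        ∃ W : Multiset (Word S), (∀ r ∈ W, r ∈ R₀) ∧ Realizable P (w ::ₘ W) := by
    intro x g r hr ih w hw
    obtain ⟨u, rfl⟩ : ∃ u : Word S, wordVal u = x := by
      obtain ⟨u, rfl⟩ := Quot.exists_rep x
      exact ⟨u, wordVal_eq_mk u⟩
    obtain ⟨W, hW, hreal⟩ := ih u rfl
    refine ⟨wordInv r ::ₘ W, ?_, ?_⟩
    · intro s hs
      rcases Multiset.mem_cons.1 hs with rfl | hs
      · exact hinv r hr
      · exact hW s hs
    · have h1 : Realizable P ((u ++ g ++ r ++ wordInv r ++ wordInv g) ::ₘ W) := by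
        have h0 : Realizable P ((u ++ []) ::ₘ W) := by simpa using hreal
        have h2 : Realizable P (((u ++ g) ++ wordInv g) ::ₘ W) := by
          simpa using h0.spur_word g
        simpa using h2.spur_word r
      have h3 : Realizable P ((wordInv r ++ (wordInv g ++ (u ++ g ++ r))) ::ₘ W) := by
        have h1' : Realizable P (((u ++ g ++ r) ++ (wordInv r ++ wordInv g)) ::ₘ W) := by
          simpa using h1
        simpa using h1'.rotate
      have h4 := h3.pinch_head (by rw [P.elt_wordInv, P.elt_rel (hR hr), inv_one])
      refine Realizable.of_wordVal ?_ h4.rotate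
      rw [hw]
      simp only [wordVal_append, wordVal_wordInv, mul_assoc]
  intro x hx
  unfold Subgroup.normalClosure at hx
  induction hx using Subgroup.closure_induction_right with
  | one =>
    intro w hw
    refine ⟨0, by simp, ?_⟩
    have h0 : Realizable P (([] : Word S) ::ₘ 0) := by
      refine ⟨⟨id, fun _ => (Classical.arbitrary S, true), id, fun _ => 1⟩, [] ::ₘ 0, (isMap_zero _).add_nil, by simp⟩
    exact h0.of_wordVal (by rw [hw]; rfl)
  | mul_right x hx y hy ih =>
    obtain ⟨z, ⟨r, hr, rfl⟩, hz⟩ := Group.mem_conjugatesOfSet_iff.1 hy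
    obtain ⟨g, rfl⟩ := isConj_iff.1 hz
    obtain ⟨g, rfl⟩ := Quot.exists_rep g
    rw [show (Quot.mk _ g : FreeGroup S) = wordVal g from (wordVal_eq_mk g).symm]
    exact step x g r hr ih
  | mul_inv_cancel x hx y hy ih =>
    obtain ⟨z, ⟨r, hr, rfl⟩, hz⟩ := Group.mem_conjugatesOfSet_iff.1 hy
    obtain ⟨g, rfl⟩ := isConj_iff.1 hz
    obtain ⟨g, rfl⟩ := Quot.exists_rep g
    rw [show (Quot.mk _ g : FreeGroup S) = wordVal g from (wordVal_eq_mk g).symm]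
    have := step x g (wordInv r) (hinv r hr) ih
    rw [wordVal_wordInv] at this
    simpa [mul_assoc] using this

end

/-! ### Euler's inequality -/

section

variable {S : Type} {P : C6Presentation S} {M : MapData S P.Grp} {cs : Multiset (List ℕ)}

theorem sum_map_darts {R : Type} [AddCommMonoid R] (ω : ℕ → R) (cs : Multiset (List ℕ)) :
    ((darts cs).map ω).sum = (cs.map fun c => (c.map ω).sum).sum := by
  induction cs using Multiset.induction_on with
  | empty => simp
  | cons c cs ih => simp [ih]

theorem IsMap.sum_darts_eq_zero (h : IsMap P M cs) {ω : ℕ → ℚ}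
    (hω : ∀ d ∈ darts cs, ω (M.inv d) = - ω d) :
    (cs.map fun c => (c.map ω).sum).sum = 0 := by
  rw [← sum_map_darts]
  have e : ((darts cs).map ω).sum = ∑ d ∈ (darts cs).toFinset, ω d := by
    rw [Finset.sum_eq_multiset_sum, Multiset.toFinset_val, Multiset.dedup_eq_self.2 h.nodup]
  rw [e]
  refine Finset.sum_involution (fun d _ => M.inv d) ?_ ?_ ?_ ?_
  · intro d hd
    rw [hω d (Multiset.mem_toFinset.1 hd)]; ring
  · intro d hd _
    exact h.inv_ne d (Multiset.mem_toFinset.1 hd)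
  · intro d hd
    exact Multiset.mem_toFinset.2 (h.inv_mem d (Multiset.mem_toFinset.1 hd))
  · intro d hd
    exact h.inv_inv d (Multiset.mem_toFinset.1 hd)

theorem IsMap.card_half (h : IsMap P M cs) :
    2 * ((darts cs).toFinset.filter fun d => d < M.inv d).card = Multiset.card (darts cs) := by
  have e : Multiset.card (darts cs) = (darts cs).toFinset.card := by
    rw [Multiset.toFinset_card_of_nodup h.nodup]
  rw [e, ← Finset.card_filter_add_card_filter_not (s := (darts cs).toFinset)
    (fun d => d < M.inv d), two_mul]
  congr 1
  refine Finset.card_bij' (fun d _ => M.inv d) (fun d _ => M.inv d) ?_ ?_ ?_ ?_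
  · intro d hd
    simp only [Finset.mem_filter, Multiset.mem_toFinset] at hd ⊢
    exact ⟨h.inv_mem d hd.1, by rw [h.inv_inv d hd.1]; omega⟩
  · intro d hd
    simp only [Finset.mem_filter, Multiset.mem_toFinset] at hd ⊢
    have := h.inv_ne d hd.1
    exact ⟨h.inv_mem d hd.1, by rw [h.inv_inv d hd.1]; omega⟩
  · intro d hd
    exact h.inv_inv d (Multiset.mem_toFinset.1 (Finset.mem_filter.1 hd).1)
  · intro d hd
    exact h.inv_inv d (Multiset.mem_toFinset.1 (Finset.mem_filter.1 hd).1)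

/-- Euler's inequality for spherical maps. -/
theorem IsMap.euler (h : IsMap P M cs) (hne : darts cs ≠ 0) :
    Multiset.card (darts cs) + 4 ≤
      2 * ((darts cs).toFinset.image M.src).card + 2 * Multiset.card cs := by
  classical
  set ds := (darts cs).toFinset with hds
  have hmem : ∀ d, d ∈ ds ↔ d ∈ darts cs := fun d => Multiset.mem_toFinset
  set half := ds.filter (fun d => d < M.inv d) with hhalf
  have hhm : ∀ d, d ∈ half ↔ d ∈ ds ∧ d < M.inv d := fun d => by simp [hhalf]
  obtain ⟨d₀, hd₀⟩ := Multiset.exists_mem_of_ne_zero hne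
  obtain ⟨c₀, hc₀, -⟩ := mem_darts.1 hd₀
  obtain ⟨cs', rfl⟩ := Multiset.exists_cons_of_mem hc₀
  set V := ds.image M.src with hV
  set v₀ := M.src d₀
  have hv₀ : v₀ ∈ V := Finset.mem_image_of_mem _ ((hmem _).2 hd₀)
  let ω : (half → ℚ) →ₗ[ℚ] (ℕ → ℚ) :=
    { toFun := fun x d => if hd : d ∈ half then x ⟨d, hd⟩ else
        if hd : M.inv d ∈ half then - x ⟨M.inv d, hd⟩ else 0
      map_add' := by
        intro x y; ext d; simp only [Pi.add_apply]; split_ifs <;> ring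
      map_smul' := by
        intro a x; ext d; simp only [Pi.smul_apply, smul_eq_mul, RingHom.id_apply]
        split_ifs <;> ring }
  have hω1 : ∀ x d (hd : d ∈ half), ω x d = x ⟨d, hd⟩ := by
    intro x d hd; simp [ω, hd]
  have hω2 : ∀ x, ∀ d ∈ darts (c₀ ::ₘ cs'), ω x (M.inv d) = - ω x d := by
    intro x d hd
    have i1 := h.inv_inv d hd
    have i2 := h.inv_ne d hd
    by_cases hlt : d < M.inv d
    · have m1 : d ∈ half := (hhm d).2 ⟨(hmem d).2 hd, hlt⟩
      have m2 : M.inv d ∉ half := by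
        rw [hhm, i1]; intro hh; omega
      simp [ω, m1, m2, i1]
    · have m1 : d ∉ half := by rw [hhm]; tauto
      have m2 : M.inv d ∈ half := by
        rw [hhm, i1]; exact ⟨(hmem _).2 (h.inv_mem d hd), by omega⟩
      simp [ω, m1, m2]
  let L := cs'.toList
  let Φ : (half → ℚ) →ₗ[ℚ] (Fin L.length → ℚ) :=
    { toFun := fun x i => ((L.get i).map (ω x)).sum
      map_add' := by
        intro x y; ext i
        simp only [map_add, Pi.add_apply, ← List.sum_map_add]
        rfl
      map_smul' := by
        intro a x; ext i
        simp only [map_smul, Pi.smul_apply, RingHom.id_apply, smul_eq_mul]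
        exact List.sum_map_mul_left (l := L.get i) (r := a) (f := ω x) }
  let V' := V.erase v₀
  let E : (V' → ℚ) →ₗ[ℚ] (ℕ → ℚ) :=
    { toFun := fun g v => if hv : v ∈ V' then g ⟨v, hv⟩ else 0
      map_add' := by
        intro x y; ext d; simp only [Pi.add_apply]; split_ifs <;> ring
      map_smul' := by
        intro a x; ext d; simp only [Pi.smul_apply, smul_eq_mul, RingHom.id_apply]
        split_ifs <;> ring }
  let Ψ : (V' → ℚ) →ₗ[ℚ] (half → ℚ) :=
    { toFun := fun g d => E g (M.src (M.inv d.1)) - E g (M.src d.1)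
      map_add' := by
        intro x y; ext d; simp only [map_add, Pi.add_apply]; ring
      map_smul' := by
        intro a x; ext d
        simp only [map_smul, Pi.smul_apply, smul_eq_mul, RingHom.id_apply]; ring }
  have hker : LinearMap.ker Φ ≤ LinearMap.range Ψ := by
    intro x hx
    have hx' : ∀ c ∈ cs', (c.map (ω x)).sum = 0 := by
      intro c hc
      obtain ⟨i, hi⟩ := List.get_of_mem (Multiset.mem_toList.2 hc)
      have := congrFun (LinearMap.mem_ker.1 hx) i
      rw [← hi]; exact this
    have hx0 : (c₀.map (ω x)).sum = 0 := by
      have := h.sum_darts_eq_zero (hω2 x)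
      rw [Multiset.map_cons, Multiset.sum_cons, Multiset.sum_eq_zero, add_zero] at this
      · exact this
      · intro q hq
        obtain ⟨c, hc, rfl⟩ := Multiset.mem_map.1 hq
        exact hx' c hc
    obtain ⟨g, hg⟩ := h.exact (ω x) (hω2 x) (by
      intro c hc
      rcases Multiset.mem_cons.1 hc with rfl | hc
      · exact hx0
      · exact hx' c hc)
    refine ⟨fun v => g v - g v₀, ?_⟩
    have hE : ∀ v ∈ V, E (fun v => g v - g v₀) v = g v - g v₀ := by
      intro v hv
      by_cases hvv : v = v₀
      · simp [E, V', hvv]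
      · have : v ∈ V' := Finset.mem_erase.2 ⟨hvv, hv⟩
        simp [E, this]
    ext ⟨d, hd⟩
    have hd' := (hmem d).1 ((hhm d).1 hd).1
    show E _ (M.src (M.inv d)) - E _ (M.src d) = _
    rw [hE _ (Finset.mem_image_of_mem _ ((hmem _).2 (h.inv_mem d hd'))),
      hE _ (Finset.mem_image_of_mem _ ((hmem _).2 hd')), ← hω1 x d hd, hg d hd']
    ring
  have e1 := LinearMap.finrank_range_add_finrank_ker Φ
  have e2 : Module.finrank ℚ (LinearMap.ker Φ) ≤ Module.finrank ℚ (LinearMap.range Ψ) :=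
    Submodule.finrank_mono hker
  have e3 : Module.finrank ℚ (LinearMap.range Ψ) ≤ Module.finrank ℚ (V' → ℚ) :=
    LinearMap.finrank_range_le Ψ
  have e4 : Module.finrank ℚ (LinearMap.range Φ) ≤ Module.finrank ℚ (Fin L.length → ℚ) :=
    Submodule.finrank_le _
  simp only [Module.finrank_fintype_fun_eq_card, Fintype.card_fin, Fintype.card_coe] at e1 e3 e4
  have e5 : V'.card + 1 = V.card := Finset.card_erase_add_one hv₀
  have e6 : L.length = Multiset.card cs' := Multiset.length_toList cs'
  have e7 := h.card_half
  rw [← hds, ← hhalf] at e7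
  rw [Multiset.card_cons]
  omega

end

/-! ### Rotation around vertices -/

section

variable {S : Type} {P : C6Presentation S} {M : MapData S P.Grp} {cs : Multiset (List ℕ)}

/-- The successor permutation of a collection of disjoint cycles. -/
noncomputable def nxt (cs : Multiset (List ℕ)) : Equiv.Perm ℕ :=
  (cs.toList.map List.formPerm).prod

theorem prod_formPerm_of_notMem {L : List (List ℕ)} {d : ℕ} (h : ∀ c ∈ L, d ∉ c) :
    (L.map List.formPerm).prod d = d := by
  induction L with
  | nil => simp
  | cons c L ih =>
    rw [List.map_cons, List.prod_cons, Equiv.Perm.mul_apply,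
      ih (fun c' hc' => h c' (List.mem_cons_of_mem _ hc'))]
    exact List.formPerm_apply_of_notMem (h c List.mem_cons_self)

theorem prod_formPerm_of_mem {L : List (List ℕ)} (hL : (darts (L : Multiset (List ℕ))).Nodup)
    {c : List ℕ} (hc : c ∈ L) {d : ℕ} (hd : d ∈ c) :
    (L.map List.formPerm).prod d = c.formPerm d := by
  induction L with
  | nil => simp at hc
  | cons b L ih =>
    rw [← Multiset.cons_coe, darts_cons, Multiset.nodup_add] at hL
    obtain ⟨h1, h2, h3⟩ := hL
    rw [List.map_cons, List.prod_cons, Equiv.Perm.mul_apply]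
    have hdis : ∀ e ∈ b, ∀ c' ∈ L, e ∉ c' := by
      intro e he c' hc' he'
      exact Multiset.disjoint_left.1 h3 (Multiset.mem_coe.2 he)
        (mem_darts.2 ⟨c', Multiset.mem_coe.2 hc', he'⟩)
    by_cases hcL : c ∈ L
    · rw [ih h2 hcL]
      refine List.formPerm_apply_of_notMem ?_
      intro hb
      exact hdis _ hb c hcL (List.formPerm_apply_mem_of_mem hd)
    · obtain rfl : c = b := by
        rcases List.mem_cons.1 hc with h | h
        · exact h
        · exact absurd h hcL
      rw [prod_formPerm_of_notMem (fun c' hc' => hdis d hd c' hc')]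

theorem nodup_of_mem (h : (darts cs).Nodup) {c : List ℕ} (hc : c ∈ cs) : c.Nodup := by
  obtain ⟨cs', rfl⟩ := Multiset.exists_cons_of_mem hc
  rw [darts_cons, Multiset.nodup_add] at h
  exact Multiset.coe_nodup.1 h.1

theorem nxt_getElem (h : (darts cs).Nodup) {c : List ℕ} (hc : c ∈ cs) {i : ℕ} (hi : i < c.length) :
    nxt cs (c)[i] = (c)[(i + 1) % c.length]'(Nat.mod_lt _ (by omega)) := by
  unfold nxt
  rw [prod_formPerm_of_mem (c := c) (by rwa [Multiset.coe_toList]) (Multiset.mem_toList.2 hc)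
    (List.getElem_mem hi)]
  exact List.formPerm_apply_getElem _ (nodup_of_mem h hc) _ _

theorem nxt_mem (h : (darts cs).Nodup) {c : List ℕ} (hc : c ∈ cs) {d : ℕ} :
    nxt cs d ∈ c ↔ d ∈ c := by
  have key : ∀ c ∈ cs, ∀ d ∈ c, nxt cs d ∈ c := by
    intro c hc d hd
    obtain ⟨i, hi, rfl⟩ := List.getElem_of_mem hd
    rw [nxt_getElem h hc hi]; exact List.getElem_mem _
  refine ⟨fun hd => ?_, key c hc d⟩
  obtain ⟨i, hi, hid⟩ := List.getElem_of_mem hd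
  have hpos : 0 < c.length := by omega
  have : nxt cs ((c)[(i + (c.length - 1)) % c.length]'(Nat.mod_lt _ hpos)) = (c)[i] := by
    rw [nxt_getElem h hc (Nat.mod_lt _ hpos)]
    congr 1
    rw [Nat.mod_add_mod, show i + (c.length - 1) + 1 = i + c.length by omega, Nat.add_mod_right,
      Nat.mod_eq_of_lt hi]
  rw [hid] at this
  rw [← (nxt cs).injective this]
  exact List.getElem_mem _

theorem nxt_mem_darts (h : (darts cs).Nodup) {d : ℕ} (hd : d ∈ darts cs) :
    nxt cs d ∈ darts cs := by
  obtain ⟨c, hc, hdc⟩ := mem_darts.1 hd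
  exact mem_darts.2 ⟨c, hc, (nxt_mem h hc).2 hdc⟩

theorem MapData.IsPath.src_getElem_succ {S G : Type} {M : MapData S G} {a b : ℕ} {c : List ℕ}
    (h : M.IsPath a c b) {i : ℕ} (hi : i + 1 < c.length) :
    M.src (c)[i + 1] = M.src (M.inv (c)[i]) := by
  induction c generalizing a i with
  | nil => simp at hi
  | cons d c ih =>
    cases i with
    | zero =>
      cases c with
      | nil => simp at hi
      | cons e c => simpa using h.2.1
    | succ i =>
      have hi' : i + 1 < c.length := by simpa using hi
      exact ih h.2 hi'

theorem MapData.IsPath.src_getElem_zero {S G : Type} {M : MapData S G} {a b : ℕ} {c : List ℕ}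
    (h : M.IsPath a c b) (hi : 0 < c.length) : M.src (c)[0] = a := by
  cases c with
  | nil => simp at hi
  | cons d c => exact h.1

theorem MapData.IsPath.tgt_last {S G : Type} {M : MapData S G} {a b : ℕ} {c : List ℕ}
    (h : M.IsPath a c b) {i : ℕ} (hi : i + 1 = c.length) : M.src (M.inv (c)[i]) = b := by
  induction c generalizing a i with
  | nil => simp at hi
  | cons d c ih =>
    cases i with
    | zero =>
      cases c with
      | nil => exact h.2
      | cons e c => simp at hi
    | succ i => exact ih h.2 (by simpa using hi)

theorem IsMap.src_getElem (h : IsMap P M cs) {c : List ℕ} (hc : c ∈ cs) {i : ℕ}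
    (hi : i < c.length) :
    M.src ((c)[(i + 1) % c.length]'(Nat.mod_lt _ (by omega))) = M.src (M.inv (c)[i]) := by
  obtain ⟨a, ha⟩ := h.closed c hc
  by_cases hi' : i + 1 < c.length
  · simp only [Nat.mod_eq_of_lt hi']
    exact ha.src_getElem_succ hi'
  · have e : i + 1 = c.length := by omega
    rw [ha.tgt_last e]
    simp only [e, Nat.mod_self]
    exact ha.src_getElem_zero (by omega)

theorem IsMap.src_nxt (h : IsMap P M cs) {d : ℕ} (hd : d ∈ darts cs) :
    M.src (nxt cs d) = M.src (M.inv d) := by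
  obtain ⟨c, hc, hdc⟩ := mem_darts.1 hd
  obtain ⟨i, hi, rfl⟩ := List.getElem_of_mem hdc
  rw [nxt_getElem h.nodup hc hi, h.src_getElem hc hi]

/-- Two darts are linked if they are in the same orbit of the rotation about a vertex. -/
def Linked (M : MapData S P.Grp) (cs : Multiset (List ℕ)) : ℕ → ℕ → Prop :=
  Relation.EqvGen fun a b => a ∈ darts cs ∧ b = nxt cs (M.inv a)

open Classical in
/-- The darts around a vertex. -/
noncomputable def orb (M : MapData S P.Grp) (cs : Multiset (List ℕ)) (d : ℕ) : Finset ℕ :=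
  (darts cs).toFinset.filter (Linked M cs d)

theorem mem_orb {d e : ℕ} : e ∈ orb M cs d ↔ e ∈ darts cs ∧ Linked M cs d e := by
  simp [orb]

theorem self_mem_orb {d : ℕ} (hd : d ∈ darts cs) : d ∈ orb M cs d :=
  mem_orb.2 ⟨hd, Relation.EqvGen.refl d⟩

theorem IsMap.nu_mem_orb (h : IsMap P M cs) {d e : ℕ} (he : e ∈ orb M cs d) :
    nxt cs (M.inv e) ∈ orb M cs d := by
  obtain ⟨h1, h2⟩ := mem_orb.1 he
  exact mem_orb.2 ⟨nxt_mem_darts h.nodup (h.inv_mem e h1),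
    h2.trans _ _ _ (Relation.EqvGen.rel _ _ ⟨h1, rfl⟩)⟩

theorem orb_eq {d e : ℕ} (he : e ∈ orb M cs d) : orb M cs e = orb M cs d := by
  obtain ⟨h1, h2⟩ := mem_orb.1 he
  ext x
  rw [mem_orb, mem_orb]
  exact ⟨fun hx => ⟨hx.1, h2.trans _ _ _ hx.2⟩, fun hx => ⟨hx.1, (h2.symm _ _).trans _ _ _ hx.2⟩⟩

theorem IsMap.src_orb (h : IsMap P M cs) {d e : ℕ} (he : e ∈ orb M cs d) :
    M.src e = M.src d := by
  have : ∀ a b, Linked M cs a b → M.src b = M.src a := by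
    intro a b hab
    induction hab with
    | rel a b hab =>
      rw [hab.2, h.src_nxt (h.inv_mem a hab.1), h.inv_inv a hab.1]
    | refl => rfl
    | symm _ _ _ ih => exact ih.symm
    | trans _ _ _ _ _ ih1 ih2 => exact ih2.trans ih1
  exact this _ _ (mem_orb.1 he).2

/-- The curvature cost of an inner corner. -/
noncomputable def cost (M : MapData S P.Grp) (cs : Multiset (List ℕ)) (O : List ℕ) (d : ℕ) : ℤ :=
  if ((orb M cs d).filter (· ∈ O)).card = 0 then
    (if ((orb M cs d).filter (· ∉ O)).card ≤ 2 then 0 else 2)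
  else if ((orb M cs d).filter (· ∈ O)).card = 1 then
    (if ((orb M cs d).filter (· ∉ O)).card ≤ 1 then 0 else 3)
  else 6

theorem cost_nonneg (O : List ℕ) (d : ℕ) : 0 ≤ cost M cs O d := by
  unfold cost; split_ifs <;> norm_num

theorem IsMap.card_image_src_le (h : IsMap P M cs) :
    ((darts cs).toFinset.image M.src).card ≤ ((darts cs).toFinset.image (orb M cs)).card := by
  classical
  let g : Finset ℕ → ℕ := fun B => if hB : B.Nonempty then M.src hB.choose else 0
  have hg : ∀ d ∈ (darts cs).toFinset, g (orb M cs d) = M.src d := by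
    intro d hd
    have hB : (orb M cs d).Nonempty := ⟨d, self_mem_orb (Multiset.mem_toFinset.1 hd)⟩
    simp only [g, hB, dif_pos]
    exact h.src_orb hB.choose_spec
  have : (darts cs).toFinset.image M.src = ((darts cs).toFinset.image (orb M cs)).image g := by
    rw [Finset.image_image]
    exact Finset.image_congr (fun d hd => (hg d hd).symm)
  rw [this]
  exact Finset.card_image_le

/-- The combinatorial Gauss–Bonnet inequality. -/
theorem IsMap.curvature {O : List ℕ} {F : Multiset (List ℕ)} (h : IsMap P M (O ::ₘ F))
    (hO : O ≠ [])
    (hred : ∀ d ∈ darts F, M.inv d ∉ O → nxt (O ::ₘ F) (M.inv d) ≠ d) :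
    12 ≤ (F.map fun c => 12 - (c.map (cost M (O ::ₘ F) O)).sum).sum +
      6 * ((O.toFinset.filter fun d => nxt (O ::ₘ F) (M.inv d) = d).card : ℤ) := by
  classical
  set cs := O ::ₘ F with hcs
  set ds := (darts cs).toFinset with hds
  have hmem : ∀ d, d ∈ ds ↔ d ∈ darts cs := fun d => Multiset.mem_toFinset
  have hnodup := h.nodup
  rw [hcs, darts_cons, Multiset.nodup_add] at hnodup
  obtain ⟨hn1, hn2, hn3⟩ := hnodup
  have hdis : ∀ d ∈ darts F, d ∉ O := fun d hd hdO => Multiset.disjoint_left.1 hn3 hdO hd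
  have hdsO : ∀ d, d ∈ ds ↔ d ∈ O ∨ d ∈ darts F := by
    intro d; rw [hmem, hcs, darts_cons]; simp
  set orbs := ds.image (orb M cs) with horbs
  have horb : ∀ B ∈ orbs, B = ds.filter (fun d => orb M cs d = B) := by
    intro B hB
    obtain ⟨d, hd, rfl⟩ := Finset.mem_image.1 hB
    ext e
    rw [Finset.mem_filter]
    constructor
    · intro he
      exact ⟨(hmem e).2 (mem_orb.1 he).1, orb_eq he⟩
    · rintro ⟨he, heq⟩
      rw [← heq]; exact self_mem_orb ((hmem e).1 he)
  let g : ℕ → ℤ := fun d => if d ∈ O then (if nxt cs (M.inv d) = d then 6 else 0)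
    else - cost M cs O d
  have hB : ∀ B ∈ orbs, (12 : ℤ) - 6 * B.card ≤ ∑ d ∈ B, g d := by
    intro B hB
    obtain ⟨d, hd, rfl⟩ := Finset.mem_image.1 hB
    set B := orb M cs d with hBdef
    have hdB : d ∈ B := self_mem_orb ((hmem d).1 hd)
    set o := (B.filter (· ∈ O)).card with ho
    set n := (B.filter (· ∉ O)).card with hn
    have hcard : B.card = o + n := by
      rw [ho, hn, Finset.card_filter_add_card_filter_not]
    have hcost : ∀ e ∈ B, cost M cs O e =
        if o = 0 then (if n ≤ 2 then 0 else 2) else if o = 1 then (if n ≤ 1 then 0 else 3)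
        else 6 := by
      intro e he
      unfold cost
      rw [orb_eq he]
    have hin : ∑ e ∈ B.filter (· ∉ O), g e = - (n * (if o = 0 then (if n ≤ 2 then 0 else 2) else
        if o = 1 then (if n ≤ 1 then 0 else 3) else 6) : ℤ) := by
      rw [Finset.sum_congr rfl (g := fun _ => - (if o = 0 then (if n ≤ 2 then 0 else 2) else
        if o = 1 then (if n ≤ 1 then 0 else 3) else 6 : ℤ)) (fun e he => by
        have := Finset.mem_filter.1 he
        simp only [g, this.2, if_false, hcost e this.1])]
      rw [Finset.sum_const, ← hn, nsmul_eq_mul, mul_neg]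
    have hout : 0 ≤ ∑ e ∈ B.filter (· ∈ O), g e := by
      refine Finset.sum_nonneg (fun e he => ?_)
      have := Finset.mem_filter.1 he
      simp only [g, this.2, if_true]
      split_ifs <;> norm_num
    have hsplit := Finset.sum_filter_add_sum_filter_not B (· ∈ O) g
    rw [hin] at hsplit
    rw [hcard]
    push_cast
    by_cases ho0 : o = 0
    · have hn0 : n ≠ 0 := by
        have : 0 < B.card := Finset.card_pos.2 ⟨d, hdB⟩
        omega
      have hn1 : n ≠ 1 := by
        intro hn1
        have hc1 : B.card = 1 := by omega
        obtain ⟨x, hx⟩ := Finset.card_eq_one.1 hc1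
        have e1 : d = x := by simpa [hx] using hdB
        have e2 : nxt cs (M.inv d) = x := by
          have := h.nu_mem_orb (d := d) hdB
          rw [← hBdef, hx] at this
          simpa using this
        have hnot : ∀ e ∈ B, e ∉ O := by
          intro e he heO
          have := Finset.card_eq_zero.1 (ho.symm.trans ho0)
          have h2 : e ∈ B.filter (· ∈ O) := Finset.mem_filter.2 ⟨he, heO⟩
          rw [this] at h2; simp at h2
        have hdF : d ∈ darts F := ((hdsO d).1 hd).resolve_left (hnot d hdB)
        refine hred d hdF ?_ (e2.trans e1.symm)
        intro hi
        have := (nxt_mem h.nodup (c := O) (by simp [hcs]) (d := M.inv d)).2 hi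
        rw [e2, ← e1] at this
        exact hnot d hdB this
      simp only [ho0, if_true] at hsplit
      split_ifs at hsplit with h2
      · have : n = 2 := by omega
        rw [this, ho0] ; push_cast; linarith
      · have : (3 : ℤ) ≤ n := by exact_mod_cast (by omega : 3 ≤ n)
        rw [ho0]; push_cast; linarith
    · by_cases ho1 : o = 1
      · by_cases hn0 : n = 0
        · have hc1 : B.card = 1 := by omega
          obtain ⟨x, hx⟩ := Finset.card_eq_one.1 hc1
          have e1 : d = x := by simpa [hx] using hdB
          have e2 : nxt cs (M.inv d) = x := by
            have := h.nu_mem_orb (d := d) hdB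
            rw [← hBdef, hx] at this
            simpa using this
          have hdO : d ∈ O := by
            by_contra hdO
            have : d ∈ B.filter (· ∉ O) := Finset.mem_filter.2 ⟨hdB, hdO⟩
            rw [Finset.card_eq_zero.1 (hn.symm.trans hn0)] at this
            simp at this
          have : g d = 6 := by simp [g, hdO, e2.trans e1.symm]
          rw [hx, Finset.sum_singleton, ← e1, this, ho1, hn0]
          norm_num
        · simp only [ho1, one_ne_zero, if_false, if_true] at hsplit
          rw [ho1]
          split_ifs at hsplit with h2
          · have : n = 1 := by omega
            rw [this]; push_cast; linarith
          · have : (2 : ℤ) ≤ n := by exact_mod_cast (by omega : 2 ≤ n)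
            push_cast; linarith
      · simp only [ho0, ho1, if_false] at hsplit
        have : (2 : ℤ) ≤ o := by exact_mod_cast (by omega : 2 ≤ o)
        linarith
  have hsum1 : ∑ B ∈ orbs, ((12 : ℤ) - 6 * B.card) ≤ ∑ d ∈ ds, g d := by
    calc _ ≤ ∑ B ∈ orbs, ∑ d ∈ B, g d := Finset.sum_le_sum hB
      _ = ∑ B ∈ orbs, ∑ d ∈ ds with orb M cs d = B, g d :=
        Finset.sum_congr rfl (fun B hB => by rw [← horb B hB])
      _ = _ := Finset.sum_fiberwise_of_maps_to (fun d hd => Finset.mem_image_of_mem _ hd) _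
  have hsum2 : ∑ B ∈ orbs, (B.card : ℤ) = ds.card := by
    rw [Finset.card_eq_sum_card_fiberwise (f := orb M cs) (t := orbs)
      (fun d hd => Finset.mem_image_of_mem _ hd)]
    push_cast
    exact Finset.sum_congr rfl (fun B hB => by rw [← horb B hB])
  rw [Finset.sum_sub_distrib, Finset.sum_const, ← Finset.mul_sum, hsum2, nsmul_eq_mul] at hsum1
  have hne : darts cs ≠ 0 := by
    intro h0
    obtain ⟨x, O', rfl⟩ := List.exists_cons_of_ne_nil hO
    have : x ∈ darts cs := by simp [hcs]
    rw [h0] at this; simp at this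
  have heuler := h.euler hne
  have hV := h.card_image_src_le
  have hcards : Multiset.card (darts cs) = ds.card :=
    (Multiset.toFinset_card_of_nodup h.nodup).symm
  have hF : Multiset.card cs = Multiset.card F + 1 := by simp [hcs]
  have hds_eq : ∑ d ∈ ds, g d = ((darts cs).map g).sum := by
    rw [Finset.sum_eq_multiset_sum, Multiset.toFinset_val, Multiset.dedup_eq_self.2 h.nodup]
  have hOsum : (O.map g).sum =
      6 * ((O.toFinset.filter fun d => nxt cs (M.inv d) = d).card : ℤ) := by
    have e1 : (O.map g).sum = ∑ d ∈ O.toFinset, g d :=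
      (List.sum_toFinset g (Multiset.coe_nodup.1 hn1)).symm
    rw [e1, Finset.sum_congr rfl (g := fun d => if nxt cs (M.inv d) = d then (6 : ℤ) else 0)
      (fun d hd => by simp [g, List.mem_toFinset.1 hd]), ← Finset.sum_filter, Finset.sum_const,
      nsmul_eq_mul, mul_comm]
  have hFsum : ((darts F).map g).sum = - (F.map fun c => (c.map (cost M cs O)).sum).sum := by
    rw [sum_map_darts, ← Multiset.sum_map_neg]
    refine congrArg _ (Multiset.map_congr rfl (fun c hc => ?_))
    have : ∀ b : List ℕ, (∀ d ∈ b, d ∉ O) →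
        (b.map g).sum = - (b.map (cost M cs O)).sum := by
      intro b hb
      induction b with
      | nil => simp
      | cons x b ih =>
        rw [List.map_cons, List.sum_cons, List.map_cons, List.sum_cons,
          ih (fun d hd => hb d (List.mem_cons_of_mem _ hd))]
        simp [g, hb x List.mem_cons_self]
        ring
    exact this c (fun d hd => hdis d (mem_darts.2 ⟨c, hc, hd⟩))
  rw [hds_eq, hcs, darts_cons, Multiset.map_add, Multiset.sum_add, Multiset.map_coe,
    Multiset.sum_coe, hOsum, hFsum] at hsum1
  rw [Multiset.sum_map_sub]
  simp only [Multiset.map_const', Multiset.sum_replicate, nsmul_eq_mul]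
  have : (ds.card : ℤ) + 4 ≤ 2 * orbs.card + 2 * (Multiset.card F + 1) := by
    rw [hcards, hF] at heuler
    exact_mod_cast heuler.trans (by gcongr)
  linarith

end

/-! ### Disc diagrams -/

section

/-- The entries of a list, read cyclically. -/
def cyc (b : List ℕ) (i : ℕ) : ℕ := b.getD (i % b.length) 0

theorem cyc_eq_getElem {b : List ℕ} {i : ℕ} (hi : i < b.length) : cyc b i = b[i] := by
  simp [cyc, Nat.mod_eq_of_lt hi, hi]

theorem cyc_mod (b : List ℕ) (i : ℕ) : cyc b (i % b.length) = cyc b i := by simp [cyc]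

theorem cyc_add_length (b : List ℕ) (i : ℕ) : cyc b (i + b.length) = cyc b i := by simp [cyc]

theorem cyc_mem {b : List ℕ} (hb : b ≠ []) (i : ℕ) : cyc b i ∈ b := by
  rw [← cyc_mod, cyc_eq_getElem (Nat.mod_lt _ (List.length_pos_of_ne_nil hb))]
  exact List.getElem_mem _

theorem exists_cyc {b : List ℕ} {d : ℕ} (hd : d ∈ b) : ∃ i < b.length, cyc b i = d := by
  obtain ⟨i, hi, rfl⟩ := List.getElem_of_mem hd
  exact ⟨i, hi, cyc_eq_getElem hi⟩

theorem cyc_inj {b : List ℕ} (hb : b.Nodup) {i j : ℕ} (hi : i < b.length) (hj : j < b.length)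
    (h : cyc b i = cyc b j) : i = j := by
  rw [cyc_eq_getElem hi, cyc_eq_getElem hj] at h
  exact (List.Nodup.getElem_inj_iff hb).1 h

theorem map_cyc_range (b : List ℕ) : (List.range b.length).map (cyc b) = b := by
  apply List.ext_getElem
  · simp
  · intro i h1 h2
    simp only [List.getElem_map, List.getElem_range]
    exact cyc_eq_getElem h2

theorem rotate_eq_map_cyc (b : List ℕ) (i : ℕ) :
    b.rotate i = (List.range b.length).map fun j => cyc b (i + j) := by
  apply List.ext_getElem
  · simp
  · intro j h1 h2
    have hj : j < b.length := by simpa using h1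
    simp only [List.getElem_map, List.getElem_range, List.getElem_rotate]
    rw [← cyc_mod, cyc_eq_getElem (Nat.mod_lt _ (by omega))]
    simp only [Nat.add_comm]

theorem append_self_eq_map_cyc (b : List ℕ) :
    b ++ b = (List.range (b.length + b.length)).map (cyc b) := by
  rw [List.range_add, List.map_append, map_cyc_range, List.map_map]
  congr 1
  conv_lhs => rw [← map_cyc_range b]
  refine List.map_congr_left (fun i _ => ?_)
  simp [Nat.add_comm, cyc_add_length]

theorem sum_map_eq_sum_cyc {A : Type} [AddCommMonoid A] (b : List ℕ) (f : ℕ → A) :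
    (b.map f).sum = ∑ i ∈ Finset.range b.length, f (cyc b i) := by
  conv_lhs => rw [← map_cyc_range b]
  rw [List.map_map]
  rfl

theorem sum_cyc_succ {A : Type} [AddCommMonoid A] (b : List ℕ) (f : ℕ → A) :
    ∑ i ∈ Finset.range b.length, f (cyc b (i + 1)) =
      ∑ i ∈ Finset.range b.length, f (cyc b i) := by
  rcases Nat.eq_zero_or_pos b.length with h0 | h0
  · simp [h0]
  · obtain ⟨n, hn⟩ := Nat.exists_eq_succ_of_ne_zero h0.ne'
    rw [hn, Finset.sum_range_succ, Finset.sum_range_succ', ← cyc_add_length b 0, hn]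
    simp

theorem nxt_cyc {cs : Multiset (List ℕ)} (h : (darts cs).Nodup) {b : List ℕ} (hb : b ∈ cs)
    (hne : b ≠ []) (i : ℕ) : nxt cs (cyc b i) = cyc b (i + 1) := by
  have hpos := List.length_pos_of_ne_nil hne
  rw [← cyc_mod b i, cyc_eq_getElem (Nat.mod_lt _ hpos), nxt_getElem h hb (Nat.mod_lt _ hpos),
    ← cyc_mod b (i + 1), cyc_eq_getElem (Nat.mod_lt _ hpos)]
  congr 1
  simp

theorem reduced_iff {S : Type} {w : Word S} :
    Reduced w ↔ ∀ i (h : i + 1 < w.length), w[i + 1] ≠ flipLetter w[i] := by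
  unfold Reduced
  refine Iff.trans List.isChain_iff_getElem ?_
  refine forall_congr' fun i => forall_congr' fun h => ?_
  generalize w[i] = a, w[i + 1] = b
  obtain ⟨a, s⟩ := a
  obtain ⟨b, t⟩ := b
  cases s <;> cases t <;> simp [flipLetter, eq_comm]

theorem Reduced.infix {S : Type} {u v : Word S} (h : Reduced v) (huv : u <:+: v) : Reduced u :=
  List.IsChain.infix h huv

theorem eq_nil_of_wordInv_eq_self {S : Type} {w : Word S} (hw : Reduced w)
    (h : wordInv w = w) : w = [] := by
  by_contra hne
  have hpos := List.length_pos_of_ne_nil hne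
  have key : ∀ i (hi : i < w.length), w[i] = flipLetter (w[w.length - 1 - i]'(by omega)) := by
    intro i hi
    have : (wordInv w)[i]'(by simpa using hi) = w[i] := by simp [h]
    rw [← this]
    simp [wordInv_eq]
  rcases Nat.even_or_odd' w.length with ⟨k, hk | hk⟩
  · have h1 := key k (by omega)
    have h2 := reduced_iff.1 hw (k - 1) (by omega)
    simp only [show k - 1 + 1 = k by omega] at h2
    simp only [show w.length - 1 - k = k - 1 by omega] at h1
    exact h2 h1
  · have h1 := key k (by omega)
    simp only [show w.length - 1 - k = k by omega] at h1
    exact flipLetter_ne _ h1.symm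

theorem CyclicallyReduced.rotate_ne_wordInv {S : Type} {r : Word S} (hr : CyclicallyReduced r)
    (hne : r ≠ []) (i j : ℕ) : r.rotate i ≠ wordInv (r.rotate j) := by
  intro h
  have hpos := List.length_pos_of_ne_nil hne
  obtain ⟨k, hk⟩ : ∃ k ≤ (r.rotate j).length, r.rotate i = (r.rotate j).rotate k := by
    refine ⟨(i + (r.length - j % r.length)) % r.length, ?_, ?_⟩
    · rw [List.length_rotate]; exact (Nat.mod_lt _ hpos).le
    · rw [List.rotate_rotate, ← List.rotate_mod r (j + _), ← List.rotate_mod r i]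
      congr 1
      have hj : j % r.length < r.length := Nat.mod_lt _ hpos
      rw [Nat.add_mod_mod]
      have e := Nat.mod_add_div j r.length
      rw [show j + (i + (r.length - j % r.length)) =
        i + r.length + r.length * (j / r.length) by omega, Nat.add_mul_mod_self_left,
        Nat.add_mod_right]
  set s := r.rotate j with hs
  have hsne : s ≠ [] := by simpa [hs] using hne
  have hsr : Reduced s := by
    refine Reduced.infix hr ?_
    rw [hs, List.rotate_eq_drop_append_take_mod]
    refine ⟨r.take (j % r.length), r.drop (j % r.length), ?_⟩
    rw [← List.append_assoc, List.take_append_drop, List.append_assoc, List.take_append_drop]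
  rw [hk.2, List.rotate_eq_drop_append_take hk.1] at h
  have h2 : wordInv s = wordInv (s.drop k) ++ wordInv (s.take k) := by
    rw [← wordInv_append, List.take_append_drop]
  rw [h2] at h
  obtain ⟨e1, e2⟩ := List.append_inj h (by simp)
  have r1 := eq_nil_of_wordInv_eq_self (hsr.infix (List.drop_suffix k s).isInfix) e1.symm
  have r2 := eq_nil_of_wordInv_eq_self (hsr.infix (List.take_prefix k s).isInfix) e2.symm
  apply hsne
  rw [← List.take_append_drop k s, r1, r2]; rfl

variable {S : Type} {P : C6Presentation S} {M : MapData S P.Grp} {cs : Multiset (List ℕ)}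

theorem IsMap.rotate_nat {b : List ℕ} (h : IsMap P M (b ::ₘ cs)) (i : ℕ) :
    IsMap P M (b.rotate i ::ₘ cs) := by
  rw [List.rotate_eq_drop_append_take_mod]
  apply IsMap.rotate
  rwa [List.take_append_drop]

/-- A disc diagram with boundary cycle `O` and inner faces `F` labelled by relators, in which no
two inner faces are mirror images of each other along a common edge. -/
structure Diagram (P : C6Presentation S) (M : MapData S P.Grp) (O : List ℕ)
    (F : Multiset (List ℕ)) : Prop where
  isMap : IsMap P M (O ::ₘ F)
  outer_ne : O ≠ []
  ne : ∀ b ∈ F, b ≠ []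
  rel : ∀ b ∈ F, b.map M.lab ∈ P.rels
  mirror : ∀ b ∈ F, ∀ b' ∈ F, ∀ i j, M.inv (cyc b i) = cyc b' j →
    (b.map M.lab).rotate i ≠ wordInv ((b'.map M.lab).rotate (j + 1))

theorem rotate_eq_cyc_cons {b : List ℕ} (hb : b ≠ []) (i : ℕ) :
    ∃ u, b.rotate i = cyc b i :: u ∧ b.rotate (i + 1) = u ++ [cyc b i] := by
  obtain ⟨n, hn⟩ := Nat.exists_eq_succ_of_ne_zero (List.length_pos_of_ne_nil hb).ne'
  refine ⟨(List.range n).map fun j => cyc b (i + 1 + j), ?_, ?_⟩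
  · rw [rotate_eq_map_cyc, hn, List.range_succ_eq_map]
    simp only [List.map_cons, List.map_map, Nat.add_zero]
    congr 1
    refine List.map_congr_left (fun j _ => ?_)
    simp only [Function.comp]
    congr 1
    omega
  · rw [rotate_eq_map_cyc, hn, List.range_succ, List.map_append]
    congr 1
    simp only [List.map_cons, List.map_nil, List.cons.injEq, and_true]
    rw [← cyc_add_length b i, hn]
    congr 1
    omega

/-- Cancelling two faces which are mirror images of each other along an edge. -/
theorem IsMap.realizable_of_mirror {b b' : List ℕ} (h : IsMap P M (b ::ₘ b' ::ₘ cs))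
    (hb : b ≠ []) (hb' : b' ≠ []) {i j : ℕ} (hij : M.inv (cyc b i) = cyc b' j)
    (hw : (b.map M.lab).rotate i = wordInv ((b'.map M.lab).rotate (j + 1))) :
    Realizable P (cs.map (List.map M.lab)) := by
  obtain ⟨u, hu, -⟩ := rotate_eq_cyc_cons hb i
  obtain ⟨v, hv, hv'⟩ := rotate_eq_cyc_cons hb' j
  have h1 := h.rotate_nat i
  rw [Multiset.cons_swap] at h1
  have h2 := h1.rotate_nat j
  rw [Multiset.cons_swap, hu, hv, ← hij] at h2
  have h3 := h2.merge
  rw [← List.map_rotate, ← List.map_rotate, hu, hv'] at hw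
  simp only [List.map_cons, List.map_append, List.map_nil, wordInv_append, wordInv_cons,
    wordInv_nil, List.nil_append, List.singleton_append, List.cons.injEq] at hw
  have h4 : Realizable P (([] ++ (v.map M.lab ++ wordInv (v.map M.lab)) ++ []) ::ₘ
      cs.map (List.map M.lab)) :=
    realizable_cons.2 ⟨M, _, cs, h3, by simp [hw.2], rfl⟩
  exact (h4.fold_word).of_nil

theorem exists_diagram {R₀ : Set (Word S)} (hR : R₀ ⊆ P.rels) (hR' : [] ∉ R₀)
    {T : Set (Word S)} (hT : [] ∉ T)
    (h : ∃ w ∈ T, ∃ W : Multiset (Word S), (∀ r ∈ W, r ∈ R₀) ∧ Realizable P (w ::ₘ W)) :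
    ∃ (M : MapData S P.Grp) (O : List ℕ) (F : Multiset (List ℕ)), Diagram P M O F ∧
      O.map M.lab ∈ T ∧ (∀ b ∈ F, b.map M.lab ∈ R₀) ∧
      ∀ w ∈ T, ∀ W : Multiset (Word S), (∀ r ∈ W, r ∈ R₀) → Realizable P (w ::ₘ W) →
        Multiset.card F ≤ Multiset.card W := by
  classical
  have hex : ∃ n, ∃ w ∈ T, ∃ W : Multiset (Word S), (∀ r ∈ W, r ∈ R₀) ∧ Realizable P (w ::ₘ W) ∧
      Multiset.card W = n := by
    obtain ⟨w, hw, W, h1, h2⟩ := h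
    exact ⟨_, w, hw, W, h1, h2, rfl⟩
  obtain ⟨w, hw, W, h1, h2, h3⟩ := Nat.find_spec hex
  have hmin : ∀ w ∈ T, ∀ W : Multiset (Word S), (∀ r ∈ W, r ∈ R₀) → Realizable P (w ::ₘ W) →
      Nat.find hex ≤ Multiset.card W :=
    fun w hw W h1 h2 => Nat.find_min' hex ⟨w, hw, W, h1, h2, rfl⟩
  obtain ⟨M, O, F, hm, rfl, rfl⟩ := realizable_cons.1 h2
  rw [Multiset.card_map] at h3
  have hF : ∀ b ∈ F, b.map M.lab ∈ R₀ := fun b hb => h1 _ (Multiset.mem_map_of_mem _ hb)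
  have hne : ∀ b ∈ F, b ≠ [] := by
    rintro b hb rfl
    exact hR' (hF _ hb)
  refine ⟨M, O, F, ⟨hm, ?_, hne, fun b hb => hR (hF b hb), ?_⟩, hw, hF, ?_⟩
  · rintro rfl; exact hT hw
  · intro b hb b' hb' i j hij hw'
    have hbb : b ≠ b' := by
      rintro rfl
      exact (P.cyclically_reduced _ (hR (hF b hb))).rotate_ne_wordInv
        (by simpa using hne b hb) _ _ hw'
    obtain ⟨F₁, rfl⟩ := Multiset.exists_cons_of_mem hb
    obtain ⟨F₂, rfl⟩ := Multiset.exists_cons_of_mem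
      ((Multiset.mem_cons.1 hb').resolve_left (Ne.symm hbb))
    have hm' : IsMap P M (b ::ₘ b' ::ₘ O ::ₘ F₂) := by
      rwa [Multiset.cons_swap b' O, Multiset.cons_swap b O]
    have h5 := hm'.realizable_of_mirror (hne b hb) (hne b' hb') hij hw'
    rw [Multiset.map_cons] at h5
    have := hmin _ hw _ (fun r hr => h1 r (by
      simp only [Multiset.map_cons, Multiset.mem_cons]; exact Or.inr (Or.inr hr))) h5
    rw [← h3] at this
    simp at this
  · rw [h3]; exact hmin

end

/-! ### Gluing faces of a disc diagram -/

section

variable {S : Type} {P : C6Presentation S} {M : MapData S P.Grp} {O : List ℕ}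
  {F : Multiset (List ℕ)} {b : List ℕ}

theorem Diagram.nodup (D : Diagram P M O F) : (darts (O ::ₘ F)).Nodup := D.isMap.nodup

theorem Diagram.outer_nodup (D : Diagram P M O F) : O.Nodup :=
  nodup_of_mem D.nodup (Multiset.mem_cons_self _ _)

theorem Diagram.face_nodup (D : Diagram P M O F) (hb : b ∈ F) : b.Nodup :=
  nodup_of_mem D.nodup (Multiset.mem_cons_of_mem hb)

theorem Diagram.mem_darts (D : Diagram P M O F) (hb : b ∈ F) (i : ℕ) :
    cyc b i ∈ darts (O ::ₘ F) :=
  GSC.mem_darts.2 ⟨b, Multiset.mem_cons_of_mem hb, cyc_mem (D.ne b hb) i⟩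

theorem Diagram.outer_mem_darts {d : ℕ} (hd : d ∈ O) : d ∈ darts (O ::ₘ F) :=
  GSC.mem_darts.2 ⟨O, Multiset.mem_cons_self _ _, hd⟩

theorem Diagram.nxt_face (D : Diagram P M O F) (hb : b ∈ F) (i : ℕ) :
    nxt (O ::ₘ F) (cyc b i) = cyc b (i + 1) :=
  nxt_cyc D.nodup (Multiset.mem_cons_of_mem hb) (D.ne b hb) i

theorem Diagram.nxt_outer (D : Diagram P M O F) (i : ℕ) :
    nxt (O ::ₘ F) (cyc O i) = cyc O (i + 1) :=
  nxt_cyc D.nodup (Multiset.mem_cons_self _ _) D.outer_ne i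

theorem Diagram.nxt_mem_outer (D : Diagram P M O F) {d : ℕ} : nxt (O ::ₘ F) d ∈ O ↔ d ∈ O :=
  nxt_mem D.nodup (Multiset.mem_cons_self _ _)

theorem Diagram.inv_ne_succ (D : Diagram P M O F) (hb : b ∈ F) (i : ℕ) :
    M.inv (cyc b i) ≠ cyc b (i + 1) := by
  intro h
  have hpos := List.length_pos_of_ne_nil (D.ne b hb)
  have h1 := D.isMap.lab_inv _ (D.mem_darts hb i)
  rw [h] at h1
  have h2 := P.cyclically_reduced _ (D.rel b hb)
  unfold CyclicallyReduced at h2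
  rw [← List.map_append, append_self_eq_map_cyc, reduced_iff] at h2
  have hi := Nat.mod_lt i hpos
  have h3 := h2 (i % b.length) (by simp; omega)
  simp only [List.getElem_map, List.getElem_range] at h3
  rw [← cyc_mod, Nat.mod_add_mod, cyc_mod, cyc_mod] at h3
  exact h3 h1

theorem Diagram.inv_mem_orb (D : Diagram P M O F) (hb : b ∈ F) (i : ℕ) :
    M.inv (cyc b i) ∈ orb M (O ::ₘ F) (cyc b (i + 1)) := by
  have h := D.isMap
  refine mem_orb.2 ⟨h.inv_mem _ (D.mem_darts hb i), ?_⟩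
  refine (Relation.EqvGen.rel _ _ ⟨h.inv_mem _ (D.mem_darts hb i), ?_⟩).symm
  rw [h.inv_inv _ (D.mem_darts hb i), D.nxt_face hb]

theorem Diagram.nxt_inv_ne (D : Diagram P M O F) (hb : b ∈ F) (i : ℕ) :
    nxt (O ::ₘ F) (M.inv (cyc b (i + 1))) ≠ cyc b (i + 1) := by
  intro h1
  rw [← D.nxt_face hb i] at h1
  have h2 := (nxt (O ::ₘ F)).injective h1
  rw [D.nxt_face hb i] at h2
  refine D.inv_ne_succ hb i ?_
  rw [← h2, D.isMap.inv_inv _ (D.mem_darts hb _)]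

theorem orb_card (cs : Multiset (List ℕ)) (O : List ℕ) (d : ℕ) :
    ((orb M cs d).filter (· ∈ O)).card + ((orb M cs d).filter (· ∉ O)).card =
      (orb M cs d).card :=
  Finset.card_filter_add_card_filter_not _

theorem Diagram.mirror_succ (D : Diagram P M O F) (hb : b ∈ F) {i : ℕ}
    (h0 : cost M (O ::ₘ F) O (cyc b (i + 1)) = 0) :
    nxt (O ::ₘ F) (M.inv (cyc b (i + 1))) = M.inv (cyc b i) := by
  have hcard : (orb M (O ::ₘ F) (cyc b (i + 1))).card ≤ 2 := by
    rw [← orb_card (O ::ₘ F) O]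
    unfold cost at h0
    split_ifs at h0 <;> omega
  by_contra hne
  have h1 : ({cyc b (i + 1), M.inv (cyc b i), nxt (O ::ₘ F) (M.inv (cyc b (i + 1)))} : Finset ℕ) ⊆
      orb M (O ::ₘ F) (cyc b (i + 1)) := by
    intro x hx
    simp only [Finset.mem_insert, Finset.mem_singleton] at hx
    rcases hx with rfl | rfl | rfl
    · exact self_mem_orb (D.mem_darts hb _)
    · exact D.inv_mem_orb hb i
    · exact D.isMap.nu_mem_orb (self_mem_orb (D.mem_darts hb _))
  have h2 := Finset.card_le_card h1
  rw [Finset.card_eq_three.2 ⟨_, _, _, (D.inv_ne_succ hb i).symm, (D.nxt_inv_ne hb i).symm,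
    fun h => hne h.symm, rfl⟩] at h2
  omega

theorem Diagram.ext_iff_of_cost (D : Diagram P M O F) (hb : b ∈ F) {i : ℕ}
    (h0 : cost M (O ::ₘ F) O (cyc b (i + 1)) = 0) :
    M.inv (cyc b i) ∈ O ↔ M.inv (cyc b (i + 1)) ∈ O := by
  rw [← D.mirror_succ hb h0, D.nxt_mem_outer]

theorem Diagram.three_le_cost (D : Diagram P M O F) (hb : b ∈ F) {i : ℕ}
    (h0 : cost M (O ::ₘ F) O (cyc b (i + 1)) ≠ 0)
    (h : M.inv (cyc b i) ∈ O ∨ M.inv (cyc b (i + 1)) ∈ O) :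
    3 ≤ cost M (O ::ₘ F) O (cyc b (i + 1)) := by
  have ho : ((orb M (O ::ₘ F) (cyc b (i + 1))).filter (· ∈ O)).card ≠ 0 := by
    refine Finset.card_ne_zero.2 ?_
    rcases h with h | h
    · exact ⟨_, Finset.mem_filter.2 ⟨D.inv_mem_orb hb i, h⟩⟩
    · exact ⟨_, Finset.mem_filter.2 ⟨D.isMap.nu_mem_orb (self_mem_orb (D.mem_darts hb _)),
        D.nxt_mem_outer.2 h⟩⟩
  unfold cost at h0 ⊢
  rw [if_neg ho] at h0 ⊢
  split_ifs at h0 ⊢ <;> omega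

theorem two_le_cost {cs : Multiset (List ℕ)} {d : ℕ}
    (h0 : cost M cs O d ≠ 0) : 2 ≤ cost M cs O d := by
  unfold cost at h0 ⊢
  split_ifs at h0 ⊢ <;> omega

theorem Diagram.six_le_cost (D : Diagram P M O F) (hb : b ∈ F) {i : ℕ}
    (h0 : cost M (O ::ₘ F) O (cyc b (i + 1)) ≠ 0)
    (h1 : M.inv (cyc b i) ∈ O) (h2 : M.inv (cyc b (i + 1)) ∈ O) :
    6 ≤ cost M (O ::ₘ F) O (cyc b (i + 1)) := by
  set d := cyc b (i + 1) with hd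
  set cs := O ::ₘ F with hcs
  have hdm : d ∈ darts cs := D.mem_darts hb _
  have m1 : M.inv (cyc b i) ∈ (orb M cs d).filter (· ∈ O) :=
    Finset.mem_filter.2 ⟨D.inv_mem_orb hb i, h1⟩
  have m2 : nxt cs (M.inv d) ∈ (orb M cs d).filter (· ∈ O) :=
    Finset.mem_filter.2 ⟨D.isMap.nu_mem_orb (self_mem_orb hdm), D.nxt_mem_outer.2 h2⟩
  have ho : ((orb M cs d).filter (· ∈ O)).card ≠ 0 := Finset.card_ne_zero.2 ⟨_, m1⟩
  have ho1 : ((orb M cs d).filter (· ∈ O)).card ≠ 1 := by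
    intro ho1
    have e1 : nxt cs (M.inv d) = M.inv (cyc b i) :=
      Finset.card_le_one.1 ho1.le _ m2 _ m1
    have e2 : nxt cs (M.inv (M.inv (cyc b i))) = d := by
      rw [D.isMap.inv_inv _ (D.mem_darts hb i), D.nxt_face hb]
    have key : ∀ x y, Linked M cs x y →
        ((x = d ∨ x = M.inv (cyc b i)) ↔ (y = d ∨ y = M.inv (cyc b i))) := by
      intro x y hxy
      induction hxy with
      | rel x y hxy =>
        obtain ⟨hx, rfl⟩ := hxy
        constructor
        · rintro (rfl | rfl)
          · exact Or.inr e1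
          · exact Or.inl e2
        · have inj : ∀ y ∈ darts cs, nxt cs (M.inv x) = nxt cs (M.inv y) → x = y := by
            intro y hy hxy
            exact D.isMap.inv_inj hx hy ((nxt cs).injective hxy)
          rintro (h | h)
          · exact Or.inr (inj _ (D.isMap.inv_mem _ (D.mem_darts hb i)) (h.trans e2.symm))
          · exact Or.inl (inj _ hdm (h.trans e1.symm))
      | refl => rfl
      | symm _ _ _ ih => exact ih.symm
      | trans _ _ _ _ _ ih1 ih2 => exact ih1.trans ih2
    have hsub : (orb M cs d).filter (· ∉ O) ⊆ {d} := by
      intro x hx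
      obtain ⟨hx1, hx2⟩ := Finset.mem_filter.1 hx
      rcases (key _ _ (mem_orb.1 hx1).2).1 (Or.inl rfl) with h | h
      · simp [h]
      · exact absurd (h ▸ h1) hx2
    have := Finset.card_le_card hsub
    rw [Finset.card_singleton] at this
    apply h0
    unfold cost
    rw [if_neg ho, if_pos ho1, if_pos this]
  unfold cost
  rw [if_neg ho, if_neg ho1]

end

/-! ### Runs of inner and outer darts -/

section

/-- The indicator of a proposition. -/
noncomputable def ind (p : Prop) : ℕ := by
  classical exact if p then 1 else 0

theorem ind_pos {p : Prop} (h : p) : ind p = 1 := if_pos h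

theorem ind_neg {p : Prop} (h : ¬ p) : ind p = 0 := if_neg h

@[simp] theorem ind_true : ind True = 1 := ind_pos trivial

@[simp] theorem ind_false : ind False = 0 := ind_neg not_false

theorem ind_le (p : Prop) : ind p ≤ 1 := by
  by_cases h : p
  · rw [ind_pos h]
  · rw [ind_neg h]; exact zero_le_one

theorem ind_mono {p q : Prop} (h : p → q) : ind p ≤ ind q := by
  by_cases hp : p
  · rw [ind_pos hp, ind_pos (h hp)]
  · rw [ind_neg hp]; exact zero_le

/-- The number of `i < n` satisfying `p`. -/
noncomputable def cnt (p : ℕ → Prop) (n : ℕ) : ℕ := ∑ i ∈ Finset.range n, ind (p i)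

@[simp] theorem cnt_zero (p : ℕ → Prop) : cnt p 0 = 0 := rfl

theorem cnt_succ (p : ℕ → Prop) (n : ℕ) : cnt p (n + 1) = cnt p n + ind (p n) :=
  Finset.sum_range_succ _ _

theorem cnt_add (p : ℕ → Prop) (m n : ℕ) : cnt p (m + n) = cnt p m + cnt (fun i => p (m + i)) n :=
  Finset.sum_range_add _ _ _

theorem cnt_le (p : ℕ → Prop) (n : ℕ) : cnt p n ≤ n := by
  induction n with
  | zero => simp
  | succ n ih => rw [cnt_succ]; have := ind_le (p n); omega

theorem cnt_add_of_periodic {p : ℕ → Prop} {L : ℕ} (hp : ∀ i, p (i + L) ↔ p i) (a : ℕ) :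
    cnt (fun i => p (a + i)) L = cnt p L := by
  have h1 := cnt_add p a L
  have h2 := cnt_add p L a
  rw [Nat.add_comm L a] at h2
  have h3 : cnt (fun k => p (L + k)) a = cnt p a := by
    congr 1; ext k; rw [Nat.add_comm, hp]
  omega

theorem cnt_not_add (p : ℕ → Prop) (n : ℕ) : cnt (fun i => ¬ p i) n + cnt p n = n := by
  induction n with
  | zero => simp
  | succ n ih =>
    rw [cnt_succ, cnt_succ]
    by_cases h : p n
    · rw [ind_pos h, ind_neg (not_not.2 h)]; omega
    · rw [ind_pos h, ind_neg h]; omega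

theorem cnt_le_mul_cnt {T C : ℕ → Prop} {n B : ℕ}
    (hT : ∀ i, ¬ C i → T i → T (i + 1))
    (hrun : ∀ i k, 1 ≤ k → k ≤ n → (∀ j < k, T (i + j)) → (∀ j, j + 1 < k → ¬ C (i + j)) → k ≤ B)
    (hlast : ∀ i, i + 1 = n → C i) :
    cnt T n ≤ B * cnt (fun i => C i ∧ T i) n := by
  have key : ∀ l ≤ n, ∃ k i, i + k = l ∧ (∀ j < k, T (i + j) ∧ ¬ C (i + j)) ∧
      cnt T l ≤ B * cnt (fun i => C i ∧ T i) l + k := by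
    intro l
    induction l with
    | zero => intro _; exact ⟨0, 0, rfl, by simp, by simp⟩
    | succ l ih =>
      intro hl
      obtain ⟨k, i, rfl, h2, h3⟩ := ih (by omega)
      rw [cnt_succ, cnt_succ]
      by_cases hTl : T (i + k)
      · have hall : ∀ j < k + 1, T (i + j) := by
          intro j hj
          rcases Nat.lt_succ_iff_lt_or_eq.1 hj with h | rfl
          · exact (h2 j h).1
          · exact hTl
        by_cases hCl : C (i + k)
        · refine ⟨0, i + k + 1, by omega, by simp, ?_⟩
          have := hrun i (k + 1) (by omega) (by omega) hall
            (fun j hj => (h2 j (by omega)).2)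
          rw [ind_pos hTl, ind_pos ⟨hCl, hTl⟩, Nat.mul_add]
          omega
        · refine ⟨k + 1, i, by omega, ?_, ?_⟩
          · intro j hj
            refine ⟨hall j hj, ?_⟩
            rcases Nat.lt_succ_iff_lt_or_eq.1 hj with h | rfl
            · exact (h2 j h).2
            · exact hCl
          · rw [ind_pos hTl, ind_neg (fun h => hCl h.1)]
            simp only [Nat.add_zero]
            omega
      · have hk : k = 0 := by
          by_contra hk
          have := h2 (k - 1) (by omega)
          have h4 := hT _ this.2 this.1
          rw [show i + (k - 1) + 1 = i + k by omega] at h4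
          exact hTl h4
        subst hk
        refine ⟨0, i + 1, by omega, by simp, ?_⟩
        rw [ind_neg hTl, ind_neg (fun h => hTl h.2)]
        simp only [Nat.add_zero] at *
        omega
  obtain ⟨k, i, h1, h2, h3⟩ := key n le_rfl
  rcases Nat.eq_zero_or_pos k with rfl | hk
  · simpa using h3
  · exact absurd (hlast (i + (k - 1)) (by omega)) (h2 (k - 1) (by omega)).2

theorem cnt_le_mul_cnt_of_periodic {T C : ℕ → Prop} {L B : ℕ}
    (hTL : ∀ i, T (i + L) ↔ T i) (hCL : ∀ i, C (i + L) ↔ C i)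
    (hT : ∀ i, ¬ C i → T i → T (i + 1))
    (hrun : ∀ i k, 1 ≤ k → k ≤ L → (∀ j < k, T (i + j)) → (∀ j, j + 1 < k → ¬ C (i + j)) → k ≤ B)
    (hex : ∃ i, C i) :
    cnt T L ≤ B * cnt (fun i => C i ∧ T i) L := by
  obtain ⟨i₀, hi₀⟩ := hex
  rw [← cnt_add_of_periodic hTL (i₀ + 1),
    ← cnt_add_of_periodic (p := fun i => C i ∧ T i) (fun i => by rw [hTL, hCL]) (i₀ + 1)]
  refine cnt_le_mul_cnt (T := fun i => T (i₀ + 1 + i)) (C := fun i => C (i₀ + 1 + i))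
    (fun i => hT (i₀ + 1 + i)) ?_ ?_
  · intro i k h1 h2 h3 h4
    exact hrun (i₀ + 1 + i) k h1 h2 (fun j hj => by rw [Nat.add_assoc]; exact h3 j hj)
      (fun j hj => by rw [Nat.add_assoc]; exact h4 j hj)
  · intro i hi
    rw [show i₀ + 1 + i = i₀ + L by omega]
    exact (hCL _).2 hi₀

variable {S : Type} {P : C6Presentation S} {M : MapData S P.Grp} {O : List ℕ}
  {F : Multiset (List ℕ)} {b : List ℕ}

/-- The `i`-th dart of the face `b` lies on the boundary of the diagram. -/
def Ext (M : MapData S P.Grp) (O b : List ℕ) (i : ℕ) : Prop := M.inv (cyc b i) ∈ O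

/-- The corner of the face `b` following its `i`-th dart has nonzero cost. -/
def Chg (M : MapData S P.Grp) (O : List ℕ) (F : Multiset (List ℕ)) (b : List ℕ) (i : ℕ) : Prop :=
  cost M (O ::ₘ F) O (cyc b (i + 1)) ≠ 0

theorem ext_add_length (i : ℕ) : Ext M O b (i + b.length) ↔ Ext M O b i := by
  unfold Ext; rw [cyc_add_length]

theorem chg_add_length (i : ℕ) : Chg M O F b (i + b.length) ↔ Chg M O F b i := by
  unfold Chg; rw [Nat.add_right_comm, cyc_add_length]

theorem Diagram.ext_succ (D : Diagram P M O F) (hb : b ∈ F) {i : ℕ} (h : ¬ Chg M O F b i) :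
    Ext M O b i ↔ Ext M O b (i + 1) := D.ext_iff_of_cost hb (not_not.1 h)

theorem Diagram.mirror_run (D : Diagram P M O F) (hb : b ∈ F) {A : List ℕ}
    (hA : A ∈ O ::ₘ F) (hA' : A ≠ []) {i J k : ℕ} (hk : k ≤ J + 1)
    (hJ : M.inv (cyc b i) = cyc A J) (hc : ∀ j, j + 1 < k → ¬ Chg M O F b (i + j)) :
    ∀ j < k, M.inv (cyc b (i + j)) = cyc A (J - j) := by
  intro j
  induction j with
  | zero => intro _; simpa using hJ
  | succ j ih =>
    intro hj
    apply (nxt (O ::ₘ F)).injective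
    rw [nxt_cyc D.nodup hA hA', ← Nat.add_assoc,
      D.mirror_succ hb (not_not.1 (hc j hj)), ih (by omega)]
    congr 1
    omega

theorem getElem_rotate_map {A : Type} (f : ℕ → A) (b : List ℕ) (i j : ℕ)
    (hj : j < ((b.map f).rotate i).length) : ((b.map f).rotate i)[j] = f (cyc b (i + j)) := by
  simp only [← List.map_rotate, rotate_eq_map_cyc, List.getElem_map, List.getElem_range]

theorem getElem_wordInv {S : Type} (w : Word S) (j : ℕ) (hj : j < (wordInv w).length) :
    (wordInv w)[j] = flipLetter (w[w.length - 1 - j]'(by simp at hj; omega)) := by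
  simp [wordInv_eq]

theorem Diagram.take_eq_of_mirror (D : Diagram P M O F) (hb : b ∈ F) {A : List ℕ}
    {i J k : ℕ} (hk : k ≤ J + 1) (hkA : k ≤ A.length) (hkb : k ≤ b.length)
    (h : ∀ j < k, M.inv (cyc b (i + j)) = cyc A (J - j)) :
    ((b.map M.lab).rotate i).take k = (wordInv ((A.map M.lab).rotate (J + 1))).take k := by
  apply List.ext_getElem
  · simp; omega
  · intro j h1 h2
    have hj : j < k := by simp at h1; omega
    simp only [List.getElem_take]
    rw [getElem_rotate_map, getElem_wordInv, getElem_rotate_map]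
    have e : cyc A (J + 1 + (((A.map M.lab).rotate (J + 1)).length - 1 - j)) = cyc A (J - j) := by
      rw [← cyc_add_length A (J - j)]
      congr 1
      simp; omega
    rw [e, ← h j hj, D.isMap.lab_inv _ (D.mem_darts hb _), flipLetter_flipLetter]

theorem Diagram.inner_run (D : Diagram P M O F) (hb : b ∈ F) {i k : ℕ} (hk1 : 1 ≤ k)
    (hk : k ≤ b.length) (hE : ∀ j < k, ¬ Ext M O b (i + j))
    (hc : ∀ j, j + 1 < k → ¬ Chg M O F b (i + j)) : 6 * k < b.length := by
  have h0 : M.inv (cyc b i) ∈ darts (O ::ₘ F) := D.isMap.inv_mem _ (D.mem_darts hb i)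
  rw [darts_cons, Multiset.mem_add] at h0
  have h0' := h0.resolve_left (fun h => hE 0 (by omega) (by simpa [Ext] using h))
  obtain ⟨A, hA, hd⟩ := GSC.mem_darts.1 h0'
  obtain ⟨j₀, hj₀, hj⟩ := exists_cyc hd
  have hAne := D.ne A hA
  obtain ⟨J, hJ1, hJ⟩ : ∃ J, k ≤ J + 1 ∧ M.inv (cyc b i) = cyc A J := by
    refine ⟨j₀ + A.length * k, ?_, ?_⟩
    · have : k ≤ A.length * k := Nat.le_mul_of_pos_left _ (by omega)
      omega
    · rw [← hj, ← cyc_mod A (j₀ + _), Nat.add_mul_mod_self_left, cyc_mod]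
  have hrun := D.mirror_run hb (Multiset.mem_cons_of_mem hA) hAne hJ1 hJ hc
  have hne := D.mirror b hb A hA i J hJ
  set k' := min k A.length with hk'
  have heq := D.take_eq_of_mirror hb (A := A) (i := i) (J := J) (k := k') (by omega) (by omega)
    (by omega) (fun j hj => hrun j (by omega))
  have hr1 := P.rotate_mem _ (D.rel b hb) i
  have hr2 := P.inv_mem _ (P.rotate_mem _ (D.rel A hA) (J + 1))
  have hp1 := List.take_prefix k' ((b.map M.lab).rotate i)
  have hp2 := List.take_prefix k' (wordInv ((A.map M.lab).rotate (J + 1)))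
  rw [← heq] at hp2
  have hpc : IsPiece P.rels (((b.map M.lab).rotate i).take k') := ⟨_, hr1, _, hr2, hne, hp1, hp2⟩
  have s1 := P.small_cancellation _ hr1 _ hp1 hpc
  have s2 := P.small_cancellation _ hr2 _ hp2 hpc
  simp only [List.length_take, List.length_rotate, List.length_map, length_wordInv] at s1 s2
  omega

/-- The number of boundary darts of a face. -/
noncomputable def extCount (M : MapData S P.Grp) (O b : List ℕ) : ℕ :=
  cnt (Ext M O b) b.length

/-- The number of maximal boundary runs of a face ending in a charged corner. -/
noncomputable def extRuns (M : MapData S P.Grp) (O : List ℕ) (F : Multiset (List ℕ))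
    (b : List ℕ) : ℕ :=
  cnt (fun i => Chg M O F b i ∧ Ext M O b i) b.length

/-- The number of maximal inner runs of a face. -/
noncomputable def intRuns (M : MapData S P.Grp) (O : List ℕ) (F : Multiset (List ℕ))
    (b : List ℕ) : ℕ :=
  cnt (fun i => Chg M O F b i ∧ ¬ Ext M O b i) b.length

theorem extCount_le : extCount M O b ≤ b.length := cnt_le _ _

theorem Diagram.ext_of_not_chg (D : Diagram P M O F) (hb : b ∈ F) (h : ∀ i, ¬ Chg M O F b i) :
    ∀ i, Ext M O b i := by
  have hall : ∀ i, Ext M O b i ↔ Ext M O b 0 := by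
    intro i
    induction i with
    | zero => rfl
    | succ i ih => rw [← D.ext_succ hb (h i), ih]
  intro i
  by_contra hi
  have := D.inner_run hb (i := 0) (k := b.length) (List.length_pos_of_ne_nil (D.ne b hb)) le_rfl
    (fun j _ => by rw [hall, ← hall i]; exact hi) (fun j _ => h _)
  omega

theorem Diagram.six_mul_inner_le (D : Diagram P M O F) (hb : b ∈ F) (h : ∃ i, Chg M O F b i) :
    6 * (b.length - extCount M O b) ≤ intRuns M O F b * (b.length - 1) := by
  have h1 : cnt (fun i => ¬ Ext M O b i) b.length ≤
      ((b.length - 1) / 6) * intRuns M O F b := by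
    refine cnt_le_mul_cnt_of_periodic (T := fun i => ¬ Ext M O b i)
      (fun i => by rw [ext_add_length]) chg_add_length
      ?_ ?_ h
    · intro i hi hE; rwa [← D.ext_succ hb hi]
    · intro i k hk1 hk hE hc
      have := D.inner_run hb hk1 hk hE hc
      omega
  have h2 : cnt (fun i => ¬ Ext M O b i) b.length + extCount M O b = b.length := by
    exact cnt_not_add _ _
  have h3 : 6 * (((b.length - 1) / 6) * intRuns M O F b) ≤ intRuns M O F b * (b.length - 1) := by
    have := Nat.div_mul_le_self (b.length - 1) 6
    calc _ = intRuns M O F b * ((b.length - 1) / 6 * 6) := by ring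
      _ ≤ _ := Nat.mul_le_mul_left _ this
  omega

theorem Diagram.sum_ext_succ (D : Diagram P M O F) (hb : b ∈ F) :
    (∑ i ∈ Finset.range b.length, (ind (Chg M O F b i ∧ Ext M O b (i + 1)) : ℤ)) =
      extRuns M O F b := by
  rw [extRuns, cnt, Nat.cast_sum]
  have h1 : ∑ i ∈ Finset.range b.length, (ind (Ext M O b (i + 1)) : ℤ) =
      ∑ i ∈ Finset.range b.length, (ind (Ext M O b i) : ℤ) :=
    sum_cyc_succ b (fun d => (ind (M.inv d ∈ O) : ℤ))
  rw [← sub_eq_zero, ← Finset.sum_sub_distrib] at h1 ⊢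
  rw [← h1]
  refine Finset.sum_congr rfl (fun i _ => ?_)
  by_cases hC : Chg M O F b i
  · simp [hC]
  · simp [hC, D.ext_succ hb hC]

/-- The curvature of an inner face. -/
noncomputable def curv (M : MapData S P.Grp) (O : List ℕ) (F : Multiset (List ℕ))
    (b : List ℕ) : ℤ := 12 - (b.map (cost M (O ::ₘ F) O)).sum

theorem curv_eq : curv M O F b =
    12 - ∑ i ∈ Finset.range b.length, cost M (O ::ₘ F) O (cyc b (i + 1)) := by
  rw [curv, sum_map_eq_sum_cyc, ← sum_cyc_succ]

theorem Diagram.curv_le (D : Diagram P M O F) (hb : b ∈ F) :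
    curv M O F b ≤ 12 - 6 * (extRuns M O F b : ℤ) := by
  rw [curv_eq]
  have h1 := D.sum_ext_succ hb
  have h2 : (extRuns M O F b : ℤ) =
      ∑ i ∈ Finset.range b.length, (ind (Chg M O F b i ∧ Ext M O b i) : ℤ) := by
    rw [extRuns, cnt, Nat.cast_sum]
  have h3 : ∑ i ∈ Finset.range b.length, (3 * (ind (Chg M O F b i ∧ Ext M O b i) : ℤ)
      + 3 * (ind (Chg M O F b i ∧ Ext M O b (i + 1)) : ℤ)) ≤
      ∑ i ∈ Finset.range b.length, cost M (O ::ₘ F) O (cyc b (i + 1)) := by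
    refine Finset.sum_le_sum (fun i _ => ?_)
    by_cases hC : Chg M O F b i
    · by_cases e1 : Ext M O b i <;> by_cases e2 : Ext M O b (i + 1)
      · simpa [hC, e1, e2] using D.six_le_cost hb hC e1 e2
      · simpa [hC, e1, e2] using D.three_le_cost hb hC (Or.inl e1)
      · simpa [hC, e1, e2] using D.three_le_cost hb hC (Or.inr e2)
      · simpa [hC, e1, e2] using cost_nonneg _ _
    · simpa [hC] using cost_nonneg _ _
  rw [Finset.sum_add_distrib, ← Finset.mul_sum, ← Finset.mul_sum, ← h2, h1] at h3
  linarith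

theorem Diagram.curv_le' (D : Diagram P M O F) (hb : b ∈ F) :
    curv M O F b ≤ 12 - 4 * (extRuns M O F b : ℤ) - 2 * intRuns M O F b := by
  rw [curv_eq]
  have h1 := D.sum_ext_succ hb
  have h2 : (extRuns M O F b : ℤ) =
      ∑ i ∈ Finset.range b.length, (ind (Chg M O F b i ∧ Ext M O b i) : ℤ) := by
    rw [extRuns, cnt, Nat.cast_sum]
  have h4 : (intRuns M O F b : ℤ) =
      ∑ i ∈ Finset.range b.length, (ind (Chg M O F b i ∧ ¬ Ext M O b i) : ℤ) := by
    rw [intRuns, cnt, Nat.cast_sum]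
  have h3 : ∑ i ∈ Finset.range b.length, (3 * (ind (Chg M O F b i ∧ Ext M O b i) : ℤ)
      + (ind (Chg M O F b i ∧ Ext M O b (i + 1)) : ℤ)
      + 2 * (ind (Chg M O F b i ∧ ¬ Ext M O b i) : ℤ)) ≤
      ∑ i ∈ Finset.range b.length, cost M (O ::ₘ F) O (cyc b (i + 1)) := by
    refine Finset.sum_le_sum (fun i _ => ?_)
    by_cases hC : Chg M O F b i
    · by_cases e1 : Ext M O b i <;> by_cases e2 : Ext M O b (i + 1)
      · have := D.six_le_cost hb hC e1 e2
        simp [hC, e1, e2]; linarith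
      · simpa [hC, e1, e2] using D.three_le_cost hb hC (Or.inl e1)
      · simpa [hC, e1, e2] using D.three_le_cost hb hC (Or.inr e2)
      · simpa [hC, e1, e2] using two_le_cost hC
    · simpa [hC] using cost_nonneg _ _
  rw [Finset.sum_add_distrib, Finset.sum_add_distrib, ← Finset.mul_sum, ← Finset.mul_sum, ← h2,
    h1, ← h4] at h3
  linarith

end

/-! ### Corner weights and curvature -/

section

variable {S : Type} {P : C6Presentation S} {M : MapData S P.Grp} {O : List ℕ}
  {F : Multiset (List ℕ)} {b : List ℕ}

/-- The total weight of the uncharged outer corners traversed by a face. -/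
noncomputable def corn (M : MapData S P.Grp) (O : List ℕ) (F : Multiset (List ℕ)) (β : ℕ → ℤ)
    (b : List ℕ) : ℤ :=
  ∑ i ∈ Finset.range b.length,
    (ind (Ext M O b i ∧ ¬ Chg M O F b i) : ℤ) * β (O.idxOf (M.inv (cyc b i)))

theorem cyc_idxOf {d : ℕ} (hd : d ∈ O) : cyc O (O.idxOf d) = d := by
  rw [cyc_eq_getElem (List.idxOf_lt_length_iff.2 hd)]
  exact List.getElem_idxOf _

theorem idxOf_cyc (hO : O.Nodup) (hO' : O ≠ []) (j : ℕ) : O.idxOf (cyc O j) = j % O.length := by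
  have hm := cyc_mem hO' j
  apply cyc_inj hO (List.idxOf_lt_length_iff.2 hm)
    (Nat.mod_lt _ (List.length_pos_of_ne_nil hO'))
  rw [cyc_idxOf hm, cyc_mod]

theorem Diagram.spur_mem (D : Diagram P M O F) {d : ℕ} (hd : d ∈ O)
    (h : nxt (O ::ₘ F) (M.inv d) = d) : M.inv d ∈ O := by
  rw [← D.nxt_mem_outer, h]; exact hd

open Classical in
theorem Diagram.sum_corn_le (D : Diagram P M O F) {β : ℕ → ℤ} (hβ : ∀ j, 0 ≤ β j) :
    (F.map (corn M O F β)).sum +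
      ∑ d ∈ O.toFinset.filter (fun d => nxt (O ::ₘ F) (M.inv d) = d), β (O.idxOf d) ≤
    ∑ j ∈ Finset.range O.length, β j := by
  set h : ℕ → ℤ := fun x => if M.inv x ∈ O then β (O.idxOf (M.inv x)) else 0 with hh
  have h0 : ∀ x, 0 ≤ h x := by
    intro x; simp only [hh]; split_ifs; exacts [hβ _, le_rfl]
  have h1 : (F.map (corn M O F β)).sum ≤ (F.map fun b => (b.map h).sum).sum := by
    refine Multiset.sum_map_le_sum_map _ _ (fun b _ => ?_)
    rw [sum_map_eq_sum_cyc]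
    refine Finset.sum_le_sum (fun i _ => ?_)
    by_cases hE : Ext M O b i ∧ ¬ Chg M O F b i
    · rw [ind_pos hE]; simp only [hh]; rw [if_pos (show M.inv (cyc b i) ∈ O from hE.1)]; simp
    · rw [ind_neg hE]; simpa using h0 _
  have hn := D.nodup
  have hsum : ∑ x ∈ (darts (O ::ₘ F)).toFinset, h x =
      (O.map h).sum + (F.map fun b => (b.map h).sum).sum := by
    have : ((O ::ₘ F).map fun b => (b.map h).sum).sum = ∑ x ∈ (darts (O ::ₘ F)).toFinset, h x := by
      rw [← sum_map_darts, Finset.sum, Multiset.toFinset_val, hn.dedup]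
    rw [← this]; simp
  have hinv : ∑ x ∈ (darts (O ::ₘ F)).toFinset, h x =
      ∑ x ∈ (darts (O ::ₘ F)).toFinset, if x ∈ O then β (O.idxOf x) else 0 := by
    refine Finset.sum_bij' (fun x _ => M.inv x) (fun x _ => M.inv x) ?_ ?_ ?_ ?_ ?_
    · intro x hx; simp only [Multiset.mem_toFinset] at *; exact D.isMap.inv_mem _ hx
    · intro x hx; simp only [Multiset.mem_toFinset] at *; exact D.isMap.inv_mem _ hx
    · intro x hx; exact D.isMap.inv_inv _ (Multiset.mem_toFinset.1 hx)
    · intro x hx; exact D.isMap.inv_inv _ (Multiset.mem_toFinset.1 hx)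
    · intro x hx; rfl
  have hO : ∑ x ∈ (darts (O ::ₘ F)).toFinset, (if x ∈ O then β (O.idxOf x) else 0) =
      ∑ j ∈ Finset.range O.length, β j := by
    rw [← Finset.sum_filter]
    have e1 : (darts (O ::ₘ F)).toFinset.filter (· ∈ O) = O.toFinset := by
      ext x; simp only [Finset.mem_filter, Multiset.mem_toFinset, List.mem_toFinset]
      exact ⟨fun h => h.2, fun h => ⟨Diagram.outer_mem_darts h, h⟩⟩
    rw [e1, List.sum_toFinset _ D.outer_nodup, sum_map_eq_sum_cyc]
    refine Finset.sum_congr rfl (fun j hj => ?_)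
    rw [idxOf_cyc D.outer_nodup D.outer_ne, Nat.mod_eq_of_lt (Finset.mem_range.1 hj)]
  have hsp : ∑ d ∈ O.toFinset.filter (fun d => nxt (O ::ₘ F) (M.inv d) = d), β (O.idxOf d) ≤
      (O.map h).sum := by
    rw [← List.sum_toFinset _ D.outer_nodup]
    calc _ = ∑ d ∈ (O.toFinset.filter (fun d => nxt (O ::ₘ F) (M.inv d) = d)).image M.inv,
          h d := by
          rw [Finset.sum_image]
          · refine Finset.sum_congr rfl (fun d hd => ?_)
            have hd' := List.mem_toFinset.1 (Finset.mem_filter.1 hd).1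
            simp only [hh, D.isMap.inv_inv _ (Diagram.outer_mem_darts hd'), if_pos hd']
          · intro x hx y hy hxy
            have hx' := List.mem_toFinset.1 (Finset.mem_filter.1 hx).1
            have hy' := List.mem_toFinset.1 (Finset.mem_filter.1 hy).1
            rw [← D.isMap.inv_inv _ (Diagram.outer_mem_darts hx'), hxy,
              D.isMap.inv_inv _ (Diagram.outer_mem_darts hy')]
      _ ≤ _ := by
          refine Finset.sum_le_sum_of_subset_of_nonneg ?_ (fun x _ _ => h0 x)
          intro x hx
          obtain ⟨d, hd, rfl⟩ := Finset.mem_image.1 hx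
          have hd' := Finset.mem_filter.1 hd
          exact List.mem_toFinset.2 (D.spur_mem (List.mem_toFinset.1 hd'.1) hd'.2)
  linarith

/-- The weighted form of the combinatorial Gauss–Bonnet inequality. -/
theorem Diagram.curvature (D : Diagram P M O F) {β : ℕ → ℤ} (hβ : ∀ j, 0 ≤ β j)
    (hsp : ∀ d ∈ O, nxt (O ::ₘ F) (M.inv d) = d → 6 ≤ β (O.idxOf d)) :
    12 ≤ (F.map fun b => curv M O F b - corn M O F β b).sum +
      ∑ j ∈ Finset.range O.length, β j := by
  classical
  have h1 := D.isMap.curvature D.outer_ne (fun d hd _ => by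
    obtain ⟨b, hb, hdb⟩ := GSC.mem_darts.1 hd
    obtain ⟨i, -, rfl⟩ := exists_cyc hdb
    rw [← cyc_add_length]
    obtain ⟨k, hk⟩ := Nat.exists_eq_succ_of_ne_zero (List.length_pos_of_ne_nil (D.ne b hb)).ne'
    rw [hk, Nat.succ_eq_add_one, ← Nat.add_assoc]
    exact D.nxt_inv_ne hb _)
  have h2 := D.sum_corn_le hβ
  have h3 : 6 * ((O.toFinset.filter fun d => nxt (O ::ₘ F) (M.inv d) = d).card : ℤ) ≤
      ∑ d ∈ O.toFinset.filter (fun d => nxt (O ::ₘ F) (M.inv d) = d), β (O.idxOf d) := by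
    rw [mul_comm, ← nsmul_eq_mul]
    refine Finset.card_nsmul_le_sum _ _ _ (fun d hd => ?_)
    have hd' := Finset.mem_filter.1 hd
    exact hsp d (List.mem_toFinset.1 hd'.1) hd'.2
  rw [Multiset.sum_map_sub]
  unfold curv
  linarith

end

/-! ### Curvature of faces -/

section

theorem cnt_eq_zero {p : ℕ → Prop} {n : ℕ} (h : ∀ i < n, ¬ p i) : cnt p n = 0 :=
  Finset.sum_eq_zero fun i hi => ind_neg (h i (Finset.mem_range.1 hi))

theorem cnt_eq_self {p : ℕ → Prop} {n : ℕ} (h : ∀ i < n, p i) : cnt p n = n := by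
  have := cnt_not_add p n
  rwa [cnt_eq_zero (fun i hi => not_not.2 (h i hi)), Nat.zero_add] at this

theorem cnt_pos {p : ℕ → Prop} {n i : ℕ} (hi : i < n) (h : p i) : 0 < cnt p n := by
  have : ind (p i) ≤ cnt p n :=
    Finset.single_le_sum (f := fun i => ind (p i)) (fun _ _ => Nat.zero_le _)
      (Finset.mem_range.2 hi)
  rw [ind_pos h] at this
  exact this

theorem exists_of_cnt_pos {p : ℕ → Prop} {n : ℕ} (h : 0 < cnt p n) : ∃ i < n, p i := by
  by_contra! hc
  rw [cnt_eq_zero hc] at h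
  exact lt_irrefl _ h

theorem cnt_of_upward {q : ℕ → Prop} {n : ℕ} (h : ∀ j, j + 1 < n → q j → q (j + 1)) :
    ∀ j < n, q j ↔ n - cnt q n ≤ j := by
  intro j hj
  by_cases hex : ∃ j < n, q j
  · classical
    set m := Nat.find hex with hm
    obtain ⟨h1, h2⟩ := Nat.find_spec hex
    have hmin : ∀ i < m, ¬ q i := fun i hi hq =>
      Nat.find_min hex hi ⟨by omega, hq⟩
    have hup : ∀ k, m + k < n → q (m + k) := by
      intro k
      induction k with
      | zero => exact fun _ => h2
      | succ k ih => exact fun hk => h _ (by omega) (ih (by omega))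
    have hc : cnt q n = n - m := by
      rw [show n = m + (n - m) by omega, cnt_add, cnt_eq_zero hmin,
        cnt_eq_self (fun i hi => hup i (by omega))]
      omega
    rw [hc]
    constructor
    · intro hq
      have := Nat.find_min' hex ⟨hj, hq⟩
      omega
    · intro hle
      have := hup (j - m) (by omega)
      rwa [show m + (j - m) = j by omega] at this
  · push Not at hex
    rw [cnt_eq_zero hex]
    simp only [hex j hj, false_iff]
    omega

theorem sum_add_of_periodic {A : Type} [AddCommGroup A] {f : ℕ → A} {L : ℕ}
    (hf : ∀ i, f (i + L) = f i) (a : ℕ) :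
    ∑ i ∈ Finset.range L, f (a + i) = ∑ i ∈ Finset.range L, f i := by
  have h1 := Finset.sum_range_add f a L
  have h2 := Finset.sum_range_add f L a
  rw [Nat.add_comm L a, h1, add_comm] at h2
  have h3 : ∑ k ∈ Finset.range a, f (L + k) = ∑ k ∈ Finset.range a, f k :=
    Finset.sum_congr rfl (fun k _ => by rw [Nat.add_comm, hf])
  rw [h3] at h2
  exact add_right_cancel h2

theorem cyc_eq_iff {b : List ℕ} (hb : b.Nodup) (hne : b ≠ []) {x y : ℕ} :
    cyc b x = cyc b y ↔ x % b.length = y % b.length := by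
  have hpos := List.length_pos_of_ne_nil hne
  constructor
  · intro h
    rw [← cyc_mod b x, ← cyc_mod b y] at h
    exact cyc_inj hb (Nat.mod_lt _ hpos) (Nat.mod_lt _ hpos) h
  · intro h
    rw [← cyc_mod b x, h, cyc_mod]

variable {S : Type} {P : C6Presentation S} {M : MapData S P.Grp} {O : List ℕ}
  {F : Multiset (List ℕ)} {b : List ℕ}

theorem Diagram.exists_mirror_outer (D : Diagram P M O F) (hb : b ∈ F) {i k : ℕ}
    (hE : Ext M O b i) (hc : ∀ j, j + 1 < k → ¬ Chg M O F b (i + j)) :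
    ∃ J, k ≤ J + 1 ∧ ∀ j < k, M.inv (cyc b (i + j)) = cyc O (J - j) := by
  obtain ⟨j₀, hj₀, hj⟩ := exists_cyc hE
  have hpos := List.length_pos_of_ne_nil D.outer_ne
  refine ⟨j₀ + O.length * k, ?_, ?_⟩
  · have : k ≤ O.length * k := Nat.le_mul_of_pos_left _ hpos
    omega
  · refine D.mirror_run hb (Multiset.mem_cons_self _ _) D.outer_ne ?_ ?_ hc
    · have : k ≤ O.length * k := Nat.le_mul_of_pos_left _ hpos
      omega
    · rw [← hj, ← cyc_mod O (j₀ + _), Nat.add_mul_mod_self_left, cyc_mod]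

theorem Diagram.exists_window (D : Diagram P M O F) (hb : b ∈ F) {i k : ℕ} (hk1 : 1 ≤ k)
    (hkb : k ≤ b.length) (hE : Ext M O b i) (hc : ∀ j, j + 1 < k → ¬ Chg M O F b (i + j)) :
    ∃ p < O.length, k ≤ O.length ∧ (∀ j < k, M.inv (cyc b (i + j)) = cyc O (p + k - 1 - j)) ∧
      ((O.map M.lab).rotate p).take k = (wordInv ((b.map M.lab).rotate (i + k))).take k := by
  obtain ⟨J, hJ, hrun⟩ := D.exists_mirror_outer hb hE hc
  have hpos := List.length_pos_of_ne_nil D.outer_ne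
  set p := (J + 1 - k) % O.length with hp
  have hrun' : ∀ j < k, M.inv (cyc b (i + j)) = cyc O (p + k - 1 - j) := by
    intro j hj
    rw [hrun j hj, cyc_eq_iff D.outer_nodup D.outer_ne,
      show J - j = (J + 1 - k) + (k - 1 - j) by omega,
      show p + k - 1 - j = p + (k - 1 - j) by omega, Nat.add_mod, hp]
    simp
  have hkO : k ≤ O.length := by
    by_contra hlt
    have h1 := hrun' 0 (by omega)
    have h2 := hrun' O.length (by omega)
    rw [← cyc_add_length O (p + k - 1 - O.length),
      show p + k - 1 - O.length + O.length = p + k - 1 - 0 by omega, ← h1] at h2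
    have h3 := D.isMap.inv_inj (D.mem_darts hb _) (D.mem_darts hb _) h2
    rw [cyc_eq_iff (D.face_nodup hb) (D.ne b hb), Nat.add_zero] at h3
    have h4 : (i + O.length) ≡ (i + 0) [MOD b.length] := h3
    have h5 := Nat.ModEq.add_left_cancel' i h4
    rw [Nat.modEq_zero_iff_dvd] at h5
    have := Nat.le_of_dvd hpos h5
    omega
  refine ⟨p, Nat.mod_lt _ hpos, hkO, hrun', ?_⟩
  apply List.ext_getElem
  · simp; omega
  · intro j h1 h2
    have hj : j < k := by simp at h1; omega
    simp only [List.getElem_take]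
    rw [getElem_rotate_map, getElem_wordInv, getElem_rotate_map]
    have e : cyc b (i + k + (((b.map M.lab).rotate (i + k)).length - 1 - j)) =
        cyc b (i + (k - 1 - j)) := by
      rw [← cyc_add_length b (i + (k - 1 - j))]
      congr 1
      simp; omega
    rw [e, ← D.isMap.lab_inv _ (D.mem_darts hb _), hrun' _ (by omega)]
    congr 2
    omega

theorem Diagram.uncharged (D : Diagram P M O F) (hb : b ∈ F) (h : ∀ i, ¬ Chg M O F b i)
    (β : ℕ → ℤ) : b.length = O.length ∧ O.map M.lab ∈ P.rels ∧
      corn M O F β b = ∑ j ∈ Finset.range O.length, β j := by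
  have hE := D.ext_of_not_chg hb h
  have hL := List.length_pos_of_ne_nil (D.ne b hb)
  have hn := List.length_pos_of_ne_nil D.outer_ne
  obtain ⟨p, hp, hLn, hrun, hw⟩ := D.exists_window hb (i := 0) (k := b.length) hL le_rfl
    (hE 0) (fun j _ => h _)
  have hlen : b.length = O.length := by
    obtain ⟨J, hJ, hr⟩ := D.exists_mirror_outer hb (i := 0) (k := b.length + 1) (hE 0)
      (fun j _ => h _)
    have h1 := hr 0 (by omega)
    have h2 := hr b.length (by omega)
    rw [cyc_add_length, ← Nat.add_zero 0, h1, cyc_eq_iff D.outer_nodup D.outer_ne] at h2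
    have h3 : J - b.length + b.length ≡ J - b.length + 0 [MOD O.length] := by
      rw [Nat.sub_add_cancel (by omega)]; exact h2
    have h4 := Nat.ModEq.add_left_cancel' _ h3
    rw [Nat.modEq_zero_iff_dvd] at h4
    exact le_antisymm hLn (Nat.le_of_dvd hL h4)
  refine ⟨hlen, ?_, ?_⟩
  · rw [List.take_of_length_le (by simp [hlen]), List.take_of_length_le (by simp)] at hw
    have h1 : (O.map M.lab).rotate p ∈ P.rels := by
      rw [hw]; exact P.inv_mem _ (P.rotate_mem _ (D.rel b hb) _)
    have h2 := P.rotate_mem _ h1 (O.length - p)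
    rwa [List.rotate_rotate, show p + (O.length - p) = (O.map M.lab).length by simp; omega,
      List.rotate_length] at h2
  · unfold corn
    have h1 : ∀ i ∈ Finset.range b.length, (ind (Ext M O b i ∧ ¬ Chg M O F b i) : ℤ) *
        β (O.idxOf (M.inv (cyc b i))) = β ((p + (b.length - 1 - i)) % O.length) := by
      intro i hi
      have hi' := Finset.mem_range.1 hi
      have := hrun i hi'
      rw [Nat.zero_add] at this
      rw [ind_pos ⟨hE i, h i⟩, this, idxOf_cyc D.outer_nodup D.outer_ne,
        show p + b.length - 1 - i = p + (b.length - 1 - i) by omega]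
      simp
    rw [Finset.sum_congr rfl h1,
      Finset.sum_range_reflect (fun x => β ((p + x) % O.length)) b.length, hlen,
      sum_add_of_periodic (f := fun x => β (x % O.length)) (fun i => by simp) p]
    exact Finset.sum_congr rfl (fun i hi => by rw [Nat.mod_eq_of_lt (Finset.mem_range.1 hi)])

theorem Diagram.extCount_eq_zero (D : Diagram P M O F) (hb : b ∈ F) (h : ∃ i, Chg M O F b i)
    (he : extRuns M O F b = 0) : extCount M O b = 0 := by
  have := cnt_le_mul_cnt_of_periodic (T := Ext M O b) (C := Chg M O F b) (B := b.length)
    ext_add_length chg_add_length (fun i hi hE => (D.ext_succ hb hi).1 hE)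
    (fun i k _ hk _ _ => hk) h
  unfold extRuns at he
  rw [he] at this
  unfold extCount; omega

theorem Diagram.single_run (D : Diagram P M O F) (hb : b ∈ F) (he : extRuns M O F b = 1) :
    ∃ i, 1 ≤ extCount M O b ∧ (∀ j < extCount M O b, Ext M O b (i + j)) ∧
      (∀ j, extCount M O b ≤ j → j < b.length → ¬ Ext M O b (i + j)) ∧
      (∀ j, j + 1 < extCount M O b → ¬ Chg M O F b (i + j)) ∧
      Chg M O F b (i + (extCount M O b - 1)) := by
  obtain ⟨c, hc, hcC, hcE⟩ := exists_of_cnt_pos (p := fun i => Chg M O F b i ∧ Ext M O b i)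
    (n := b.length) (by have : 0 < extRuns M O F b := by omega
                        exact this)
  have h1 := cnt_add_of_periodic (p := fun i => Chg M O F b i ∧ Ext M O b i) (L := b.length)
    (fun i => by rw [chg_add_length, ext_add_length]) (c + 1)
  have h2 : cnt (fun i => Chg M O F b i ∧ Ext M O b i) b.length = 1 := he
  rw [h2] at h1
  obtain ⟨l, hl⟩ := Nat.exists_eq_succ_of_ne_zero (List.length_pos_of_ne_nil (D.ne b hb)).ne'
  have hlast : c + 1 + l = c + b.length := by omega
  rw [hl, Nat.succ_eq_add_one, cnt_succ, hlast, ind_pos] at h1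
  swap
  · rw [chg_add_length, ext_add_length]; exact ⟨hcC, hcE⟩
  have hno : ∀ j < l, ¬ (Chg M O F b (c + 1 + j) ∧ Ext M O b (c + 1 + j)) := by
    intro j hj h
    have := cnt_pos (p := fun i => Chg M O F b (c + 1 + i) ∧ Ext M O b (c + 1 + i)) hj h
    omega
  have hext : cnt (fun j => Ext M O b (c + 1 + j)) b.length = extCount M O b :=
    cnt_add_of_periodic (p := Ext M O b) ext_add_length (c + 1)
  have hup := cnt_of_upward (q := fun j => Ext M O b (c + 1 + j)) (n := b.length) (by
    intro j hj hE
    exact (D.ext_succ hb (fun hC => hno j (by omega) ⟨hC, hE⟩)).1 hE)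
  rw [hext] at hup
  have ht : extCount M O b ≤ b.length := extCount_le
  have ht1 : 1 ≤ extCount M O b := by
    have := (hup l (by omega)).1 (by rw [hlast, ext_add_length]; exact hcE)
    omega
  refine ⟨c + 1 + (b.length - extCount M O b), ht1, ?_, ?_, ?_, ?_⟩
  · intro j hj
    have := (hup (b.length - extCount M O b + j) (by omega)).2 (by omega)
    rwa [← Nat.add_assoc] at this
  · intro j hj1 hj2 hE
    rw [show c + 1 + (b.length - extCount M O b) + j = c + 1 + (j - extCount M O b) + b.length
      by omega, ext_add_length] at hE
    have := (hup _ (by omega)).1 hE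
    omega
  · intro j hj hC
    refine hno (b.length - extCount M O b + j) (by omega) ⟨?_, ?_⟩
    · rwa [← Nat.add_assoc]
    · exact (hup _ (by omega)).2 (by omega)
  · rw [show c + 1 + (b.length - extCount M O b) + (extCount M O b - 1) = c + b.length by omega,
      chg_add_length]
    exact hcC

theorem Diagram.single_window (D : Diagram P M O F) (hb : b ∈ F) (he : extRuns M O F b = 1)
    (β : ℕ → ℤ) : 1 ≤ extCount M O b ∧ extCount M O b ≤ O.length ∧
    ∃ i, ∃ p < O.length, (∀ j < extCount M O b,
        M.inv (cyc b (i + j)) = cyc O (p + extCount M O b - 1 - j)) ∧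
      (∀ j, extCount M O b ≤ j → j < b.length → ¬ Ext M O b (i + j)) ∧
      ((O.map M.lab).rotate p).take (extCount M O b) =
        (wordInv ((b.map M.lab).rotate (i + extCount M O b))).take (extCount M O b) ∧
      corn M O F β b =
        ∑ j ∈ Finset.range (extCount M O b - 1), β ((p + 1 + j) % O.length) := by
  obtain ⟨i, h1, h2, h3, h4, h5⟩ := D.single_run hb he
  have ht : extCount M O b ≤ b.length := extCount_le
  set t := extCount M O b with htdef
  obtain ⟨p, hp, htn, hrun, hw⟩ := D.exists_window (i := i) hb h1 ht (h2 0 (by omega)) h4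
  refine ⟨h1, htn, i, p, hp, hrun, h3, hw, ?_⟩
  unfold corn
  rw [← sum_add_of_periodic (f := fun i => (ind (Ext M O b i ∧ ¬ Chg M O F b i) : ℤ) *
        β (O.idxOf (M.inv (cyc b i)))) (fun i => by
          simp only [ext_add_length, chg_add_length, cyc_add_length]) i,
    show b.length = (t - 1) + (1 + (b.length - t)) by omega, Finset.sum_range_add,
    Finset.sum_eq_zero (s := Finset.range (1 + (b.length - t))), add_zero,
    ← Finset.sum_range_reflect]
  · refine Finset.sum_congr rfl (fun j hj => ?_)
    have hj' := Finset.mem_range.1 hj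
    rw [ind_pos ⟨h2 _ (by omega), h4 _ (by omega)⟩, hrun _ (by omega),
      idxOf_cyc D.outer_nodup D.outer_ne,
      show p + t - 1 - (t - 1 - 1 - j) = p + 1 + j by omega]
    simp
  · intro j hj
    have hj' := Finset.mem_range.1 hj
    rw [ind_neg]
    · simp
    · rintro ⟨hE, hC⟩
      rcases Nat.eq_zero_or_pos j with rfl | hj0
      · exact hC h5
      · exact h3 (t - 1 + j) (by omega) (by omega) hE

theorem Diagram.lt_intRuns (D : Diagram P M O F) (hb : b ∈ F) (h : ∃ i, Chg M O F b i) {q : ℕ}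
    (hq : q * (b.length - 1) < 6 * (b.length - extCount M O b)) : q < intRuns M O F b :=
  Nat.lt_of_mul_lt_mul_right (hq.trans_le (D.six_mul_inner_le hb h))

end

/-! ### Counting faces with little boundary -/

section

variable {S : Type} {P : C6Presentation S} {M : MapData S P.Grp} {O : List ℕ}
  {F : Multiset (List ℕ)} {b : List ℕ}

/-- Between two consecutive corners in `K`, the boundary word `w` contains at most half of any
relator. -/
def HalfAt (P : C6Presentation S) (w : Word S) (K : ℕ → Prop) : Prop :=
  ∀ r ∈ P.rels, ∀ p k, 1 ≤ k → k ≤ r.length → p + k ≤ w.length →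
    r.take k = (w.drop p).take k → (∀ j, p < j → j < p + k → ¬ K j) → 2 * k ≤ r.length

theorem corn_nonneg {β : ℕ → ℤ} (hβ : ∀ j, 0 ≤ β j) : 0 ≤ corn M O F β b :=
  Finset.sum_nonneg fun _ _ => mul_nonneg (Nat.cast_nonneg _) (hβ _)

theorem Diagram.curv_le_corn (D : Diagram P M O F) (hb : b ∈ F) {K : ℕ → Prop} (hK : K 0)
    (hH : HalfAt P (O.map M.lab) K) :
    curv M O F b ≤ corn M O F (fun j => 6 * (ind (K j) : ℤ)) b ∧
      (3 * extCount M O b ≤ b.length →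
        curv M O F b + 1 ≤ corn M O F (fun j => 6 * (ind (K j) : ℤ)) b) := by
  have hL := List.length_pos_of_ne_nil (D.ne b hb)
  have hn := List.length_pos_of_ne_nil D.outer_ne
  have c1 := D.curv_le hb
  have c2 := D.curv_le' hb
  have hβ : ∀ j, 0 ≤ (fun j => 6 * (ind (K j) : ℤ)) j := fun j => by positivity
  have hc0 : 0 ≤ corn M O F (fun j => 6 * (ind (K j) : ℤ)) b := corn_nonneg hβ
  have htL : extCount M O b ≤ b.length := extCount_le
  by_cases hch : ∃ i, Chg M O F b i
  · have hbad : 3 * extCount M O b ≤ b.length → 4 < intRuns M O F b := fun h =>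
      D.lt_intRuns hb hch (by omega)
    rcases Nat.lt_or_ge 1 (extRuns M O F b) with he | he
    · exact ⟨by omega, fun h => by have := hbad h; omega⟩
    · interval_cases he' : extRuns M O F b
      · have h0 := D.extCount_eq_zero hb hch he'
        have : 6 < intRuns M O F b := D.lt_intRuns hb hch (by omega)
        omega
      · refine ⟨?_, fun h => by have := hbad h; omega⟩
        obtain ⟨h1, h2, i, p, hp, hrun, -, hw, hcorn⟩ :=
          D.single_window hb he' (fun j => 6 * (ind (K j) : ℤ))
        set t := extCount M O b with ht
        by_cases hex : ∃ j < t - 1, K ((p + 1 + j) % O.length)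
        · obtain ⟨j, hj, hKj⟩ := hex
          have h6 : (6 : ℤ) ≤ corn M O F (fun j => 6 * (ind (K j) : ℤ)) b := by
            rw [hcorn]
            have := Finset.single_le_sum
              (f := fun j => 6 * (ind (K ((p + 1 + j) % O.length)) : ℤ))
              (fun j _ => hβ _) (Finset.mem_range.2 hj)
            simpa [ind_pos hKj] using this
          omega
        · push Not at hex
          have hpt : p + t ≤ O.length := by
            by_contra hlt
            refine hex (O.length - p - 1) (by omega) ?_
            rwa [show p + 1 + (O.length - p - 1) = O.length by omega, Nat.mod_self]
          have h2t : 2 * t ≤ b.length := by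
            have hr := P.inv_mem _ (P.rotate_mem _ (D.rel b hb) (i + t))
            have := hH _ hr p t h1 (by simpa using htL) (by simpa using hpt) ?_ ?_
            · simpa using this
            · rw [← hw, List.rotate_eq_drop_append_take (by simp; omega),
                List.take_append_of_le_length (by simp; omega)]
            · intro j hj1 hj2 hKj
              refine hex (j - p - 1) (by omega) ?_
              rwa [show p + 1 + (j - p - 1) = j by omega, Nat.mod_eq_of_lt (by omega)]
          have : 3 < intRuns M O F b := D.lt_intRuns (q := 3) hb hch (by omega)
          omega
  · push Not at hch
    obtain ⟨hlen, hrel, hcorn⟩ := D.uncharged hb hch (fun j => 6 * (ind (K j) : ℤ))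
    have hcv : curv M O F b ≤ 12 := by omega
    have h12 : (12 : ℤ) ≤ corn M O F (fun j => 6 * (ind (K j) : ℤ)) b := by
      rw [hcorn, ← Finset.mul_sum, ← Nat.cast_sum]
      change 12 ≤ 6 * (cnt K O.length : ℤ)
      obtain ⟨l, hl⟩ := Nat.exists_eq_succ_of_ne_zero hn.ne'
      have e : cnt K O.length = ind (K 0) + cnt (fun i => K (1 + i)) l := by
        rw [hl, Nat.succ_eq_add_one, Nat.add_comm l 1, cnt_add]
        simp [cnt]
      rw [ind_pos hK] at e
      have : 0 < cnt (fun i => K (1 + i)) l := by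
        by_contra h0
        have := hH _ hrel 0 O.length hn (by simp) (by simp) (by simp) (fun j hj1 hj2 hKj => ?_)
        · simp at this; omega
        · have := cnt_pos (p := fun i => K (1 + i)) (n := l) (i := j - 1) (by omega)
            (by rwa [show 1 + (j - 1) = j by omega])
          omega
      omega
    have : extCount M O b = b.length := cnt_eq_self (fun i _ => D.ext_of_not_chg hb hch i)
    exact ⟨by omega, fun h => by omega⟩

theorem Diagram.spur_cancel (D : Diagram P M O F) {d : ℕ} (hd : d ∈ O)
    (h : nxt (O ::ₘ F) (M.inv d) = d) (h0 : O.idxOf d ≠ 0) :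
    ∃ j, O.idxOf d = j + 1 ∧ ∃ h : j + 1 < (O.map M.lab).length,
      (O.map M.lab)[j + 1] = flipLetter (O.map M.lab)[j] := by
  obtain ⟨j, hj⟩ := Nat.exists_eq_succ_of_ne_zero h0
  have hlt := List.idxOf_lt_length_iff.2 hd
  refine ⟨j, hj, by rw [List.length_map]; omega, ?_⟩
  have h1 : cyc O (j + 1) = d := by rw [← Nat.succ_eq_add_one, ← hj, cyc_idxOf hd]
  have h2 : M.inv d = cyc O j := by
    apply (nxt (O ::ₘ F)).injective
    rw [h, D.nxt_outer, h1]
  simp only [List.getElem_map]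
  rw [← cyc_eq_getElem (b := O) (i := j + 1) (by omega),
    ← cyc_eq_getElem (b := O) (i := j) (by omega), h1, ← h2,
    D.isMap.lab_inv _ (Diagram.outer_mem_darts hd), flipLetter_flipLetter]

/-- At most `6 |K| - 12` faces have at most a third of their boundary on the outer cycle. -/
theorem Diagram.card_bad_le (D : Diagram P M O F) {K : ℕ → Prop} (hK : K 0)
    (hH : HalfAt P (O.map M.lab) K)
    (hred : ∀ j (h : j + 1 < (O.map M.lab).length),
      (O.map M.lab)[j + 1] = flipLetter (O.map M.lab)[j] → K (j + 1)) :
    12 + (F.map fun b => ind (3 * extCount M O b ≤ b.length)).sum ≤ 6 * cnt K O.length := by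
  have h1 := D.curvature (β := fun j => 6 * (ind (K j) : ℤ)) (fun j => by positivity) (by
    intro d hd hsp
    have : K (O.idxOf d) := by
      by_cases h0 : O.idxOf d = 0
      · rwa [h0]
      · obtain ⟨j, hj, hlt, he⟩ := D.spur_cancel hd hsp h0
        rw [hj]; exact hred j hlt he
    simp [ind_pos this])
  have h2 : (F.map fun b => curv M O F b - corn M O F (fun j => 6 * (ind (K j) : ℤ)) b).sum ≤
      (F.map fun b => -(ind (3 * extCount M O b ≤ b.length) : ℤ)).sum := by
    refine Multiset.sum_map_le_sum_map _ _ (fun b hb => ?_)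
    obtain ⟨g1, g2⟩ := D.curv_le_corn hb hK hH
    by_cases hbad : 3 * extCount M O b ≤ b.length
    · rw [ind_pos hbad]; have := g2 hbad; push_cast; omega
    · rw [ind_neg hbad]; push_cast; omega
  have h3 : (F.map fun b => -(ind (3 * extCount M O b ≤ b.length) : ℤ)).sum =
      -(((F.map fun b => ind (3 * extCount M O b ≤ b.length)).sum : ℕ) : ℤ) := by
    rw [Multiset.sum_map_neg, Nat.cast_multiset_sum, Multiset.map_map]; rfl
  have h4 : ∑ j ∈ Finset.range O.length, 6 * (ind (K j) : ℤ) = 6 * (cnt K O.length : ℤ) := by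
    rw [← Finset.mul_sum, cnt, Nat.cast_sum]
  rw [h4] at h1
  rw [h3] at h2
  omega

end

/-! ### Dehn's algorithm -/

section

variable {S : Type} {P : C6Presentation S}

theorem exists_cancel {w : Word S} (h : ¬ Reduced w) :
    ∃ u l v, w = u ++ l :: flipLetter l :: v := by
  rw [reduced_iff] at h
  push Not at h
  obtain ⟨i, hi, h⟩ := h
  refine ⟨w.take i, w[i], w.drop (i + 2), ?_⟩
  rw [← h, ← List.drop_eq_getElem_cons, ← List.drop_eq_getElem_cons, List.take_append_drop]

theorem normalClosure_nonempty_rels (P : C6Presentation S) :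
    Subgroup.normalClosure (wordVal '' P.rels) ≤
      Subgroup.normalClosure (wordVal '' {r ∈ P.rels | r ≠ []}) := by
  refine Subgroup.normalClosure_le_normal ?_
  rintro _ ⟨r, hr, rfl⟩
  by_cases h : r = []
  · subst h; exact Subgroup.one_mem _
  · exact Subgroup.subset_normalClosure ⟨r, ⟨hr, h⟩, rfl⟩

theorem wordInv_eq_nil {w : Word S} : wordInv w = [] ↔ w = [] := by
  rw [← List.length_eq_zero_iff, length_wordInv, List.length_eq_zero_iff]

/-- Dehn's algorithm: a nonempty reduced word representing the identity contains more than half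
of a relator. -/
theorem exists_long_relator_subword {w : Word S} (hw : w ≠ []) (hr : Reduced w)
    (h1 : P.elt w = 1) :
    ∃ r ∈ P.rels, ∃ p k, 1 ≤ k ∧ k ≤ r.length ∧ p + k ≤ w.length ∧
      r.take k = (w.drop p).take k ∧ r.length < 2 * k := by
  classical
  by_contra hcon
  push Not at hcon
  obtain ⟨l, hl⟩ := List.exists_mem_of_ne_nil w hw
  have : Nonempty S := ⟨l.1⟩
  have h2 := normalClosure_nonempty_rels P ((P.elt_eq_one_iff w).1 h1)
  obtain ⟨W, hW, hW'⟩ := exists_realizable (P := P) (R₀ := {r ∈ P.rels | r ≠ []})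
    (fun r hr => hr.1) (fun r hr => ⟨P.inv_mem r hr.1, by simpa [wordInv_eq_nil] using hr.2⟩) h2
  obtain ⟨M, O, F, D, hO, -, -⟩ := exists_diagram (P := P) (R₀ := {r ∈ P.rels | r ≠ []})
    (fun r hr => hr.1) (fun h => h.2 rfl) (T := {w}) (fun h => hw h.symm) ⟨w, rfl, W, hW, hW'⟩
  have hO' : O.map M.lab = w := hO
  have h3 := D.card_bad_le (K := fun j => j = 0) rfl (by
      intro r hr p k hk1 hk2 hk3 hk4 _
      rw [hO'] at hk3 hk4
      exact hcon r hr p k hk1 hk2 hk3 hk4)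
    (by
      intro j h h4
      subst hO'
      exact absurd h4 (reduced_iff.1 hr j h))
  have h4 : ∀ n, cnt (fun j => j = 0) n ≤ 1 := by
    intro n
    induction n with
    | zero => simp
    | succ n ih =>
      rw [cnt_succ]
      rcases Nat.eq_zero_or_pos n with h | h
      · subst h; simp only [cnt_zero, zero_add]; exact ind_le _
      · rw [ind_neg (by omega)]; omega
  have := h4 O.length
  omega

theorem rels_reduced {r : Word S} (hr : r ∈ P.rels) : Reduced r :=
  Reduced.infix (P.cyclically_reduced r hr) (List.prefix_append r r).isInfix

/-- Proper subwords of relators are nontrivial. -/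
theorem elt_ne_one_of_prefix {r : Word S} (hr : r ∈ P.rels) {u v : Word S} (h : r = u ++ v)
    (hu : u ≠ []) (hv : v ≠ []) : P.elt u ≠ 1 := by
  have key : ∀ u v : Word S, u ++ v ∈ P.rels → u ≠ [] → P.elt u = 1 →
      (u ++ v).length < 2 * u.length := by
    intro u v hr hu h1
    have hred : Reduced u := (rels_reduced hr).infix (List.prefix_append u v).isInfix
    obtain ⟨r', hr', p, k, hk1, hk2, hk3, hk4, hk5⟩ := exists_long_relator_subword hu hred h1
    have hp : (u ++ v).rotate p = u.drop p ++ v ++ u.take p := by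
      rw [List.rotate_eq_drop_append_take (by simp; omega), List.drop_append_of_le_length (by omega),
        List.take_append_of_le_length (by omega)]
    have hpre : r'.take k <+: (u ++ v).rotate p := by
      rw [hp, hk4, List.append_assoc]
      exact (List.take_prefix _ _).trans (List.prefix_append _ _)
    have hpre' : r'.take k <+: r' := List.take_prefix _ _
    have heq : r' = (u ++ v).rotate p := by
      by_contra hne
      have := P.small_cancellation r' hr' _ hpre'
        ⟨r', hr', _, P.rotate_mem _ hr p, hne, hpre', hpre⟩
      rw [List.length_take, min_eq_left hk2] at this
      omega
    have : r'.length = (u ++ v).length := by rw [heq, List.length_rotate]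
    omega
  subst h
  intro h1
  have h2 : P.elt v = 1 := by
    have := P.elt_rel hr
    rwa [P.elt_append, h1, one_mul] at this
  have h3 := key u v hr hu h1
  have h4 : v ++ u ∈ P.rels := by
    have := P.rotate_mem _ hr u.length
    rwa [List.rotate_append_length_eq] at this
  have h5 := key v u h4 hv h2
  simp only [List.length_append] at h3 h5
  omega

theorem wordVal_mem_normalClosure_short {w : Word S} (h : P.elt w = 1) :
    wordVal w ∈ Subgroup.normalClosure
      (wordVal '' {r ∈ P.rels | r ≠ [] ∧ r.length ≤ 2 * w.length}) := by
  induction hn : w.length using Nat.strong_induction_on generalizing w with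
  | _ n ih =>
  subst hn
  by_cases hw : w = []
  · subst hw; exact Subgroup.one_mem _
  have mono : ∀ m, m < w.length →
      Subgroup.normalClosure (wordVal '' {r ∈ P.rels | r ≠ [] ∧ r.length ≤ 2 * m}) ≤
      Subgroup.normalClosure (wordVal '' {r ∈ P.rels | r ≠ [] ∧ r.length ≤ 2 * w.length}) := by
    intro m hm
    refine Subgroup.normalClosure_mono (Set.image_mono ?_)
    rintro r ⟨h1, h2, h3⟩
    exact ⟨h1, h2, by omega⟩
  by_cases hr : Reduced w
  · obtain ⟨r, hr, p, k, hk1, hk2, hk3, hk4, hk5⟩ := exists_long_relator_subword hw hr h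
    set a := w.take p with ha
    set b := w.drop (p + k) with hb
    have hsplit : w = a ++ r.take k ++ b := by
      rw [hk4, ha, hb, ← List.drop_drop, List.append_assoc, List.take_append_drop,
        List.take_append_drop]
    have hrs : wordVal (r.take k) = wordVal r * (wordVal (r.drop k))⁻¹ := by
      conv_rhs => rw [← List.take_append_drop k r]
      rw [wordVal_append]; simp
    have hre : P.elt (r.take k) = (P.elt (r.drop k))⁻¹ := by
      have := P.elt_rel hr
      rw [← List.take_append_drop k r, P.elt_append] at this
      exact eq_inv_of_mul_eq_one_left this
    set w' := a ++ wordInv (r.drop k) ++ b with hw'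
    have hl : w'.length < w.length := by
      have h3 := congrArg List.length hsplit
      simp only [List.length_append, List.length_take] at h3
      rw [hw']
      simp only [List.length_append, length_wordInv, List.length_drop]
      omega
    have he : P.elt w' = 1 := by
      rw [← h, hsplit, hw']; simp [hre]
    have h4 := mono _ hl (ih _ hl he rfl)
    have h5 : wordVal w = (wordVal a * wordVal r * (wordVal a)⁻¹) * wordVal w' := by
      rw [hw']
      conv_lhs => rw [hsplit]
      simp only [wordVal_append, wordVal_wordInv, hrs]
      group
    rw [h5]
    refine Subgroup.mul_mem _ (Subgroup.normalClosure_normal.conj_mem _ ?_ _) h4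
    exact Subgroup.subset_normalClosure ⟨r, ⟨hr, by rintro rfl; simp at hk2; omega, by omega⟩, rfl⟩
  · obtain ⟨u, l, v, huv⟩ := exists_cancel hr
    have hl : (u ++ v).length < w.length := by rw [huv]; simp
    have he : P.elt (u ++ v) = 1 := by
      rw [← h, huv]; simp [C6Presentation.eltL_flip]
    have h4 := mono _ hl (ih _ hl he rfl)
    have h5 : wordVal w = wordVal (u ++ v) := by
      have : wordVal [l, flipLetter l] = 1 := by
        have := wordVal_wordInv [l]
        have h6 : wordInv [l] = [flipLetter l] := rfl
        rw [h6] at this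
        have h7 := wordVal_append [l] [flipLetter l]
        rw [this, mul_inv_cancel] at h7
        exact h7
      have h8 : u ++ l :: flipLetter l :: v = u ++ [l, flipLetter l] ++ v := by simp
      rw [huv, h8, wordVal_append, wordVal_append, this, mul_one, wordVal_append]
    rwa [h5]

theorem exists_filling {w : Word S} (hw : w ≠ []) (h : P.elt w = 1) :
    ∃ (M : MapData S P.Grp) (O : List ℕ) (F : Multiset (List ℕ)), Diagram P M O F ∧
      O.map M.lab = w ∧ ∀ b ∈ F, b.length ≤ 2 * w.length := by
  obtain ⟨l, hl⟩ := List.exists_mem_of_ne_nil w hw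
  have : Nonempty S := ⟨l.1⟩
  have h2 := wordVal_mem_normalClosure_short h
  obtain ⟨W, hW, hW'⟩ := exists_realizable (P := P)
    (R₀ := {r ∈ P.rels | r ≠ [] ∧ r.length ≤ 2 * w.length}) (fun r hr => hr.1)
    (fun r hr => ⟨P.inv_mem r hr.1, by simpa [wordInv_eq_nil] using hr.2⟩) h2
  obtain ⟨M, O, F, D, hO, hF, -⟩ := exists_diagram (P := P)
    (R₀ := {r ∈ P.rels | r ≠ [] ∧ r.length ≤ 2 * w.length}) (fun r hr => hr.1)
    (fun h => h.2.1 rfl) (T := {w}) (fun h => hw h.symm) ⟨w, rfl, W, hW, hW'⟩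
  exact ⟨M, O, F, D, hO, fun b hb => by simpa using (hF b hb).2.2⟩

end

/-! ### Windows of faces on the boundary -/

section

variable {S : Type} {P : C6Presentation S} {M : MapData S P.Grp} {O : List ℕ}
  {F : Multiset (List ℕ)} {b : List ℕ}

/-- The darts `i, …, i + k - 1` of the face `b` are glued, in reverse order, to the darts
`p, …, p + k - 1` of the outer cycle. -/
def IsWindow (M : MapData S P.Grp) (O b : List ℕ) (i p k : ℕ) : Prop :=
  ∀ j < k, M.inv (cyc b (i + j)) = cyc O (p + k - 1 - j)

theorem IsWindow.sub {i p k x m : ℕ} (h : IsWindow M O b i p k) (hx : p ≤ x)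
    (hm : x + m ≤ p + k) : IsWindow M O b (i + (p + k - x - m)) x m := by
  intro j hj
  rw [Nat.add_assoc, h _ (by omega)]
  congr 1
  omega

theorem IsWindow.of_add_length {i p k : ℕ} (h : IsWindow M O b i (p + O.length) k) :
    IsWindow M O b i p k := by
  intro j hj
  rw [h j hj, show p + O.length + k - 1 - j = (p + k - 1 - j) + O.length by omega, cyc_add_length]

theorem Diagram.window_word (D : Diagram P M O F) (hb : b ∈ F) {i p k : ℕ}
    (h : IsWindow M O b i p k) (hk : k ≤ b.length) (hp : p + k ≤ O.length + O.length) :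
    (wordInv ((b.map M.lab).rotate (i + k))).take k =
      ((O.map M.lab ++ O.map M.lab).drop p).take k := by
  apply List.ext_getElem
  · simp; omega
  · intro j h1 h2
    have hj : j < k := by simp at h1; omega
    rw [List.getElem_take, List.getElem_take, List.getElem_drop, getElem_wordInv,
      getElem_rotate_map]
    have e : cyc b (i + k + (((b.map M.lab).rotate (i + k)).length - 1 - j)) =
        cyc b (i + (k - 1 - j)) := by
      rw [← cyc_add_length b (i + (k - 1 - j))]
      congr 1
      simp; omega
    rw [e, ← D.isMap.lab_inv _ (D.mem_darts hb _), h _ (by omega)]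
    simp only [← List.map_append, List.getElem_map, append_self_eq_map_cyc, List.getElem_range]
    congr 2
    omega

theorem Diagram.absorb (D : Diagram P M O F) (hb : b ∈ F) {i x : ℕ}
    (h : M.inv (cyc b i) = cyc O x) {l l' : S × Bool} {u v : Word S}
    (hv : (O.map M.lab).rotate x = l :: v)
    (hu : wordInv ((b.map M.lab).rotate (i + 1)) = l' :: u) :
    ∃ W : Multiset (Word S), (∀ r ∈ W, r ∈ P.rels ∧ r ≠ []) ∧
      Multiset.card W < Multiset.card F ∧ Realizable P ((v ++ wordInv u) ::ₘ W) := by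
  obtain ⟨u', hu', hu''⟩ := rotate_eq_cyc_cons (D.ne b hb) i
  obtain ⟨v', hv', -⟩ := rotate_eq_cyc_cons D.outer_ne x
  obtain ⟨F', rfl⟩ := Multiset.exists_cons_of_mem hb
  have h0 := D.isMap
  rw [Multiset.cons_swap] at h0
  have h1 := h0.rotate_nat i
  rw [Multiset.cons_swap] at h1
  have h2 := h1.rotate_nat x
  rw [Multiset.cons_swap, hu', hv', ← h] at h2
  have h3 := h2.merge
  rw [← List.map_rotate, hv', List.map_cons, List.cons.injEq] at hv
  rw [← List.map_rotate, hu''] at hu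
  simp only [List.map_cons, List.map_append, List.map_nil, wordInv_append, wordInv_cons,
    wordInv_nil, List.nil_append, List.singleton_append, List.cons.injEq] at hu
  refine ⟨F'.map (List.map M.lab), ?_, by simp, ?_⟩
  · intro r hr
    obtain ⟨b', hb', rfl⟩ := Multiset.mem_map.1 hr
    have := Multiset.mem_cons_of_mem (b := b) hb'
    exact ⟨D.rel _ this, by simpa using D.ne _ this⟩
  · rw [← hu.2, ← hv.2, wordInv_wordInv, ← List.map_append]
    exact realizable_cons.2 ⟨M, _, F', h3, rfl, rfl⟩

/-- If replacing the arc `c` of a relator `c ++ d` by the other arc does not reduce the number of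
faces, then the faces meet `c` in pieces. -/
theorem Diagram.six_mul_lt_of_arc (D : Diagram P M O F) {c d t : Word S} (hcd : c ++ d ∈ P.rels)
    (hO : O.map M.lab = c ++ t)
    (hmin : ∀ W : Multiset (Word S), (∀ r ∈ W, r ∈ P.rels ∧ r ≠ []) →
      Realizable P ((wordInv d ++ t) ::ₘ W) → Multiset.card F ≤ Multiset.card W)
    (hb : b ∈ F) {i x k : ℕ} (h : IsWindow M O b i x k) (hk : k ≤ b.length)
    (hx : x + k ≤ c.length) : 6 * k < b.length := by
  have hL := List.length_pos_of_ne_nil (D.ne b hb)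
  rcases Nat.eq_zero_or_pos k with rfl | hk0
  · simpa using hL
  have hn : O.length = c.length + t.length := by
    have := congrArg List.length hO
    simpa using this
  have hword := D.window_word hb h hk (by omega)
  have hr := P.inv_mem _ (P.rotate_mem _ (D.rel b hb) (i + k))
  set r := wordInv ((b.map M.lab).rotate (i + k)) with hrdef
  have hrl : r.length = b.length := by simp [hrdef]
  have hrot : ∀ z : Word S, (c ++ z).rotate x = c.drop x ++ z ++ c.take x := by
    intro z
    rw [List.rotate_eq_drop_append_take (by simp; omega), List.drop_append_of_le_length (by omega),
      List.take_append_of_le_length (by omega)]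
  by_cases hne : r = (c ++ d).rotate x
  · exfalso
    obtain ⟨l, c2, hc2⟩ : ∃ l c2, c.drop x = l :: c2 :=
      List.exists_cons_of_length_pos (by rw [List.length_drop]; omega)
    have h1 : M.inv (cyc b (i + (k - 1))) = cyc O x := by
      rw [h _ (by omega)]; congr 1; omega
    obtain ⟨W, hW, hcard, hreal⟩ := D.absorb hb h1 (l := l) (v := c2 ++ t ++ c.take x)
      (l' := l) (u := c2 ++ d ++ c.take x)
      (by rw [hO, hrot, hc2]; simp)
      (by rw [show i + (k - 1) + 1 = i + k by omega, ← hrdef, hne, hrot, hc2]; simp)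
    have := hmin W hW ?_
    · omega
    · have h2 : Realizable P ((c2 ++ (t ++ c.take x ++ wordInv (c2 ++ d ++ c.take x))) ::ₘ W) := by
        simpa using hreal
      have h3 := h2.rotate
      refine Realizable.rotate (Realizable.of_wordVal ?_ h3)
      simp only [wordVal_append, wordVal_wordInv]
      group
  · have hpre : r.take k <+: (c ++ d).rotate x := by
      rw [hword, hO, hrot, List.append_assoc c, List.drop_append_of_le_length (by omega),
        List.take_append_of_le_length (by rw [List.length_drop]; omega), List.append_assoc]
      exact (List.take_prefix _ _).trans (List.prefix_append _ _)
    have := P.small_cancellation r hr _ (List.take_prefix k r)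
      ⟨r, hr, _, P.rotate_mem _ hcd x, hne, List.take_prefix k r, hpre⟩
    rw [List.length_take, hrl, min_eq_left hk] at this
    exact this

theorem two_mul_le_of_geoWord {r : Word S} (hr : r ∈ P.rels) {u v x : Word S}
    (hg : GeoWord P (u ++ v ++ x)) {k : ℕ} (hk : k ≤ r.length) (h : r.take k = v) :
    2 * k ≤ r.length := by
  have h1 := hg.infix
  have h2 := P.elt_rel hr
  rw [← List.take_append_drop k r, P.elt_append, h] at h2
  have h3 := P.len_elt_le (r.drop k)
  rw [← inv_eq_of_mul_eq_one_right h2, P.len_inv, h1, ← h, List.length_take, List.length_drop] at h3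
  omega

theorem len_ge_of_geoWord_append {u v : Word S} (hu : GeoWord P u) :
    u.length ≤ P.len (P.elt (u ++ v)) + v.length := by
  have h1 := P.len_mul_le (P.elt u * P.elt v) (P.elt v)⁻¹
  have h2 := P.len_elt_le v
  rw [mul_inv_cancel_right, P.len_inv, hu] at h1
  rw [P.elt_append]; omega

/-- A relator cannot follow a path to its closest-point projection and onwards along a geodesic
for more than three quarters of its length. -/
theorem four_mul_le_of_near {r : Word S} (hr : r ∈ P.rels) {k : ℕ} (hk : k ≤ r.length)
    {m n : ℕ} (hmn : m + n = k)
    (h1 : m ≤ P.len (P.elt (r.take k))) (h2 : n ≤ P.len (P.elt (r.take k)) + m) :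
    4 * k ≤ 3 * r.length := by
  have h3 := P.elt_rel hr
  rw [← List.take_append_drop k r, P.elt_append] at h3
  have h4 := P.len_elt_le (r.drop k)
  rw [← inv_eq_of_mul_eq_one_right h3, P.len_inv, List.length_drop] at h4
  omega

end

/-! ### Geodesic quadrilaterals -/

section

variable {S : Type} {P : C6Presentation S} {M : MapData S P.Grp} {O : List ℕ}
  {F : Multiset (List ℕ)} {b : List ℕ}

/-- A geodesic quadrilateral: an arc `c` of a relator `c ++ d`, a geodesic `a`, and geodesics `s`,
`s'` realising the distance from the end points of `c` to `a`. -/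
structure Quad (P : C6Presentation S) (c d s a s' : Word S) : Prop where
  rel : c ++ d ∈ P.rels
  geo_s : GeoWord P s
  geo_a : GeoWord P a
  geo_s' : GeoWord P s'
  loop : P.elt (c ++ (s ++ (a ++ s'))) = 1
  near : ∀ j, s.length ≤ P.len (P.elt (s ++ a.take j))
  near' : ∀ j, s'.length ≤ P.len (P.elt (a.drop j ++ s'))

theorem GeoWord.take {u : Word S} (h : GeoWord P u) (k : ℕ) : GeoWord P (u.take k) := by
  apply GeoWord.infix (u := []) (x := u.drop k)
  simpa using h

theorem GeoWord.drop {u : Word S} (h : GeoWord P u) (k : ℕ) : GeoWord P (u.drop k) := by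
  apply GeoWord.infix (u := u.take k) (x := [])
  simpa using h

theorem Diagram.window_rel (D : Diagram P M O F) (hb : b ∈ F) {i x k : ℕ}
    (h : IsWindow M O b i x k) (hk : k ≤ b.length) {u v y : Word S}
    (hO : O.map M.lab = u ++ (v ++ y)) (hx : u.length ≤ x) (hxk : x + k ≤ u.length + v.length) :
    ∃ r ∈ P.rels, r.length = b.length ∧ r.take k = (v.drop (x - u.length)).take k := by
  have hn : O.length = u.length + (v.length + y.length) := by
    have := congrArg List.length hO
    simpa using this
  refine ⟨_, P.inv_mem _ (P.rotate_mem _ (D.rel b hb) (i + k)), by simp, ?_⟩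
  rw [D.window_word hb h hk (by omega), hO, List.append_assoc, List.drop_append, List.drop_eq_nil_of_le hx,
    List.nil_append, List.append_assoc, List.drop_append_of_le_length (by omega),
    List.take_append_of_le_length (by rw [List.length_drop]; omega)]

theorem Diagram.two_mul_window (D : Diagram P M O F) (hb : b ∈ F) {i x k : ℕ}
    (h : IsWindow M O b i x k) (hk : k ≤ b.length) {u v y : Word S}
    (hO : O.map M.lab = u ++ (v ++ y)) (hx : u.length ≤ x) (hxk : x + k ≤ u.length + v.length)
    (hv : GeoWord P v) : 2 * k ≤ b.length := by
  obtain ⟨r, hr, hrl, he⟩ := D.window_rel hb h hk hO hx hxk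
  rw [← hrl]
  refine two_mul_le_of_geoWord (u := []) (x := []) hr ?_ (hrl ▸ hk) he
  simpa using (hv.drop _).take _

theorem Diagram.four_mul_window (D : Diagram P M O F) (hb : b ∈ F) {i x k : ℕ}
    (h : IsWindow M O b i x k) (hk : k ≤ b.length) {u s a y : Word S}
    (hO : O.map M.lab = u ++ (s ++ (a ++ y))) (hx : u.length ≤ x)
    (hxs : x ≤ u.length + s.length) (hsx : u.length + s.length ≤ x + k)
    (hxk : x + k ≤ u.length + s.length + a.length)
    (ha : GeoWord P a) (hnear : ∀ j, s.length ≤ P.len (P.elt (s ++ a.take j))) :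
    4 * k ≤ 3 * b.length := by
  obtain ⟨r, hr, hrl, he⟩ := D.window_rel (v := s ++ a) (y := y) hb h hk (by simpa using hO) hx
    (by rw [List.length_append]; omega)
  rw [← hrl]
  have he' : r.take k = s.drop (x - u.length) ++ a.take (x + k - u.length - s.length) := by
    rw [he, List.drop_append_of_le_length (by omega), List.take_append,
      List.take_of_length_le (by rw [List.length_drop]; omega), List.length_drop]
    congr 2; omega
  set j := x - u.length
  set l := x + k - u.length - s.length
  refine four_mul_le_of_near hr (hrl ▸ hk) (m := s.length - j) (n := l) (by omega) ?_ ?_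
  · have h1 := hnear l
    rw [← List.take_append_drop j s, List.append_assoc, P.elt_append, ← he'] at h1
    have h2 := P.len_mul_le (P.elt (s.take j)) (P.elt (r.take k))
    have h3 := P.len_elt_le (s.take j)
    simp only [List.length_append, List.length_take, List.length_drop] at h1 h3
    omega
  · have h1 := ha.take l
    have h2 := P.len_mul_le (P.elt (s.drop j))⁻¹ (P.elt (r.take k))
    have h3 := P.len_elt_le (s.drop j)
    rw [he', P.elt_append, inv_mul_cancel_left, P.len_inv, h1, ← P.elt_append, ← he'] at h2
    rw [List.length_take] at h2
    rw [List.length_drop] at h3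
    omega

theorem Diagram.four_mul_window' (D : Diagram P M O F) (hb : b ∈ F) {i x k : ℕ}
    (h : IsWindow M O b i x k) (hk : k ≤ b.length) {u a s y : Word S}
    (hO : O.map M.lab = u ++ (a ++ (s ++ y))) (hx : u.length ≤ x)
    (hxs : x ≤ u.length + a.length) (hsx : u.length + a.length ≤ x + k)
    (hxk : x + k ≤ u.length + a.length + s.length)
    (ha : GeoWord P a) (hnear : ∀ j, s.length ≤ P.len (P.elt (a.drop j ++ s))) :
    4 * k ≤ 3 * b.length := by
  obtain ⟨r, hr, hrl, he⟩ := D.window_rel (v := a ++ s) (y := y) hb h hk (by simpa using hO) hx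
    (by rw [List.length_append]; omega)
  rw [← hrl]
  have he' : r.take k = a.drop (x - u.length) ++ s.take (x + k - u.length - a.length) := by
    rw [he, List.drop_append_of_le_length (by omega), List.take_append,
      List.take_of_length_le (by rw [List.length_drop]; omega), List.length_drop]
    congr 2; omega
  set j := x - u.length
  set l := x + k - u.length - a.length
  refine four_mul_le_of_near hr (hrl ▸ hk) (m := l) (n := a.length - j) (by omega) ?_ ?_
  · have h1 := hnear j
    rw [← List.take_append_drop l s, ← List.append_assoc, P.elt_append, ← he'] at h1
    have h2 := P.len_mul_le (P.elt (r.take k)) (P.elt (s.drop l))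
    have h3 := P.len_elt_le (s.drop l)
    simp only [List.length_append, List.length_take, List.length_drop] at h1 h3
    omega
  · have h1 := len_ge_of_geoWord_append (v := s.take l) (ha.drop j)
    rw [← he', List.length_take, List.length_drop] at h1
    omega

/-- Arithmetic of a single outer run `[p, p + t)` of a face of length `L` with `I` inner runs. -/
theorem quad_arith {C s A s' n p t L I cy cz cz' cy' : ℕ} (hn : n = C + (s + (A + s')))
    (hA : A ≤ C + (s + s')) (hC : 13 * (s + s') < C) (hp : p < n) (ht : 1 ≤ t) (htn : t ≤ n)
    (htL : t ≤ L)
    (hy : p < n → n < p + t → 1 ≤ cy) (hz : p < C → C < p + t → 1 ≤ cz)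
    (hz2 : p < n + C → n + C < p + t → 1 ≤ cz)
    (hz' : p < C + s → C + s < p + t → 1 ≤ cz')
    (hz2' : p < n + (C + s) → n + (C + s) < p + t → 1 ≤ cz')
    (hy' : p < C + s + A → C + s + A < p + t → 1 ≤ cy')
    (hI : ∀ q, q * (L - 1) < 6 * (L - t) → q < I)
    (hc : ∀ x m, p ≤ x → x + m ≤ p + t → x + m ≤ C → 6 * m < L)
    (hc2 : ∀ x m, p ≤ x → x + m ≤ p + t → n ≤ x → x + m ≤ n + C → 6 * m < L)
    (hs : ∀ x m, p ≤ x → x + m ≤ p + t → C ≤ x → x + m ≤ C + s → 2 * m ≤ L)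
    (ha : ∀ x m, p ≤ x → x + m ≤ p + t → C + s ≤ x → x + m ≤ C + s + A → 2 * m ≤ L)
    (hs' : ∀ x m, p ≤ x → x + m ≤ p + t → C + s + A ≤ x → x + m ≤ n → 2 * m ≤ L)
    (hsa : ∀ x m, p ≤ x → x + m ≤ p + t → C ≤ x → x ≤ C + s → C + s ≤ x + m →
      x + m ≤ C + s + A → 4 * m ≤ 3 * L)
    (has : ∀ x m, p ≤ x → x + m ≤ p + t → C + s ≤ x → x ≤ C + s + A → C + s + A ≤ x + m →
      x + m ≤ n → 4 * m ≤ 3 * L) :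
    (6 ≤ 2 * cy + 2 * cz + 4 * cz' + 4 * cy' ∨
      8 ≤ 2 * I + (2 * cy + 2 * cz + 4 * cz' + 4 * cy')) ∧
    ∀ j < C, (p ≤ j ∧ j < p + t ∨ p ≤ n + j ∧ n + j < p + t) →
      (7 ≤ 2 * cy + 2 * cz + 4 * cz' + 4 * cy' ∨
        9 ≤ 2 * I + (2 * cy + 2 * cz + 4 * cz' + 4 * cy') ∨
        (L < 6 * (s + s') ∧ (j < 6 * (s + s') ∨ C ≤ j + 6 * (s + s')))) := by
  have q1 := hI 1
  have q2 := hI 2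
  have q3 := hI 3
  have q4 := hI 4
  rcases Nat.lt_or_ge n (p + t) with hw | hw
  · have y1 := hy hp hw
    rcases Nat.lt_or_ge p (C + s) with h1 | h1
    · have := hz' h1 (by omega)
      have : 1 ≤ cy' := hy' (by omega) (by omega)
      exact ⟨by omega, fun j _ _ => by omega⟩
    · rcases Nat.lt_or_ge (n + C) (p + t) with h2 | h2
      · have := hz2 (by omega) h2
        rcases Nat.lt_or_ge (n + (C + s)) (p + t) with h3 | h3
        · have := hz2' (by omega) h3
          exact ⟨by omega, fun j _ _ => by omega⟩
        · rcases Nat.lt_or_ge p (C + s + A) with h4 | h4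
          · have := hy' h4 (by omega)
            exact ⟨by omega, fun j _ _ => by omega⟩
          · have := hc2 n C (by omega) (by omega) le_rfl le_rfl
            exact ⟨by omega, fun j _ _ => by omega⟩
      · have e1 := hc2 n (p + t - n) (by omega) (by omega) le_rfl (by omega)
        rcases Nat.lt_or_ge p (C + s + A) with h4 | h4
        · have := hy' h4 (by omega)
          have e2 := has p (n - p) le_rfl (by omega) (by omega) (by omega) (by omega) (by omega)
          have e3 := ha p (C + s + A - p) le_rfl (by omega) (by omega) (by omega)
          exact ⟨by omega, fun j _ _ => by omega⟩
        · have e2 := hs' p (n - p) le_rfl (by omega) (by omega) (by omega)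
          exact ⟨by omega, fun j _ _ => by omega⟩
  · rcases Nat.lt_or_ge p C with h1 | h1
    · rcases Nat.lt_or_ge C (p + t) with h2 | h2
      · have y1 := hz h1 h2
        have e1 := hc p (C - p) le_rfl (by omega) (by omega)
        rcases Nat.lt_or_ge (C + s) (p + t) with h3 | h3
        · have := hz' (by omega) h3
          rcases Nat.lt_or_ge (C + s + A) (p + t) with h4 | h4
          · have := hy' (by omega) h4
            exact ⟨by omega, fun j _ _ => by omega⟩
          · have e2 := hsa C (p + t - C) (by omega) (by omega) le_rfl (by omega) (by omega)
              (by omega)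
            have e3 := ha (C + s) (p + t - (C + s)) (by omega) (by omega) le_rfl (by omega)
            exact ⟨by omega, fun j _ _ => by omega⟩
        · have e2 := hs C (p + t - C) (by omega) (by omega) le_rfl (by omega)
          exact ⟨by omega, fun j _ _ => by omega⟩
      · have e1 := hc p t le_rfl le_rfl h2
        exact ⟨by omega, fun j _ _ => by omega⟩
    · refine ⟨?_, fun j _ _ => by omega⟩
      rcases Nat.lt_or_ge p (C + s) with h2 | h2
      · rcases Nat.lt_or_ge (C + s) (p + t) with h3 | h3
        · have := hz' h2 h3
          rcases Nat.lt_or_ge (C + s + A) (p + t) with h4 | h4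
          · have := hy' (by omega) h4
            omega
          · have e2 := hsa p t le_rfl le_rfl (by omega) (by omega) (by omega) (by omega)
            omega
        · have := hs p t le_rfl le_rfl (by omega) (by omega)
          omega
      · rcases Nat.lt_or_ge p (C + s + A) with h3 | h3
        · rcases Nat.lt_or_ge (C + s + A) (p + t) with h4 | h4
          · have := hy' h3 h4
            have e2 := has p t le_rfl le_rfl (by omega) (by omega) (by omega) (by omega)
            omega
          · have := ha p t le_rfl le_rfl (by omega) (by omega)
            omega
        · have := hs' p t le_rfl le_rfl (by omega) (by omega)
          omega

end

/-! ### Diagrams filling quadrilaterals -/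

section

variable {S : Type} {P : C6Presentation S} {M : MapData S P.Grp} {O : List ℕ}
  {F : Multiset (List ℕ)} {b : List ℕ}

/-- The weights of the corners of a quadrilateral with perimeter `n`. -/
noncomputable def quadWeight (n x y z j : ℕ) : ℤ :=
  2 * ind (j = 0) + 2 * ind (j = x % n) + 4 * ind (j = y % n) + 4 * ind (j = z % n)

theorem quadWeight_nonneg {n x y z j : ℕ} : 0 ≤ quadWeight n x y z j := by
  unfold quadWeight; positivity

theorem cnt_eq_one {n x : ℕ} (h : x < n) : cnt (fun j => j = x) n = 1 := by
  rw [cnt, Finset.sum_eq_single x (fun j _ hj => ind_neg hj)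
    (fun h' => absurd (Finset.mem_range.2 h) h')]
  exact ind_pos rfl

theorem sum_quadWeight {n : ℕ} (x y z : ℕ) (hn : 0 < n) :
    ∑ j ∈ Finset.range n, quadWeight n x y z j = 12 := by
  have h : ∀ x < n, ∑ j ∈ Finset.range n, (ind (j = x) : ℤ) = 1 := fun x hx => by
    have := cnt_eq_one hx
    unfold cnt at this
    exact_mod_cast this
  simp only [quadWeight, Finset.sum_add_distrib, ← Finset.mul_sum]
  rw [h _ hn, h _ (Nat.mod_lt _ hn), h _ (Nat.mod_lt _ hn), h _ (Nat.mod_lt _ hn)]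
  norm_num

theorem sum_quadWeight_window (n x y z p t : ℕ) :
    ∑ j ∈ Finset.range t, quadWeight n x y z ((p + 1 + j) % n) =
      ((2 * cnt (fun j => (p + 1 + j) % n = 0) t + 2 * cnt (fun j => (p + 1 + j) % n = x % n) t +
        4 * cnt (fun j => (p + 1 + j) % n = y % n) t +
        4 * cnt (fun j => (p + 1 + j) % n = z % n) t : ℕ) : ℤ) := by
  simp only [quadWeight, Finset.sum_add_distrib, ← Finset.mul_sum, cnt]
  push_cast
  rfl

theorem one_le_cnt_corner {n p t x y : ℕ} (hxy : x % n = y) (h1 : p < x) (h2 : x < p + t) :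
    1 ≤ cnt (fun j => (p + 1 + j) % n = y) (t - 1) := by
  refine cnt_pos (i := x - (p + 1)) (by omega) ?_
  rwa [show p + 1 + (x - (p + 1)) = x by omega]

theorem Diagram.weight_eq_zero (D : Diagram P M O F) (hb : b ∈ F) {β : ℕ → ℤ} (hβ : ∀ j, 0 ≤ β j)
    (h : corn M O F β b = 0) {i x : ℕ} (hc : ¬ Chg M O F b i)
    (hx : M.inv (cyc b i) = cyc O x) : β (x % O.length) = 0 := by
  have hL := List.length_pos_of_ne_nil (D.ne b hb)
  have h1 := (Finset.sum_eq_zero_iff_of_nonneg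
    (fun i _ => mul_nonneg (Nat.cast_nonneg _) (hβ _))).1 h (i % b.length)
    (Finset.mem_range.2 (Nat.mod_lt _ hL))
  have hE : Ext M O b i := by unfold Ext; rw [hx]; exact cyc_mem D.outer_ne _
  have e1 : Ext M O b (i % b.length) := by unfold Ext at *; rwa [cyc_mod]
  have e2 : ¬ Chg M O F b (i % b.length) := by
    intro h'
    apply hc
    have e := Nat.mod_add_div i b.length
    rw [← e]
    generalize i / b.length = m
    induction m with
    | zero => simpa using h'
    | succ m ih => rw [Nat.mul_succ, ← Nat.add_assoc, chg_add_length]; exact ih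
  rw [ind_pos ⟨e1, e2⟩, cyc_mod, hx, idxOf_cyc D.outer_nodup D.outer_ne] at h1
  simpa using h1

/-- A diagram filling a quadrilateral, with no fewer faces on the other side of the relator. -/
structure QuadDiagram (M : MapData S P.Grp) (O : List ℕ) (F : Multiset (List ℕ))
    (c d s a s' : Word S) : Prop where
  diagram : Diagram P M O F
  quad : Quad P c d s a s'
  outer : O.map M.lab = c ++ (s ++ (a ++ s'))
  min : ∀ W : Multiset (Word S), (∀ r ∈ W, r ∈ P.rels ∧ r ≠ []) →
      Realizable P ((wordInv d ++ (s ++ (a ++ s'))) ::ₘ W) → Multiset.card F ≤ Multiset.card W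
  large : 13 * (s.length + s'.length) < c.length

variable {c d s a s' : Word S}

namespace QuadDiagram

/-- The corner weights of a filled quadrilateral. -/
noncomputable def wt (O : List ℕ) (c s a : Word S) : ℕ → ℤ :=
  quadWeight O.length c.length (c.length + s.length) (c.length + s.length + a.length)

theorem length_eq (Q : QuadDiagram M O F c d s a s') :
    O.length = c.length + (s.length + (a.length + s'.length)) := by
  have := congrArg List.length Q.outer
  simpa using this

theorem length_a_le (Q : QuadDiagram M O F c d s a s') :
    a.length ≤ c.length + (s.length + s'.length) := by
  have h := Q.quad.loop
  simp only [P.elt_append] at h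
  have h1 : P.elt a = (P.elt s)⁻¹ * (P.elt c)⁻¹ *
      (P.elt c * (P.elt s * (P.elt a * P.elt s'))) * (P.elt s')⁻¹ := by group
  rw [h, mul_one] at h1
  have h2 := P.len_mul_le ((P.elt s)⁻¹ * (P.elt c)⁻¹) (P.elt s')⁻¹
  have h3 := P.len_mul_le (P.elt s)⁻¹ (P.elt c)⁻¹
  have h4 := P.len_elt_le c
  have h5 := P.len_elt_le s
  have h6 := P.len_elt_le s'
  rw [← h1, Q.quad.geo_a, P.len_inv] at h2
  rw [P.len_inv, P.len_inv] at h3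
  omega

theorem six (Q : QuadDiagram M O F c d s a s') (hb : b ∈ F) {i x k : ℕ}
    (h : IsWindow M O b i x k) (hk : k ≤ b.length) (hx : x + k ≤ c.length) : 6 * k < b.length :=
  Q.diagram.six_mul_lt_of_arc Q.quad.rel Q.outer Q.min hb h hk hx

theorem six' (Q : QuadDiagram M O F c d s a s') (hb : b ∈ F) {i x k : ℕ}
    (h : IsWindow M O b i x k) (hk : k ≤ b.length) (hx : O.length ≤ x)
    (hxk : x + k ≤ O.length + c.length) : 6 * k < b.length := by
  rw [← Nat.sub_add_cancel hx] at h
  exact Q.six hb h.of_add_length hk (by omega)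

theorem two_s (Q : QuadDiagram M O F c d s a s') (hb : b ∈ F) {i x k : ℕ}
    (h : IsWindow M O b i x k) (hk : k ≤ b.length) (hx : c.length ≤ x)
    (hxk : x + k ≤ c.length + s.length) : 2 * k ≤ b.length :=
  Q.diagram.two_mul_window hb h hk Q.outer hx hxk Q.quad.geo_s

theorem two_a (Q : QuadDiagram M O F c d s a s') (hb : b ∈ F) {i x k : ℕ}
    (h : IsWindow M O b i x k) (hk : k ≤ b.length) (hx : c.length + s.length ≤ x)
    (hxk : x + k ≤ c.length + s.length + a.length) : 2 * k ≤ b.length :=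
  Q.diagram.two_mul_window (u := c ++ s) (y := s') hb h hk (by simp [Q.outer]) (by simpa using hx)
    (by simpa using hxk) Q.quad.geo_a

theorem two_s' (Q : QuadDiagram M O F c d s a s') (hb : b ∈ F) {i x k : ℕ}
    (h : IsWindow M O b i x k) (hk : k ≤ b.length) (hx : c.length + s.length + a.length ≤ x)
    (hxk : x + k ≤ O.length) : 2 * k ≤ b.length :=
  Q.diagram.two_mul_window (u := c ++ s ++ a) (v := s') (y := []) hb h hk (by simp [Q.outer])
    (by simpa using (show _ by omega)) (by have := Q.length_eq; simp; omega) Q.quad.geo_s'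

/-- An outer run without corners. -/
theorem run (Q : QuadDiagram M O F c d s a s') (hb : b ∈ F) {i p k : ℕ}
    (h : IsWindow M O b i p k) (hk : k ≤ b.length) (hp : p < O.length)
    (hz : ∀ x, p < x → x < p + k → wt O c s a (x % O.length) = 0) :
    2 * k ≤ b.length ∧ (p < c.length → 6 * k < b.length) := by
  have hn := Q.length_eq
  have hcor : ∀ x, (x % O.length = 0 ∨ x = c.length ∨ x = c.length + s.length ∨
      x = c.length + s.length + a.length) → x ≤ p ∨ p + k ≤ x := by
    intro x hx
    by_contra! hlt
    have h0 := hz x hlt.1 hlt.2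
    unfold wt quadWeight at h0
    rcases hx with hx | rfl | rfl | rfl
    · rw [hx, ind_pos rfl] at h0; omega
    · rw [ind_pos (p := c.length % O.length = c.length % O.length) rfl] at h0; omega
    · rw [ind_pos (p := (c.length + s.length) % O.length = (c.length + s.length) % O.length) rfl]
        at h0; omega
    · rw [ind_pos (p := (c.length + s.length + a.length) % O.length =
        (c.length + s.length + a.length) % O.length) rfl] at h0; omega
  have c0 := hcor O.length (by simp)
  have c1 := hcor _ (Or.inr (Or.inl rfl))
  have c2 := hcor _ (Or.inr (Or.inr (Or.inl rfl)))
  have c3 := hcor _ (Or.inr (Or.inr (Or.inr rfl)))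
  rcases Nat.lt_or_ge p c.length with h1 | h1
  · have := Q.six hb h hk (by omega)
    exact ⟨by omega, fun _ => this⟩
  · refine ⟨?_, fun h' => by omega⟩
    rcases Nat.lt_or_ge p (c.length + s.length) with h2 | h2
    · exact Q.two_s hb h hk h1 (by omega)
    · rcases Nat.lt_or_ge p (c.length + s.length + a.length) with h3 | h3
      · exact Q.two_a hb h hk h2 (by omega)
      · exact Q.two_s' hb h hk h3 (by omega)

theorem exists_chg (Q : QuadDiagram M O F c d s a s') (hb : b ∈ F) : ∃ i, Chg M O F b i := by
  by_contra! hch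
  have D := Q.diagram
  have hn := Q.length_eq
  have hA := Q.length_a_le
  have hC := Q.large
  have hL := List.length_pos_of_ne_nil (D.ne b hb)
  obtain ⟨hlen, -, -⟩ := D.uncharged hb hch (fun _ => 0)
  obtain ⟨p, hp, -, hw, -⟩ := D.exists_window hb (i := 0) hL le_rfl
    (D.ext_of_not_chg hb hch 0) (fun j _ => hch _)
  replace hw : IsWindow M O b 0 p b.length := hw
  rcases Nat.lt_or_ge p c.length with h1 | h1
  · have e1 := Q.six hb (hw.sub (x := p) (m := c.length - p) le_rfl (by omega)) (by omega)
      (by omega)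
    have e2 := Q.six' hb (hw.sub (x := O.length) (m := p) (by omega) (by omega)) (by omega)
      le_rfl (by omega)
    omega
  · have e2 := Q.six' hb (hw.sub (x := O.length) (m := c.length) (by omega) (by omega)) (by omega)
      le_rfl (by omega)
    omega

end QuadDiagram

end

/-! ### Curvature in quadrilaterals -/

section

variable {S : Type} {P : C6Presentation S} {M : MapData S P.Grp} {O : List ℕ}
  {F : Multiset (List ℕ)} {b : List ℕ} {c d s a s' : Word S}

theorem ind_eq_add {p q : Prop} (h : q → p) : ind p = ind q + ind (p ∧ ¬ q) := by
  by_cases hq : q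
  · simp [hq, h hq]
  · simp [hq]

theorem ind_and_eq_add {p q r : Prop} (h : q → p) :
    ind (r ∧ p) = ind (r ∧ q) + ind (r ∧ (p ∧ ¬ q)) := by
  by_cases hq : q
  · simp [hq, h hq]
  · simp [hq]

namespace QuadDiagram

/-- A face with two outer runs, none of them meeting a corner, which touches `c`. -/
theorem two_lt_intRuns (Q : QuadDiagram M O F c d s a s') (hb : b ∈ F)
    (he : extRuns M O F b = 2) (hcorn : corn M O F (wt O c s a) b = 0)
    (ht : ∃ i, ∃ x < c.length, M.inv (cyc b i) = cyc O x) : 2 < intRuns M O F b := by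
  have D := Q.diagram
  have hn := Q.length_eq
  have hL := List.length_pos_of_ne_nil (D.ne b hb)
  have hch := Q.exists_chg hb
  have hz : ∀ {i x}, ¬ Chg M O F b i → M.inv (cyc b i) = cyc O x →
      wt O c s a (x % O.length) = 0 :=
    fun h1 h2 => D.weight_eq_zero hb (fun j => quadWeight_nonneg) hcorn h1 h2
  have hinj : ∀ {x y}, cyc O x = cyc O y → x % O.length = y % O.length :=
    fun h => (cyc_eq_iff D.outer_nodup D.outer_ne).1 h
  set T : ℕ → Prop := fun i => ∃ x < c.length, M.inv (cyc b i) = cyc O x with hT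
  have hTE : ∀ i, T i → Ext M O b i := by
    rintro i ⟨x, -, hx⟩
    unfold Ext; rw [hx]; exact cyc_mem D.outer_ne _
  have hTL : ∀ i, T (i + b.length) ↔ T i := by
    intro i; simp only [hT, cyc_add_length]
  have hwin : ∀ {i k}, 1 ≤ k → k ≤ b.length → Ext M O b i →
      (∀ j, j + 1 < k → ¬ Chg M O F b (i + j)) → ∃ p < O.length, IsWindow M O b i p k ∧
        2 * k ≤ b.length ∧ (p < c.length → 6 * k < b.length) := by
    intro i k h1 h2 h3 h4
    obtain ⟨p, hp, -, hw, -⟩ := D.exists_window hb h1 h2 h3 h4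
    refine ⟨p, hp, hw, Q.run hb hw h2 hp (fun x hx1 hx2 => ?_)⟩
    refine hz (h4 (p + k - 1 - x) (by omega)) ?_
    rw [hw _ (by omega)]
    congr 1
    omega
  have k1 : cnt T b.length ≤ (b.length - 1) / 6 * cnt (fun i => Chg M O F b i ∧ T i) b.length := by
    refine cnt_le_mul_cnt_of_periodic hTL chg_add_length ?_ ?_ hch
    · rintro i hc ⟨x, hx, hix⟩
      have h0 := hz hc hix
      have hx0 : x ≠ 0 := by
        rintro rfl
        unfold wt quadWeight at h0
        rw [ind_pos (Nat.zero_mod _)] at h0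
        omega
      have := D.mirror_run hb (Multiset.mem_cons_self O F) D.outer_ne (k := 2) (i := i)
        (J := x) (by omega) hix ?_ 1 (by omega)
      · exact ⟨x - 1, by omega, this⟩
      · intro j hj
        obtain rfl : j = 0 := by omega
        exact hc
    · intro i k h1 h2 h3 h4
      obtain ⟨p, hp, hw, -, h6⟩ := hwin (i := i) h1 h2 (hTE _ (h3 0 h1)) h4
      obtain ⟨x, hx, hxe⟩ := h3 (k - 1) (by omega)
      rw [hw _ (by omega)] at hxe
      have := hinj hxe
      rw [show p + k - 1 - (k - 1) = p by omega, Nat.mod_eq_of_lt hp,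
        Nat.mod_eq_of_lt (by omega)] at this
      have := h6 (by omega)
      omega
  have k2 : cnt (fun i => Ext M O b i ∧ ¬ T i) b.length ≤
      b.length / 2 * cnt (fun i => Chg M O F b i ∧ (Ext M O b i ∧ ¬ T i)) b.length := by
    refine cnt_le_mul_cnt_of_periodic (fun i => by rw [ext_add_length, hTL]) chg_add_length ?_ ?_ hch
    · rintro i hc ⟨hE, hnT⟩
      refine ⟨(D.ext_succ hb hc).1 hE, ?_⟩
      rintro ⟨x, hx, hix⟩
      obtain ⟨J, hJ, hJ'⟩ := D.exists_mirror_outer hb (k := 2) hE (fun j hj => by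
        obtain rfl : j = 0 := by omega
        exact hc)
      have e0 := hJ' 0 (by omega)
      have e1 := hJ' 1 (by omega)
      rw [hix] at e1
      have e2 : (x + 1) % O.length = J % O.length := by
        have := hinj e1
        rw [Nat.add_mod, this, ← Nat.add_mod, Nat.sub_add_cancel (by omega)]
      have e3 : M.inv (cyc b i) = cyc O (x + 1) := by
        rw [← cyc_mod O (x + 1), e2, cyc_mod]; exact e0
      rcases Nat.lt_or_ge (x + 1) c.length with h | h
      · exact hnT ⟨x + 1, h, e3⟩
      · have h0 := hz hc e3
        rw [show x + 1 = c.length by omega] at h0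
        unfold wt quadWeight at h0
        rw [ind_pos (p := c.length % O.length = c.length % O.length) rfl] at h0
        omega
    · intro i k h1 h2 h3 h4
      obtain ⟨p, hp, hw, h5, -⟩ := hwin (i := i) h1 h2 (h3 0 h1).1 h4
      omega
  have k3 : extCount M O b = cnt T b.length + cnt (fun i => Ext M O b i ∧ ¬ T i) b.length := by
    unfold extCount cnt
    rw [← Finset.sum_add_distrib]
    exact Finset.sum_congr rfl (fun i _ => ind_eq_add (hTE i))
  have k4 : extRuns M O F b = cnt (fun i => Chg M O F b i ∧ T i) b.length +
      cnt (fun i => Chg M O F b i ∧ (Ext M O b i ∧ ¬ T i)) b.length := by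
    unfold extRuns cnt
    rw [← Finset.sum_add_distrib]
    exact Finset.sum_congr rfl (fun i _ => ind_and_eq_add (hTE i))
  have k5 : 0 < cnt T b.length := by
    obtain ⟨i, x, hx, hix⟩ := ht
    exact cnt_pos (Nat.mod_lt i hL) ⟨x, hx, by rwa [cyc_mod]⟩
  refine D.lt_intRuns hb hch ?_
  have k6 : extCount M O b ≤ b.length := extCount_le
  generalize cnt (fun i => Chg M O F b i ∧ T i) b.length = e at *
  generalize cnt (fun i => Chg M O F b i ∧ (Ext M O b i ∧ ¬ T i)) b.length = e' at *
  have h2 : e + e' = 2 := by omega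
  have h3 : e ≠ 0 := by rintro rfl; omega
  have : e = 1 ∨ e = 2 := by omega
  rcases this with rfl | rfl
  · obtain rfl : e' = 1 := by omega
    omega
  · obtain rfl : e' = 0 := by omega
    omega

theorem curv_le_corn (Q : QuadDiagram M O F c d s a s') (hb : b ∈ F) :
    curv M O F b ≤ corn M O F (wt O c s a) b ∧
    ∀ j < c.length, (∃ i, M.inv (cyc b i) = cyc O j) →
      curv M O F b < corn M O F (wt O c s a) b ∨ j < 6 * (s.length + s'.length) ∨
        c.length ≤ j + 6 * (s.length + s'.length) := by
  have D := Q.diagram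
  have hn := Q.length_eq
  have hL := List.length_pos_of_ne_nil (D.ne b hb)
  have hn0 := List.length_pos_of_ne_nil D.outer_ne
  have c1 := D.curv_le hb
  have c2 := D.curv_le' hb
  have hc0 : 0 ≤ corn M O F (wt O c s a) b := corn_nonneg (fun j => quadWeight_nonneg)
  have hch := Q.exists_chg hb
  have htL : extCount M O b ≤ b.length := extCount_le
  rcases Nat.lt_or_ge 2 (extRuns M O F b) with he | he
  · exact ⟨by omega, fun j _ _ => by omega⟩
  interval_cases he' : extRuns M O F b
  · have h0 := D.extCount_eq_zero hb hch he'
    have : 6 < intRuns M O F b := D.lt_intRuns hb hch (by omega)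
    exact ⟨by omega, fun j _ _ => by omega⟩
  · obtain ⟨h1, h2, i, p, hp, hrun, hout, -, hcorn⟩ := D.single_window hb he' (wt O c s a)
    set t := extCount M O b with ht
    replace hrun : IsWindow M O b i p t := hrun
    have hsub : ∀ {x m}, p ≤ x → x + m ≤ p + t →
      IsWindow M O b (i + (p + t - x - m)) x m := fun h h' => hrun.sub h h'
    unfold wt at hcorn ⊢
    rw [sum_quadWeight_window] at hcorn
    have key := quad_arith (I := intRuns M O F b) (L := b.length) hn Q.length_a_le Q.large hp h1 h2
      htL (fun h h' => one_le_cnt_corner (Nat.mod_self _) h h')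
      (fun h h' => one_le_cnt_corner (n := O.length) rfl h h')
      (fun h h' => one_le_cnt_corner (Nat.add_mod_left _ _) h h')
      (fun h h' => one_le_cnt_corner (n := O.length) rfl h h')
      (fun h h' => one_le_cnt_corner (Nat.add_mod_left _ _) h h')
      (fun h h' => one_le_cnt_corner (n := O.length) rfl h h')
      (fun q hq => D.lt_intRuns hb hch hq)
      (fun x m e1 e2 e3 => Q.six hb (hsub e1 e2) (by omega) e3)
      (fun x m e1 e2 e3 e4 => Q.six' hb (hsub e1 e2) (by omega) e3 e4)
      (fun x m e1 e2 e3 e4 => Q.two_s hb (hsub e1 e2) (by omega) e3 e4)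
      (fun x m e1 e2 e3 e4 => Q.two_a hb (hsub e1 e2) (by omega) e3 e4)
      (fun x m e1 e2 e3 e4 => Q.two_s' hb (hsub e1 e2) (by omega) e3 e4)
      (fun x m e1 e2 e3 e4 e5 e6 => D.four_mul_window (u := c) (y := s') hb (hsub e1 e2) (by omega)
        Q.outer e3 e4 e5 e6 Q.quad.geo_a Q.quad.near)
      (fun x m e1 e2 e3 e4 e5 e6 => D.four_mul_window' (u := c ++ s) (y := []) (a := a) (s := s')
        hb (hsub e1 e2) (by omega)
        (by simp [Q.outer]) (by simpa using e3) (by simpa using e4) (by simpa using e5)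
        (by simp; omega) Q.quad.geo_a Q.quad.near')
    rw [hcorn]
    refine ⟨by have := key.1; omega, ?_⟩
    rintro j hj ⟨i', hi'⟩
    have hpos : p ≤ j ∧ j < p + t ∨ p ≤ O.length + j ∧ O.length + j < p + t := by
      obtain ⟨e, he, hce⟩ : ∃ e < b.length, cyc b (i + e) = cyc b i' := by
        have hmem := cyc_mem (D.ne b hb) i'
        refine ⟨(i' + b.length * i - i) % b.length, Nat.mod_lt _ hL, ?_⟩
        rw [cyc_eq_iff (D.face_nodup hb) (D.ne b hb), Nat.add_mod, Nat.mod_mod, ← Nat.add_mod]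
        have : i ≤ b.length * i := Nat.le_mul_of_pos_left i hL
        rw [show i + (i' + b.length * i - i) = i' + b.length * i by omega,
          Nat.add_mul_mod_self_left]
      have het : e < t := by
        by_contra hlt
        refine hout e (by omega) he ?_
        unfold Ext
        rw [hce, hi']; exact cyc_mem D.outer_ne _
      have h3 := hrun e het
      rw [hce, hi', cyc_eq_iff D.outer_nodup D.outer_ne, Nat.mod_eq_of_lt (by omega)] at h3
      rcases Nat.lt_or_ge (p + t - 1 - e) O.length with h4 | h4
      · rw [Nat.mod_eq_of_lt h4] at h3
        omega
      · rw [Nat.mod_eq_sub_mod h4, Nat.mod_eq_of_lt (by omega)] at h3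
        omega
    have := key.2 j hj hpos
    omega
  · refine ⟨by omega, fun j hj hi => ?_⟩
    by_cases h0 : corn M O F (wt O c s a) b = 0
    · obtain ⟨i, hi⟩ := hi
      have := Q.two_lt_intRuns hb he' h0 ⟨i, j, hj, hi⟩
      omega
    · omega

end QuadDiagram

end

/-! ### Cancellation in words -/

section

variable {S : Type} {P : C6Presentation S} {M : MapData S P.Grp} {O : List ℕ}
  {F : Multiset (List ℕ)} {b : List ℕ}

/-- The `i`-th and `i + 1`-st letters of `w` cancel. -/
def CancelAt (w : Word S) (i : ℕ) : Prop :=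
  ∃ l, w[i]? = some l ∧ w[i + 1]? = some (flipLetter l)

theorem Reduced.not_cancelAt {w : Word S} (h : Reduced w) (i : ℕ) : ¬ CancelAt w i := by
  rintro ⟨l, h1, h2⟩
  obtain ⟨h3, h4⟩ := List.getElem?_eq_some_iff.1 h2
  obtain ⟨h5, h6⟩ := List.getElem?_eq_some_iff.1 h1
  exact reduced_iff.1 h i h3 (by rw [h4, h6])

theorem CancelAt.eq_append {w : Word S} {i : ℕ} (h : CancelAt w i) :
    ∃ l, w = w.take i ++ l :: flipLetter l :: w.drop (i + 2) := by
  obtain ⟨l, h1, h2⟩ := h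
  obtain ⟨h3, h4⟩ := List.getElem?_eq_some_iff.1 h2
  obtain ⟨h5, h6⟩ := List.getElem?_eq_some_iff.1 h1
  refine ⟨l, ?_⟩
  conv_lhs => rw [← List.take_append_drop i w, List.drop_eq_getElem_cons h5,
    List.drop_eq_getElem_cons h3, h4, h6]

theorem CancelAt.len_add_two_le {w : Word S} {i : ℕ} (h : CancelAt w i) :
    P.len (P.elt w) + 2 ≤ w.length := by
  obtain ⟨l, hl⟩ := h.eq_append
  generalize w.take i = u, w.drop (i + 2) = v at hl
  subst hl
  have h1 : P.elt (u ++ l :: flipLetter l :: v) = P.elt (u ++ v) := by simp [P.eltL_flip]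
  have h2 := P.len_elt_le (u ++ v)
  rw [h1]
  simp at h2 ⊢
  omega

theorem GeoWord.not_cancelAt {w : Word S} (h : GeoWord P w) (i : ℕ) : ¬ CancelAt w i := by
  intro hc
  have := hc.len_add_two_le (P := P)
  unfold GeoWord at h
  omega

theorem CancelAt.of_append {u v : Word S} {i : ℕ} (h : CancelAt (u ++ v) i) :
    CancelAt u i ∨ (i + 1 = u.length ∧ ∃ l u' v', u = u' ++ [l] ∧ v = flipLetter l :: v') ∨
      (u.length ≤ i ∧ CancelAt v (i - u.length)) := by
  obtain ⟨l, h1, h2⟩ := h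
  rcases Nat.lt_trichotomy (i + 1) u.length with hlt | heq | hgt
  · rw [List.getElem?_append_left (by omega)] at h1
    rw [List.getElem?_append_left hlt] at h2
    exact Or.inl ⟨l, h1, h2⟩
  · right; left
    rw [List.getElem?_append_left (by omega)] at h1
    rw [List.getElem?_append_right heq.ge, heq, Nat.sub_self] at h2
    refine ⟨heq, l, u.take i, v.drop 1, ?_, ?_⟩
    · obtain ⟨h5, h6⟩ := List.getElem?_eq_some_iff.1 h1
      conv_lhs => rw [← List.take_append_drop i u, List.drop_eq_getElem_cons h5, h6,
        List.drop_eq_nil_of_le heq.ge]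
    · obtain ⟨h5, h6⟩ := List.getElem?_eq_some_iff.1 h2
      conv_lhs => rw [← List.drop_zero (l := v), List.drop_eq_getElem_cons h5, h6]
  · right; right
    rw [List.getElem?_append_right (by omega)] at h1
    rw [List.getElem?_append_right (by omega)] at h2
    exact ⟨by omega, l, h1, by rwa [show i - u.length + 1 = i + 1 - u.length by omega]⟩

theorem Diagram.lab_getElem? {j : ℕ} (hj : j < O.length) :
    (O.map M.lab)[j]? = some (M.lab (cyc O j)) := by
  rw [List.getElem?_map, List.getElem?_eq_getElem hj, cyc_eq_getElem hj]
  rfl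

theorem Diagram.spur_cancel_cyc (D : Diagram P M O F) {d : ℕ} (hd : d ∈ O)
    (h : nxt (O ::ₘ F) (M.inv d) = d) :
    (∃ j, O.idxOf d = j + 1 ∧ CancelAt (O.map M.lab) j) ∨
      (O.idxOf d = 0 ∧ ∃ l, (O.map M.lab)[O.length - 1]? = some l ∧
        (O.map M.lab)[0]? = some (flipLetter l)) := by
  have hlt := List.idxOf_lt_length_iff.2 hd
  have key : ∀ j, cyc O (j + 1) = d → M.lab d = flipLetter (M.lab (cyc O j)) := by
    intro j hj
    have h2 : M.inv d = cyc O j := by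
      apply (nxt (O ::ₘ F)).injective
      rw [h, D.nxt_outer, hj]
    rw [← h2, D.isMap.lab_inv _ (Diagram.outer_mem_darts hd), flipLetter_flipLetter]
  have h1 := cyc_idxOf hd
  rcases Nat.eq_zero_or_pos (O.idxOf d) with h0 | h0
  · refine Or.inr ⟨h0, _, lab_getElem? (by omega), ?_⟩
    rw [lab_getElem? (by omega), ← h0, h1]
    rw [key (O.length - 1) ?_]
    rw [Nat.sub_add_cancel (by omega), ← h1, h0, ← cyc_mod, Nat.mod_self]
  · refine Or.inl ⟨O.idxOf d - 1, by omega, _, lab_getElem? (by omega), ?_⟩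
    rw [Nat.sub_add_cancel h0, lab_getElem? hlt, h1]
    rw [key (O.idxOf d - 1) (by rw [Nat.sub_add_cancel h0, h1])]

theorem IsMap.pos_cyc {cs : Multiset (List ℕ)} (h : IsMap P M cs) (hb : b ∈ cs) (hne : b ≠ [])
    (i : ℕ) : M.pos (M.src (cyc b (i + 1))) = M.pos (M.src (cyc b i)) * P.eltL (M.lab (cyc b i)) := by
  have hd : cyc b i ∈ darts cs := GSC.mem_darts.2 ⟨b, hb, cyc_mem hne i⟩
  rw [← nxt_cyc h.nodup hb hne, h.src_nxt hd, h.pos_inv _ hd]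

theorem IsMap.pos_cyc_take {cs : Multiset (List ℕ)} (h : IsMap P M cs) (hb : b ∈ cs) (hne : b ≠ [])
    {i : ℕ} (hi : i ≤ b.length) :
    M.pos (M.src (cyc b i)) = M.pos (M.src (cyc b 0)) * P.elt ((b.map M.lab).take i) := by
  induction i with
  | zero => simp
  | succ i ih =>
    rw [h.pos_cyc hb hne, ih (by omega), ← List.take_append_getElem (by simpa using hi),
      P.elt_append, mul_assoc]
    simp [cyc_eq_getElem (b := b) (i := i) (by omega)]

/-- Subwords of length less than that of the relator are injective. -/
theorem arc_inj {c d : Word S} (hr : c ++ d ∈ P.rels) (hd : d ≠ []) {i j : ℕ} (hi : i ≤ c.length)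
    (hj : j ≤ c.length) (h : P.elt (c.take i) = P.elt (c.take j)) : i = j := by
  have key : ∀ i j, i < j → j ≤ c.length → P.elt (c.take i) ≠ P.elt (c.take j) := by
    intro i j hij hj h
    have e1 : c.take j = c.take i ++ (c.take j).drop i := by
      conv_lhs => rw [← List.take_append_drop i (c.take j), List.take_take, min_eq_left hij.le]
    rw [e1, P.elt_append, left_eq_mul] at h
    refine elt_ne_one_of_prefix (P.rotate_mem _ hr i) (u := (c.take j).drop i)
      (v := c.drop j ++ d ++ c.take i) ?_ ?_ (by simp [hd]) h
    · rw [List.rotate_eq_drop_append_take (by simp; omega), List.drop_append_of_le_length (by omega),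
        List.take_append_of_le_length (by omega)]
      have : c.drop i = (c.take j).drop i ++ c.drop j := by
        conv_lhs => rw [← List.take_append_drop j c]
        rw [List.drop_append_of_le_length (by simp; omega)]
      rw [this]; simp
    · intro h0
      have := congrArg List.length h0
      simp at this
      omega
  rcases Nat.lt_trichotomy i j with hlt | heq | hgt
  · exact absurd h (key i j hlt hj)
  · exact heq
  · exact absurd h.symm (key j i hgt hi)

end

/-! ### Tight quadrilaterals -/

section

variable {S : Type} {P : C6Presentation S} {M : MapData S P.Grp} {O : List ℕ}
  {F : Multiset (List ℕ)} {b : List ℕ} {c d s a s' : Word S}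

/-- No cancellation where `s'` and `s` meet `c`. -/
structure Tight (c s s' : Word S) : Prop where
  right : ∀ l c' s₁, c = c' ++ [l] → s ≠ flipLetter l :: s₁
  left : ∀ l c' s₁, s' = s₁ ++ [l] → c ≠ flipLetter l :: c'

namespace QuadDiagram

theorem six_le_wt (Q : QuadDiagram M O F c d s a s') (T : Tight c s s') {j : ℕ} (hj : j < O.length)
    (h : (∃ i, j = i + 1 ∧ CancelAt (O.map M.lab) i) ∨
      (j = 0 ∧ ∃ l, (O.map M.lab)[O.length - 1]? = some l ∧
        (O.map M.lab)[0]? = some (flipLetter l))) : 6 ≤ wt O c s a j := by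
  have hn := Q.length_eq
  have hC := Q.large
  rw [Q.outer] at h
  unfold wt quadWeight
  rcases h with ⟨i, rfl, h⟩ | ⟨rfl, l, h1, h2⟩
  · rcases h.of_append with h | ⟨he, l, c', v, h1, h2⟩ | ⟨hi, h⟩
    · refine absurd h (Reduced.not_cancelAt ?_ _)
      exact (rels_reduced Q.quad.rel).infix (List.prefix_append c d).isInfix
    · rcases s with _ | ⟨x, s₁⟩
      · simp only [List.length_nil, add_zero]
        have : (i + 1 = c.length % O.length) := by rw [Nat.mod_eq_of_lt (by omega), he]
        rw [ind_pos this]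
        push_cast
        omega
      · obtain ⟨rfl, -⟩ := List.cons_eq_cons.1 h2
        exact absurd rfl (T.right l c' s₁ h1)
    rcases h.of_append with h | ⟨he, l, s₁, v, h1, h2⟩ | ⟨hi', h⟩
    · exact absurd h (Q.quad.geo_s.not_cancelAt _)
    · rcases a with _ | ⟨x, a₁⟩
      · simp only [List.length_nil, add_zero]
        have : (i + 1 = (c.length + s.length) % O.length) := by
          rw [Nat.mod_eq_of_lt (by omega)]; omega
        rw [ind_pos this]
        push_cast
        omega
      · obtain ⟨rfl, -⟩ := List.cons_eq_cons.1 h2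
        have h3 := Q.quad.near 1
        have h4 : P.elt (s ++ (flipLetter l :: a₁).take 1) = P.elt s₁ := by
          rw [h1]; simp [P.eltL_flip]
        have h5 := P.len_elt_le s₁
        rw [h4] at h3
        have h6 := congrArg List.length h1
        simp at h6
        omega
    rcases h.of_append with h | ⟨he, l, a₁, v, h1, h2⟩ | ⟨hi'', h⟩
    · exact absurd h (Q.quad.geo_a.not_cancelAt _)
    · have h3 := Q.quad.near' a₁.length
      have h4 : P.elt (a.drop a₁.length ++ s') = P.elt v := by
        rw [h1, h2]; simp [P.eltL_flip]
      have h5 := P.len_elt_le v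
      rw [h4] at h3
      have h6 := congrArg List.length h2
      simp at h6
      omega
    · exact absurd h (Q.quad.geo_s'.not_cancelAt _)
  · rcases List.eq_nil_or_concat' s' with rfl | ⟨s₁, x, rfl⟩
    · have : 0 = (c.length + s.length + a.length) % O.length := by
        rw [show c.length + s.length + a.length = O.length by simp at hn; omega, Nat.mod_self]
      rw [ind_pos rfl, ind_pos this]
      push_cast
      omega
    · have e1 : l = x := by
        have e : c ++ (s ++ (a ++ (s₁ ++ [x]))) = (c ++ s ++ a ++ s₁) ++ [x] := by simp
        rw [e, List.getElem?_append_right (by simp at hn ⊢; omega)] at h1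
        rw [show O.length - 1 - (c ++ s ++ a ++ s₁).length = 0 by simp at hn ⊢; omega] at h1
        simpa using h1.symm
      subst e1
      rcases c with _ | ⟨y, c'⟩
      · simp at hC
      · simp at h2
        exact absurd (by rw [h2]) (T.left l c' s₁ rfl)

theorem curv_eq_corn (Q : QuadDiagram M O F c d s a s') (T : Tight c s s') (hb : b ∈ F) :
    curv M O F b = corn M O F (wt O c s a) b := by
  have D := Q.diagram
  have h1 := D.curvature (β := wt O c s a) (fun _ => quadWeight_nonneg) (fun d hd hsp =>
    Q.six_le_wt T (List.idxOf_lt_length_iff.2 hd) (D.spur_cancel_cyc hd hsp))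
  rw [wt, sum_quadWeight _ _ _ (List.length_pos_of_ne_nil D.outer_ne), ← wt] at h1
  by_contra hne
  have h2 := lt_of_le_of_ne (Q.curv_le_corn hb).1 hne
  obtain ⟨F', rfl⟩ := Multiset.exists_cons_of_mem hb
  rw [Multiset.map_cons, Multiset.sum_cons] at h1
  have h3 : (F'.map fun b' => curv M O (b ::ₘ F') b' - corn M O (b ::ₘ F') (wt O c s a) b').sum ≤ 0 := by
    have h4 := Multiset.sum_map_le_sum_map _ (fun _ => (0 : ℤ)) (s := F') fun b' hb' =>
      sub_nonpos.2 (Q.curv_le_corn (Multiset.mem_cons_of_mem hb')).1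
    simpa using h4
  omega

theorem inv_mem_outer (Q : QuadDiagram M O F c d s a s') (T : Tight c s s') {j : ℕ}
    (h1 : 6 * (s.length + s'.length) ≤ j) (h2 : j + 6 * (s.length + s'.length) < c.length) :
    M.inv (cyc O j) ∈ O := by
  have D := Q.diagram
  by_contra hne
  have hd := Diagram.outer_mem_darts (F := F) (cyc_mem D.outer_ne j)
  obtain ⟨b, hb, hdb⟩ := mem_darts.1 (D.isMap.inv_mem _ hd)
  rcases Multiset.mem_cons.1 hb with rfl | hb
  · exact hne hdb
  obtain ⟨i, -, hi⟩ := exists_cyc hdb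
  have h3 := (Q.curv_le_corn hb).2 j (by omega) ⟨i, by rw [hi, D.isMap.inv_inv _ hd]⟩
  have h4 := Q.curv_eq_corn T hb
  omega

theorem pos_outer (Q : QuadDiagram M O F c d s a s') {j : ℕ} (hj : j ≤ O.length) :
    M.pos (M.src (cyc O j)) =
      M.pos (M.src (cyc O 0)) * P.elt ((c ++ (s ++ (a ++ s'))).take j) := by
  rw [Q.diagram.isMap.pos_cyc_take (Multiset.mem_cons_self _ _) Q.diagram.outer_ne hj, Q.outer]

theorem src_inv (Q : QuadDiagram M O F c d s a s') (j : ℕ) :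
    M.src (M.inv (cyc O j)) = M.src (cyc O (j + 1)) := by
  rw [← Q.diagram.isMap.src_nxt (Diagram.outer_mem_darts (cyc_mem Q.diagram.outer_ne j)),
    Q.diagram.nxt_outer]

theorem pos_of_inv (Q : QuadDiagram M O F c d s a s') {j k : ℕ} (hj : j < O.length)
    (hk : k < O.length) (h : M.inv (cyc O j) = cyc O k) :
    P.elt ((c ++ (s ++ (a ++ s'))).take (j + 1)) = P.elt ((c ++ (s ++ (a ++ s'))).take k) ∧
    P.elt ((c ++ (s ++ (a ++ s'))).take (k + 1)) = P.elt ((c ++ (s ++ (a ++ s'))).take j) := by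
  have key : ∀ {j k : ℕ}, j < O.length → k < O.length → M.inv (cyc O j) = cyc O k →
      P.elt ((c ++ (s ++ (a ++ s'))).take (j + 1)) = P.elt ((c ++ (s ++ (a ++ s'))).take k) := by
    intro j k hj hk h
    have h1 := congrArg (fun e => M.pos (M.src e)) h
    simp only [Q.src_inv] at h1
    rwa [Q.pos_outer (j := j + 1) (by omega), Q.pos_outer (j := k) (by omega), mul_right_inj] at h1
  refine ⟨key hj hk h, key hk hj ?_⟩
  rw [← h, Q.diagram.isMap.inv_inv _ (Diagram.outer_mem_darts (cyc_mem Q.diagram.outer_ne j))]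

theorem inv_not_arc (Q : QuadDiagram M O F c d s a s') (hd : d ≠ []) {j k : ℕ} (hj : j < c.length)
    (hk : k < c.length) : M.inv (cyc O j) ≠ cyc O k := by
  intro h
  have hn := Q.length_eq
  obtain ⟨h1, h2⟩ := Q.pos_of_inv (by omega) (by omega) h
  rw [List.take_append_of_le_length (by omega), List.take_append_of_le_length (by omega)] at h1 h2
  have e1 := arc_inj Q.quad.rel hd (by omega) (by omega) h1
  have e2 := arc_inj Q.quad.rel hd (by omega) (by omega) h2
  omega

end QuadDiagram

/-- The edges of the path labelled `a` starting at `g` with both ends in `A`. -/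
noncomputable def edgesIn (P : C6Presentation S) (A : Set P.Grp) (g : P.Grp) (a : Word S) : ℕ :=
  cnt (fun t => g * P.elt (a.take t) ∈ A ∧ g * P.elt (a.take (t + 1)) ∈ A) a.length

theorem cnt_eq_card {p : ℕ → Prop} [DecidablePred p] (n : ℕ) :
    cnt p n = ((Finset.range n).filter p).card := by
  rw [Finset.card_filter, cnt]
  refine Finset.sum_congr rfl fun i _ => ?_
  by_cases h : p i
  · rw [ind_pos h, if_pos h]
  · rw [ind_neg h, if_neg h]

theorem QuadDiagram.length_le (Q : QuadDiagram M O F c d s a s') (T : Tight c s s') (hd : d ≠ [])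
    {g : P.Grp} {A : Set P.Grp} (hA : relatorCycle P g (c ++ d) ⊆ A) :
    c.length ≤ edgesIn P A (g * P.elt (c ++ s)) a + 13 * (s.length + s'.length) := by
  classical
  have D := Q.diagram
  have hn := Q.length_eq
  have hC := Q.large
  set σ := s.length + s'.length
  have hmem : ∀ i ≤ c.length, g * P.elt (c.take i) ∈ A := fun i _ =>
    hA ⟨_, (List.take_prefix i c).trans (List.prefix_append _ _), rfl⟩
  set J := Finset.Ico (6 * σ) (c.length - 6 * σ)
  set T1 := Finset.Ico c.length (c.length + s.length)
  set T2 := Finset.Ico (c.length + s.length + a.length) O.length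
  set T3 := ((Finset.range a.length).filter fun t =>
    g * P.elt (c ++ s) * P.elt (a.take t) ∈ A ∧ g * P.elt (c ++ s) * P.elt (a.take (t + 1)) ∈ A).image
      (c.length + s.length + ·)
  have hcard : J.card ≤ (T1 ∪ T2 ∪ T3).card := by
    refine Finset.card_le_card_of_injOn (fun j => O.idxOf (M.inv (cyc O j))) ?_ ?_
    · intro j hj
      rw [Finset.mem_coe, Finset.mem_Ico] at hj
      have hmo := Q.inv_mem_outer T (j := j) (by omega) (by omega)
      have hlt := List.idxOf_lt_length_iff.2 hmo
      have hk := cyc_idxOf hmo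
      simp only [Finset.coe_union, Set.mem_union, Finset.mem_coe]
      generalize O.idxOf (M.inv (cyc O j)) = k at hlt hk
      have h0 : c.length ≤ k := by
        by_contra! h0
        exact Q.inv_not_arc hd (by omega) h0 hk.symm
      obtain ⟨h1, h2⟩ := Q.pos_of_inv (by omega) hlt hk.symm
      rw [List.take_append_of_le_length (by omega)] at h1
      rw [List.take_append_of_le_length (i := j) (by omega)] at h2
      by_cases hk1 : k < c.length + s.length
      · exact Or.inl (Or.inl (Finset.mem_Ico.2 ⟨h0, hk1⟩))
      by_cases hk2 : c.length + s.length + a.length ≤ k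
      · exact Or.inl (Or.inr (Finset.mem_Ico.2 ⟨hk2, hlt⟩))
      refine Or.inr (Finset.mem_image.2 ⟨k - (c.length + s.length), ?_, by omega⟩)
      have e : ∀ t ≤ a.length, (c ++ (s ++ (a ++ s'))).take (c.length + s.length + t) =
          c ++ s ++ a.take t := by
        intro t ht
        rw [← List.append_assoc, ← List.length_append, List.take_length_add_append,
          List.take_append_of_le_length ht]
      rw [show k = c.length + s.length + (k - (c.length + s.length)) by omega] at h1 h2
      rw [e _ (by omega)] at h1
      rw [add_assoc _ _ 1, e _ (by omega)] at h2
      rw [Finset.mem_filter, Finset.mem_range, mul_assoc, ← P.elt_append, mul_assoc,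
        ← P.elt_append, ← h1, h2]
      exact ⟨by omega, hmem _ (by omega), hmem _ (by omega)⟩
    · intro i hi j hj hij
      rw [Finset.mem_coe, Finset.mem_Ico] at hi hj
      have h1 := cyc_idxOf (Q.inv_mem_outer T (j := i) (by omega) (by omega))
      have h2 := cyc_idxOf (Q.inv_mem_outer T (j := j) (by omega) (by omega))
      simp only at hij
      rw [hij, h2] at h1
      have h3 := congrArg M.inv h1
      rw [D.isMap.inv_inv _ (Diagram.outer_mem_darts (cyc_mem D.outer_ne _)),
        D.isMap.inv_inv _ (Diagram.outer_mem_darts (cyc_mem D.outer_ne _))] at h3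
      exact (cyc_inj D.outer_nodup (by omega) (by omega) h3).symm
  have h1 := Finset.card_union_le (T1 ∪ T2) T3
  have h2 := Finset.card_union_le T1 T2
  have h3 : T3.card ≤ edgesIn P A (g * P.elt (c ++ s)) a := by
    rw [edgesIn, cnt_eq_card]
    exact Finset.card_image_le
  have h4 : J.card = c.length - 6 * σ - 6 * σ := Nat.card_Ico _ _
  have h5 : T1.card = c.length + s.length - c.length := Nat.card_Ico _ _
  have h6 : T2.card = O.length - (c.length + s.length + a.length) := Nat.card_Ico _ _
  omega

end

/-! ### Relator cycles and quadrilaterals -/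

section

variable {S : Type} {P : C6Presentation S} {M : MapData S P.Grp} {O : List ℕ}
  {F : Multiset (List ℕ)} {b : List ℕ} {c d s a s' : Word S}

theorem mem_relatorCycle {g x : P.Grp} {r : Word S} :
    x ∈ relatorCycle P g r ↔ ∃ i ≤ r.length, x = g * P.elt (r.take i) := by
  constructor
  · rintro ⟨p, hp, rfl⟩
    exact ⟨p.length, hp.length_le, by rw [List.prefix_iff_eq_take.1 hp, List.length_take,
      min_eq_left hp.length_le]⟩
  · rintro ⟨i, -, rfl⟩
    exact ⟨_, List.take_prefix _ _, rfl⟩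

theorem relatorCycle_rotate_subset {g : P.Grp} {u v : Word S} (hr : u ++ v ∈ P.rels) :
    relatorCycle P (g * P.elt u) (v ++ u) ⊆ relatorCycle P g (u ++ v) := by
  have h1 := P.elt_rel hr
  rintro _ ⟨p, hp, rfl⟩
  rcases le_total p.length v.length with hl | hl
  · have hp := List.prefix_of_prefix_length_le hp (List.prefix_append _ _) hl
    exact ⟨u ++ p, (List.prefix_append_right_inj u).2 hp, by rw [P.elt_append, mul_assoc]⟩
  · obtain ⟨t, rfl⟩ := List.prefix_of_prefix_length_le (List.prefix_append _ _) hp hl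
    have ht := (List.prefix_append_right_inj v).1 hp
    refine ⟨t, ht.trans (List.prefix_append _ _), ?_⟩
    rw [P.elt_append] at h1
    rw [P.elt_append, mul_assoc, ← mul_assoc (P.elt u), h1, one_mul]

theorem relatorCycle_wordInv_subset {g : P.Grp} {r : Word S} (hr : r ∈ P.rels) :
    relatorCycle P g (wordInv r) ⊆ relatorCycle P g r := by
  rintro _ ⟨p, ⟨t, ht⟩, rfl⟩
  have e : r = wordInv t ++ wordInv p := by rw [← wordInv_append, ht, wordInv_wordInv]
  refine ⟨wordInv t, ⟨_, e.symm⟩, ?_⟩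
  have h1 := P.elt_rel hr
  rw [e, P.elt_append, P.elt_wordInv p, mul_inv_eq_one] at h1
  rw [h1]

theorem Quad.elt_eq (Q : Quad P c d s a s') : P.elt (wordInv d) = P.elt c := by
  have h := P.elt_rel Q.rel
  rw [P.elt_append] at h
  rw [P.elt_wordInv, eq_comm, eq_inv_iff_mul_eq_one, h]

theorem Quad.swap (Q : Quad P c d s a s') : Quad P (wordInv d) (wordInv c) s a s' where
  rel := by rw [← wordInv_append]; exact P.inv_mem _ Q.rel
  geo_s := Q.geo_s
  geo_a := Q.geo_a
  geo_s' := Q.geo_s'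
  loop := by rw [P.elt_append, Q.elt_eq, ← P.elt_append, Q.loop]
  near := Q.near
  near' := Q.near'

theorem Quad.advance_left {l : S × Bool} {c' s₁ : Word S}
    (Q : Quad P (flipLetter l :: c') d s a (s₁ ++ [l])) :
    Quad P c' (d ++ [flipLetter l]) s a s₁ where
  rel := by
    have := P.rotate_mem _ Q.rel 1
    simpa using this
  geo_s := Q.geo_s
  geo_a := Q.geo_a
  geo_s' := GeoWord.infix (u := []) (by simpa using Q.geo_s')
  loop := by
    have h := Q.loop
    simp only [P.elt_append, P.elt_cons, P.eltL_flip, P.elt_nil, mul_one] at h ⊢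
    have h2 := congrArg (fun g => P.eltL l * g * (P.eltL l)⁻¹) h
    simpa [mul_assoc] using h2
  near := Q.near
  near' j := by
    have h := Q.near' j
    rw [← List.append_assoc, P.elt_append, List.length_append, List.length_singleton] at h
    have h1 := P.len_mul_le (P.elt (a.drop j ++ s₁)) (P.elt [l])
    have h2 := P.len_elt_le [l]
    rw [List.length_singleton] at h2
    omega

theorem Quad.advance_right {l : S × Bool} {c' s₁ : Word S}
    (Q : Quad P (c' ++ [l]) d (flipLetter l :: s₁) a s') :
    Quad P c' (l :: d) s₁ a s' where
  rel := by have := Q.rel; simpa using this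
  geo_s := GeoWord.infix (u := [flipLetter l]) (x := []) (by simpa using Q.geo_s)
  geo_a := Q.geo_a
  geo_s' := Q.geo_s'
  loop := by
    have h := Q.loop
    simpa [P.elt_append, P.eltL_flip, mul_assoc] using h
  near j := by
    have h := Q.near j
    rw [List.cons_append, P.elt_cons, List.length_cons] at h
    have h1 := P.len_mul_le (P.eltL (flipLetter l)) (P.elt (s₁ ++ a.take j))
    have h2 := P.len_elt_le [flipLetter l]
    rw [List.length_singleton, P.elt_cons, P.elt_nil, mul_one] at h2
    omega
  near' := Q.near'

/-- Far from its ends an arc of a relator cycle with ends near `a` runs along `a`. -/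
theorem Quad.length_le {c d s a s' : Word S} (Q : Quad P c d s a s') {g : P.Grp} {A : Set P.Grp}
    (hA : relatorCycle P g (c ++ d) ⊆ A) :
    c.length ≤ edgesIn P A (g * P.elt (c ++ s)) a + 13 * (s.length + s'.length) ∨
    d.length ≤ edgesIn P A (g * P.elt (c ++ s)) a + 13 * (s.length + s'.length) := by
  induction hσ : s.length + s'.length using Nat.strong_induction_on generalizing c d s s' g with
  | _ σ ih =>
  have hA' : relatorCycle P g (wordInv d ++ wordInv c) ⊆ A := by
    rw [← wordInv_append]
    exact (relatorCycle_wordInv_subset Q.rel).trans hA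
  have hloose : ∀ {c d s s' : Word S} {g : P.Grp}, Quad P c d s a s' →
      relatorCycle P g (c ++ d) ⊆ A → s.length + s'.length = σ → ¬ Tight c s s' →
      c.length ≤ edgesIn P A (g * P.elt (c ++ s)) a + 13 * σ ∨
      d.length ≤ edgesIn P A (g * P.elt (c ++ s)) a + 13 * σ := by
    intro c d s s' g Q hA hσ hT
    by_contra hcon
    apply hT
    constructor
    · rintro l c' s₁ rfl rfl
      have := ih _ (by rw [← hσ, List.length_cons]; omega) Q.advance_right
        (by simpa using hA) rfl
      apply hcon
      have e : P.elt (c' ++ [l] ++ flipLetter l :: s₁) = P.elt (c' ++ s₁) := by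
        simp [P.eltL_flip]
      rw [e]
      simp only [List.length_append, List.length_cons, List.length_nil] at this hσ ⊢
      omega
    · rintro l c' s₁ rfl rfl
      have := ih _ (by rw [← hσ, List.length_append, List.length_singleton]; omega) Q.advance_left
        (g := g * P.elt [flipLetter l]) (fun x hx => hA
          (relatorCycle_rotate_subset (u := [flipLetter l]) (v := c' ++ d) Q.rel (by
            rwa [← List.append_assoc] at hx))) rfl
      apply hcon
      have e : g * P.elt (flipLetter l :: c' ++ s) = g * P.elt [flipLetter l] * P.elt (c' ++ s) := by
        simp [mul_assoc]
      rw [e]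
      simp only [List.length_append, List.length_cons, List.length_nil] at this hσ ⊢
      omega
  have ebase : P.elt (wordInv d ++ s) = P.elt (c ++ s) := by
    rw [P.elt_append, Q.elt_eq, P.elt_append]
  by_cases hT : Tight c s s'
  swap
  · exact hloose Q hA hσ hT
  by_cases hT' : Tight (wordInv d) s s'
  swap
  · have := hloose Q.swap hA' hσ hT'
    rw [ebase, length_wordInv, length_wordInv] at this
    exact this.symm
  by_contra! hcon
  have hc : c ≠ [] := by rintro rfl; simp at hcon
  have hd : d ≠ [] := by rintro rfl; simp at hcon
  obtain ⟨l, hl⟩ := List.exists_mem_of_ne_nil c hc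
  have : Nonempty S := ⟨l.1⟩
  obtain ⟨W, hW, hW'⟩ := exists_realizable (P := P) (R₀ := {r ∈ P.rels | r ≠ []})
    (fun r hr => hr.1) (fun r hr => ⟨P.inv_mem r hr.1, by simpa [wordInv_eq_nil] using hr.2⟩)
    (normalClosure_nonempty_rels P ((P.elt_eq_one_iff _).1 Q.loop))
  obtain ⟨M, O, F, D, hO, -, hmin⟩ := exists_diagram (P := P) (R₀ := {r ∈ P.rels | r ≠ []})
    (fun r hr => hr.1) (fun h => h.2 rfl)
    (T := {c ++ (s ++ (a ++ s')), wordInv d ++ (s ++ (a ++ s'))})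
    (by simp [hc, wordInv_eq_nil, hd]) ⟨_, Or.inl rfl, W, hW, hW'⟩
  rcases hO with hO | hO
  · have QD : QuadDiagram M O F c d s a s' :=
      ⟨D, Q, hO, hmin _ (Or.inr rfl), by omega⟩
    have := QD.length_le hT hd hA
    omega
  · have QD : QuadDiagram M O F (wordInv d) (wordInv c) s a s' :=
      ⟨D, Q.swap, hO, by rw [wordInv_wordInv]; exact hmin _ (Or.inl rfl),
        by rw [length_wordInv]; omega⟩
    have := QD.length_le hT' (by simpa [wordInv_eq_nil] using hc) hA'
    rw [ebase, length_wordInv] at this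
    omega

end

/-! ### Geodesics and arcs of relators -/

section

variable {S : Type} {P : C6Presentation S} {c d s a s' : Word S}

/-- Relator cycles are isometrically embedded. -/
theorem len_arc (hr : c ++ d ∈ P.rels) : P.len (P.elt c) = min c.length d.length := by
  apply le_antisymm
  · apply le_min (P.len_elt_le c)
    have h := P.elt_rel hr
    rw [P.elt_append, mul_eq_one_iff_eq_inv] at h
    rw [h, P.len_inv]
    exact P.len_elt_le d
  · obtain ⟨a, ha, ha'⟩ := P.exists_word (P.elt c)⁻¹
    have hg : GeoWord P a := by rw [GeoWord, ha', ha]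
    have Q : Quad P c d [] a [] :=
      ⟨hr, by simp [GeoWord], hg, by simp [GeoWord], by simp [ha'], by simp, by simp⟩
    have := Q.length_le (g := 1) subset_rfl
    have h1 : edgesIn P (relatorCycle P 1 (c ++ d)) (1 * P.elt (c ++ [])) a ≤ a.length := cnt_le _ _
    rw [P.len_inv] at ha
    simp only [List.length_nil, add_zero, mul_zero] at this
    omega

theorem exists_word_of_path (f : ℕ → P.Grp) (n : ℕ) (h : ∀ t < n, P.dst (f t) (f (t + 1)) = 1) :
    ∃ a : Word S, a.length = n ∧ ∀ t ≤ n, f 0 * P.elt (a.take t) = f t := by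
  induction n with
  | zero => exact ⟨[], rfl, fun t ht => by simp [Nat.le_zero.1 ht]⟩
  | succ n ih =>
    obtain ⟨a, ha, ha'⟩ := ih fun t ht => h t (by omega)
    obtain ⟨w, hw, hw'⟩ := P.exists_word_dst (f n) (f (n + 1))
    rw [h n (by omega)] at hw
    refine ⟨a ++ w, by simp [ha, hw], fun t ht => ?_⟩
    rcases Nat.lt_or_ge n t with h1 | h1
    · obtain rfl : t = n + 1 := by omega
      rw [List.take_of_length_le (by simp [ha, hw]), P.elt_append, ← mul_assoc]
      have := ha' n le_rfl
      rw [← ha, List.take_length] at this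
      rw [this, ha, hw']
    · rw [List.take_append_of_le_length (by omega)]
      exact ha' t h1

theorem exists_geoWord_in {α : Set P.Grp} (hα : IsGeodesic P.gens α) {u v : P.Grp} (hu : u ∈ α)
    (hv : v ∈ α) : ∃ a : Word S, GeoWord P a ∧ u * P.elt a = v ∧ ∀ t, u * P.elt (a.take t) ∈ α := by
  obtain ⟨I, γ, hI, hγ, rfl⟩ := hα
  obtain ⟨m, hm, rfl⟩ := hu
  obtain ⟨n, hn, rfl⟩ := hv
  have key : ∀ e : ℤ, (e = 1 ∨ e = -1) → ∀ k : ℕ, n = m + e * k → ∃ a : Word S, GeoWord P a ∧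
      γ m * P.elt a = γ n ∧ ∀ t, γ m * P.elt (a.take t) ∈ γ '' I := by
    intro e he k hk
    have hmem : ∀ t : ℕ, t ≤ k → m + e * t ∈ I := by
      intro t ht
      have ht' : (t : ℤ) ≤ k := by exact_mod_cast ht
      rcases he with rfl | rfl
      · exact hI.out hm hn ⟨by omega, by omega⟩
      · exact hI.out hn hm ⟨by omega, by omega⟩
    have hd : ∀ t t' : ℕ, t ≤ k → t' ≤ k →
        (P.dst (γ (m + e * t)) (γ (m + e * t')) : ℝ) = |(t : ℝ) - t'| := by
      intro t t' ht ht'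
      have := hγ _ (hmem t ht) _ (hmem t' ht')
      rw [P.wdist_eq] at this
      rw [this]
      push_cast
      rw [show (m + e * t - (m + e * t') : ℝ) = e * (t - t') by ring, abs_mul]
      rcases he with rfl | rfl <;> simp
    obtain ⟨a, ha, ha'⟩ := exists_word_of_path (fun t => γ (m + e * t)) k (fun t ht => by
      have := hd t (t + 1) (by omega) (by omega)
      simp only [Nat.cast_add, Nat.cast_one, sub_add_cancel_left, abs_neg, abs_one] at this ⊢
      exact_mod_cast this)
    simp only [Nat.cast_zero, mul_zero, add_zero] at ha'
    have h1 := ha' k le_rfl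
    rw [← ha, List.take_length, ha, ← hk] at h1
    refine ⟨a, ?_, h1, fun t => ?_⟩
    · have h2 := hd 0 k (by omega) le_rfl
      rw [← hk] at h2
      simp only [Nat.cast_zero, mul_zero, add_zero, zero_sub, abs_neg, Nat.abs_cast] at h2
      have h3 : P.dst (γ m) (γ n) = k := by exact_mod_cast h2
      rw [GeoWord, ha, ← h3, C6Presentation.dst, ← h1, inv_mul_cancel_left]
    · rcases le_total t k with ht | ht
      · exact ⟨_, hmem t ht, (ha' t ht).symm⟩
      · rw [List.take_of_length_le (by omega), h1]
        exact ⟨n, hn, rfl⟩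
  rcases le_total m n with h | h
  · exact key 1 (Or.inl rfl) (n - m).toNat (by omega)
  · exact key (-1) (Or.inr rfl) (m - n).toNat (by omega)

theorem exists_nearest {Y : Set P.Grp} (hY : Y.Nonempty) (x : P.Grp) :
    ∃ y ∈ Y, ∀ z ∈ Y, P.dst x y ≤ P.dst x z := by
  obtain ⟨y, hy⟩ := hY
  have h : ∃ n, ∃ y ∈ Y, P.dst x y = n := ⟨_, y, hy, rfl⟩
  classical
  obtain ⟨y, hy, he⟩ := Nat.find_spec h
  exact ⟨y, hy, fun z hz => by rw [he]; exact Nat.find_min' h ⟨z, hz, rfl⟩⟩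

theorem GeoWord.dst_take {a : Word S} (h : GeoWord P a) (u : P.Grp) {i j : ℕ} (hij : i ≤ j)
    (hj : j ≤ a.length) : P.dst (u * P.elt (a.take i)) (u * P.elt (a.take j)) = j - i := by
  have e : a.take j = a.take i ++ (a.take j).drop i := by
    conv_lhs => rw [← List.take_append_drop i (a.take j), List.take_take, min_eq_left hij]
  rw [P.dst_mul_left, e, P.elt_append, C6Presentation.dst, inv_mul_cancel_left]
  have := (h.take j).drop i
  unfold GeoWord at this
  rw [this, List.length_drop, List.length_take, min_eq_left hj]

theorem edgesIn_le {a : Word S} (h : GeoWord P a) {u : P.Grp} {A α : Set P.Grp}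
    (ha : ∀ t, u * P.elt (a.take t) ∈ α) {N : ℕ}
    (hN : ∀ x ∈ A ∩ α, ∀ y ∈ A ∩ α, P.dst x y ≤ N) : edgesIn P A u a ≤ N := by
  classical
  rw [edgesIn, cnt_eq_card]
  set T := (Finset.range a.length).filter
    fun t => u * P.elt (a.take t) ∈ A ∧ u * P.elt (a.take (t + 1)) ∈ A with hT
  rcases T.eq_empty_or_nonempty with h0 | h0
  · rw [h0]; simp
  have m1 := T.min'_mem h0
  have m2 := T.max'_mem h0
  have hsub : T ⊆ Finset.Icc (T.min' h0) (T.max' h0) := fun t ht =>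
    Finset.mem_Icc.2 ⟨T.min'_le t ht, T.le_max' t ht⟩
  have h1 := Finset.card_le_card hsub
  rw [Nat.card_Icc] at h1
  have h2 := T.min'_le_max' h0
  generalize T.min' h0 = i, T.max' h0 = j at m1 m2 h1 h2
  rw [hT, Finset.mem_filter, Finset.mem_range] at m1 m2
  have h3 := hN _ ⟨m1.2.1, ha i⟩ _ ⟨m2.2.2, ha (j + 1)⟩
  rw [h.dst_take u (by omega) (by omega)] at h3
  omega

/-- An arc of a relator cycle with ends close to a geodesic is short. -/
theorem arc_le {α : Set P.Grp} (hα : IsGeodesic P.gens α) {g : P.Grp} (hr : c ++ d ∈ P.rels)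
    {N D : ℕ} (hN : ∀ x ∈ relatorCycle P g (c ++ d) ∩ α, ∀ y ∈ relatorCycle P g (c ++ d) ∩ α,
      P.dst x y ≤ N) {x y : P.Grp} (hx : x ∈ α) (hgx : P.dst g x ≤ D) (hy : y ∈ α)
    (hgy : P.dst (g * P.elt c) y ≤ D) : min c.length d.length ≤ N + 26 * D := by
  obtain ⟨p, hp, hp'⟩ := exists_nearest ⟨x, hx⟩ g
  obtain ⟨q, hq, hq'⟩ := exists_nearest ⟨x, hx⟩ (g * P.elt c)
  obtain ⟨s, hs, hs'⟩ := P.exists_word_dst (g * P.elt c) q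
  obtain ⟨a, ha, ha', haα⟩ := exists_geoWord_in hα hq hp
  obtain ⟨s₂, hs₂, hs₂'⟩ := P.exists_word_dst p g
  have e1 : ∀ t, g * P.elt c * P.elt (s ++ a.take t) = q * P.elt (a.take t) := fun t => by
    rw [P.elt_append, ← mul_assoc, hs']
  have hlen : ∀ (g : P.Grp) (w : Word S), P.dst g (g * P.elt w) = P.len (P.elt w) := fun g w => by
    rw [C6Presentation.dst, inv_mul_cancel_left]
  have Q : Quad P c d s a s₂ := by
    refine ⟨hr, ?_, ha, ?_, ?_, fun j => ?_, fun j => ?_⟩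
    · rw [GeoWord, hs, ← hlen (g * P.elt c), hs']
    · rw [GeoWord, hs₂, ← hlen p, hs₂']
    · simp only [P.elt_append]
      rw [← mul_right_inj g, mul_one, ← mul_assoc, ← mul_assoc, hs', ← mul_assoc, ha', hs₂']
    · rw [← hlen (g * P.elt c), e1, hs]
      exact hq' _ (haα j)
    · have h1 : q * P.elt (a.take j) * P.elt (a.drop j ++ s₂) = g := by
        rw [P.elt_append, ← mul_assoc, mul_assoc q, ← P.elt_append, List.take_append_drop, ha', hs₂']
      rw [← hlen (q * P.elt (a.take j)), h1, hs₂, P.dst_comm p, P.dst_comm _ g]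
      exact hp' _ (haα j)
  have h1 := Q.length_le (g := g) subset_rfl
  have h2 := edgesIn_le (A := relatorCycle P g (c ++ d)) (u := q) ha haα hN
  rw [← hs', mul_assoc, ← P.elt_append] at h2
  have h3 := (hp' x hx).trans hgx
  have h4 := (hq' y hy).trans hgy
  rw [P.dst_comm] at hs₂
  omega

end

/-! ### Fillings and neighbourhoods of geodesics -/

section

variable {S : Type} {P : C6Presentation S} {M : MapData S P.Grp} {O : List ℕ}
  {F : Multiset (List ℕ)} {b : List ℕ}

theorem MapData.IsPath.of_eq {S G G' : Type} {M : MapData S G} {M' : MapData S G'}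
    (h1 : M'.inv = M.inv) (h2 : M'.src = M.src) {a a' : ℕ} {c : List ℕ} (h : M.IsPath a c a') :
    M'.IsPath a c a' := by
  induction c generalizing a with
  | nil => exact h
  | cons d c ih => exact ⟨by rw [h2]; exact h.1, by rw [h1, h2]; exact ih h.2⟩

theorem IsMap.translate {cs : Multiset (List ℕ)} (h : IsMap P M cs) (g : P.Grp) :
    IsMap P (⟨M.inv, M.lab, M.src, fun v => g * M.pos v⟩ : MapData S P.Grp) cs where
  nodup := h.nodup
  inv_mem := h.inv_mem
  inv_inv := h.inv_inv
  inv_ne := h.inv_ne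
  lab_inv := h.lab_inv
  pos_inv d hd := by
    change g * M.pos (M.src (M.inv d)) = g * M.pos (M.src d) * P.eltL (M.lab d)
    rw [h.pos_inv d hd, mul_assoc]
  closed c hc := by
    obtain ⟨a, ha⟩ := h.closed c hc
    exact ⟨a, MapData.IsPath.of_eq (M := M) (by rfl) (by rfl) ha⟩
  exact := h.exact

theorem exists_filling_at {w : Word S} (hw : w ≠ []) (h : P.elt w = 1) (p : P.Grp) :
    ∃ (M : MapData S P.Grp) (O : List ℕ) (F : Multiset (List ℕ)), Diagram P M O F ∧
      O.map M.lab = w ∧ M.pos (M.src (cyc O 0)) = p ∧ ∀ b ∈ F, b.length ≤ 2 * w.length := by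
  obtain ⟨M, O, F, D, hO, hF⟩ := exists_filling hw h
  exact ⟨⟨M.inv, M.lab, M.src, fun v => p * (M.pos (M.src (cyc O 0)))⁻¹ * M.pos v⟩, O, F,
    ⟨D.isMap.translate _, D.outer_ne, D.ne, D.rel, D.mirror⟩, hO, by simp, hF⟩

theorem Diagram.sum_extCount_le (D : Diagram P M O F) : (F.map (extCount M O)).sum ≤ O.length := by
  set h : ℕ → ℕ := fun x => ind (M.inv x ∈ O) with hh
  have h1 : F.map (extCount M O) = F.map fun b => (b.map h).sum := by
    refine Multiset.map_congr rfl fun b _ => ?_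
    rw [sum_map_eq_sum_cyc]
    rfl
  have hn : (darts F).Nodup := by
    have := D.nodup
    rw [darts_cons, Multiset.nodup_add] at this
    exact this.2.1
  have hmem : ∀ d ∈ darts F, d ∈ darts (O ::ₘ F) := fun d hd => by
    rw [darts_cons, Multiset.mem_add]; exact Or.inr hd
  have h2 : ((darts F).map h).sum = ∑ x ∈ (darts F).toFinset, h x := by
    rw [Finset.sum, Multiset.toFinset_val, hn.dedup]
  have h3 : ∑ x ∈ (darts F).toFinset, h x =
      ((darts F).toFinset.filter fun x => M.inv x ∈ O).card := by
    rw [Finset.card_filter]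
    refine Finset.sum_congr rfl fun x _ => ?_
    by_cases hx : M.inv x ∈ O
    · rw [if_pos hx]; exact ind_pos hx
    · rw [if_neg hx]; exact ind_neg hx
  rw [h1, ← sum_map_darts, h2, h3]
  refine le_trans (Finset.card_le_card_of_injOn (t := O.toFinset) M.inv ?_ ?_)
    (List.toFinset_card_le O)
  · intro x hx
    simpa using (Finset.mem_filter.1 hx).2
  · intro x hx y hy hxy
    have hx := hmem _ (Multiset.mem_toFinset.1 (Finset.mem_filter.1 hx).1)
    have hy := hmem _ (Multiset.mem_toFinset.1 (Finset.mem_filter.1 hy).1)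
    rw [← D.isMap.inv_inv _ hx, hxy, D.isMap.inv_inv _ hy]

theorem IsMap.pos_cyc_rotate {cs : Multiset (List ℕ)} (h : IsMap P M cs) (hb : b ∈ cs)
    (hne : b ≠ []) (i : ℕ) {t : ℕ} (ht : t ≤ b.length) :
    M.pos (M.src (cyc b (i + t))) =
      M.pos (M.src (cyc b i)) * P.elt (((b.map M.lab).rotate i).take t) := by
  induction t with
  | zero => simp
  | succ t ih =>
    have ht' : t < ((b.map M.lab).rotate i).length := by simpa using ht
    rw [← add_assoc, h.pos_cyc hb hne, ih (by omega), ← List.take_append_getElem ht',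
      P.elt_append, mul_assoc, getElem_rotate_map]
    simp

theorem Diagram.exists_cyc_add (D : Diagram P M O F) (hb : b ∈ F) (i j : ℕ) :
    ∃ t < b.length, cyc b j = cyc b (i + t) := by
  have hL := List.length_pos_of_ne_nil (D.ne b hb)
  refine ⟨(j + (b.length - i % b.length)) % b.length, Nat.mod_lt _ hL, ?_⟩
  rw [cyc_eq_iff (D.face_nodup hb) (D.ne b hb)]
  have h1 := Nat.mod_lt i hL
  have h2 := Nat.mod_add_div i b.length
  rw [Nat.add_mod_mod, ← Nat.add_mod_right j]
  conv_lhs => rw [← Nat.add_mul_mod_self_left _ _ (i / b.length)]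
  congr 1
  omega

theorem Diagram.dst_face_le (D : Diagram P M O F) (hb : b ∈ F) (i j : ℕ) :
    P.dst (M.pos (M.src (cyc b i))) (M.pos (M.src (cyc b j))) ≤ b.length := by
  obtain ⟨t, ht, hj⟩ := D.exists_cyc_add hb i j
  rw [hj, D.isMap.pos_cyc_rotate (Multiset.mem_cons_of_mem hb) (D.ne b hb) i ht.le]
  refine (P.dst_mul_elt_le _ _).trans ?_
  rw [List.length_take]
  omega

/-- The intersection of relator cycles of length at most `n` with `α` has diameter at most `N n`. -/
def MeetsIn (P : C6Presentation S) (α : Set P.Grp) (N : ℕ → ℕ) : Prop :=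
  ∀ g, ∀ r ∈ P.rels, ∀ n, r.length ≤ n →
    ∀ x ∈ relatorCycle P g r ∩ α, ∀ y ∈ relatorCycle P g r ∩ α, P.dst x y ≤ N n

/-- The closed `n`-neighbourhood of `α`. -/
def nhd (P : C6Presentation S) (α : Set P.Grp) (n : ℕ) : Set P.Grp := {x | ∃ y ∈ α, P.dst x y ≤ n}

theorem cnt_le_of_circle {p : ℕ → Prop} {L B : ℕ} (h : ∀ t < L, p t → min t (L - t) ≤ B) :
    cnt p L ≤ 2 * B + 1 := by
  classical
  rw [cnt_eq_card]
  have : (Finset.range L).filter p ⊆ Finset.Icc 0 B ∪ Finset.Ico (L - B) L := by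
    intro t ht
    rw [Finset.mem_filter, Finset.mem_range] at ht
    have := h t ht.1 ht.2
    rw [Finset.mem_union, Finset.mem_Icc, Finset.mem_Ico]
    omega
  refine (Finset.card_le_card this).trans ((Finset.card_union_le _ _).trans ?_)
  rw [Nat.card_Icc, Nat.card_Ico]
  omega

theorem Diagram.cnt_nhd_le (D : Diagram P M O F) {α : Set P.Grp} (hα : IsGeodesic P.gens α)
    {N : ℕ → ℕ} (hN : MeetsIn P α N) (hb : b ∈ F) (m : ℕ) {n : ℕ} (hn : b.length ≤ n) :
    cnt (fun i => M.pos (M.src (cyc b i)) ∈ nhd P α m) b.length ≤ 2 * (N n + 26 * m) + 1 := by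
  rcases Nat.eq_zero_or_pos (cnt (fun i => M.pos (M.src (cyc b i)) ∈ nhd P α m) b.length) with h0 | h0
  · omega
  obtain ⟨i, -, y, hy, hiy⟩ := exists_of_cnt_pos h0
  rw [← cnt_add_of_periodic (fun i => by rw [cyc_add_length]) i]
  refine cnt_le_of_circle fun t ht ⟨x, hx, htx⟩ => ?_
  have hbF := (Multiset.mem_cons_of_mem hb : b ∈ O ::ₘ F)
  rw [D.isMap.pos_cyc_rotate hbF (D.ne b hb) i ht.le] at htx
  have hr := P.rotate_mem _ (D.rel b hb) i
  set r := (b.map M.lab).rotate i with hr_def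
  have hlen : r.length = b.length := by simp [hr_def]
  have e : r.take t ++ r.drop t = r := List.take_append_drop t r
  have := arc_le hα (g := M.pos (M.src (cyc b i))) (by rw [e]; exact hr)
    (by rw [e]; exact hN _ r hr n (by omega)) hy hiy hx htx
  rw [List.length_take, List.length_drop, hlen, min_eq_left ht.le] at this
  exact this

end

/-! ### Flux through faces -/

section

variable {S : Type} {P : C6Presentation S} {M : MapData S P.Grp} {O : List ℕ}
  {F : Multiset (List ℕ)} {b : List ℕ}

open Classical in
/-- The differential of `f`, cut off outside `U`. -/
noncomputable def flux (M : MapData S P.Grp) (U : Set P.Grp) (f : P.Grp → ℤ) (d : ℕ) : ℤ :=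
  if M.pos (M.src d) ∈ U ∧ M.pos (M.src (M.inv d)) ∈ U then
    f (M.pos (M.src (M.inv d))) - f (M.pos (M.src d)) else 0

variable {U : Set P.Grp} {f : P.Grp → ℤ}

theorem flux_inv {cs : Multiset (List ℕ)} (h : IsMap P M cs) {d : ℕ} (hd : d ∈ darts cs) :
    flux M U f (M.inv d) = - flux M U f d := by
  unfold flux
  rw [h.inv_inv d hd]
  by_cases hU : M.pos (M.src d) ∈ U ∧ M.pos (M.src (M.inv d)) ∈ U
  · rw [if_pos hU, if_pos hU.symm]; ring
  · rw [if_neg hU, if_neg fun h => hU h.symm]; rfl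

theorem Diagram.sum_flux (D : Diagram P M O F) :
    (O.map (flux M U f)).sum + (F.map fun b => (b.map (flux M U f)).sum).sum = 0 := by
  have h := D.isMap.sum_darts_eq_zero (ω := fun d => (flux M U f d : ℚ)) (fun d hd => by
    rw [flux_inv D.isMap hd]; push_cast; rfl)
  have e : ∀ c : List ℕ, (c.map fun d => (flux M U f d : ℚ)).sum = (((c.map (flux M U f)).sum : ℤ) : ℚ) := by
    intro c
    rw [Int.cast_list_sum, List.map_map]
    rfl
  simp only [e] at h
  rw [Multiset.map_cons, Multiset.sum_cons] at h
  have e2 : (F.map fun c => (((c.map (flux M U f)).sum : ℤ) : ℚ)).sum =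
      (((F.map fun c => (c.map (flux M U f)).sum).sum : ℤ) : ℚ) := by
    rw [Int.cast_multiset_sum, Multiset.map_map]
    rfl
  rw [e2] at h
  exact_mod_cast h

theorem IsMap.src_inv_cyc {cs : Multiset (List ℕ)} (h : IsMap P M cs) (hb : b ∈ cs) (hne : b ≠ [])
    (i : ℕ) : M.src (M.inv (cyc b i)) = M.src (cyc b (i + 1)) := by
  have hd : cyc b i ∈ darts cs := GSC.mem_darts.2 ⟨b, hb, cyc_mem hne i⟩
  rw [← h.src_nxt hd, nxt_cyc h.nodup hb hne]

theorem sum_flux_eq_zero {cs : Multiset (List ℕ)} (h : IsMap P M cs) (hb : b ∈ cs) (hne : b ≠ [])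
    (hU : ∀ i, M.pos (M.src (cyc b i)) ∈ U) : (b.map (flux M U f)).sum = 0 := by
  rw [sum_map_eq_sum_cyc]
  have e : ∀ i ∈ Finset.range b.length, flux M U f (cyc b i) =
      f (M.pos (M.src (cyc b (i + 1)))) - f (M.pos (M.src (cyc b i))) := fun i _ => by
    unfold flux
    rw [h.src_inv_cyc hb hne, if_pos ⟨hU _, hU _⟩]
  rw [Finset.sum_congr rfl e, Finset.sum_sub_distrib, sum_cyc_succ b fun d => f (M.pos (M.src d)),
    sub_self]

theorem abs_flux_le {cs : Multiset (List ℕ)} (h : IsMap P M cs)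
    (hf : ∀ x y, |f x - f y| ≤ P.dst x y) {d : ℕ} (hd : d ∈ darts cs) :
    |flux M U f d| ≤ ind (M.pos (M.src d) ∈ U) := by
  unfold flux
  split_ifs with hU
  · rw [ind_pos hU.1, h.pos_inv d hd, abs_sub_comm]
    refine (hf _ _).trans ?_
    have := P.dst_mul_elt_le (M.pos (M.src d)) [M.lab d]
    rw [P.elt_cons, P.elt_nil, mul_one, List.length_singleton] at this
    exact_mod_cast this
  · simp

theorem abs_sum_flux_le {cs : Multiset (List ℕ)} (h : IsMap P M cs) (hb : b ∈ cs) (hne : b ≠ [])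
    (hf : ∀ x y, |f x - f y| ≤ P.dst x y) :
    |(b.map (flux M U f)).sum| ≤ cnt (fun i => M.pos (M.src (cyc b i)) ∈ U) b.length := by
  rw [sum_map_eq_sum_cyc, cnt, Nat.cast_sum]
  refine (Finset.abs_sum_le_sum_abs _ _).trans (Finset.sum_le_sum fun i _ => ?_)
  exact abs_flux_le h hf (GSC.mem_darts.2 ⟨b, hb, cyc_mem hne i⟩)

theorem exists_flux_ne_zero (hs : (b.map (flux M U f)).sum ≠ 0) : ∃ i, flux M U f (cyc b i) ≠ 0 := by
  rw [sum_map_eq_sum_cyc] at hs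
  obtain ⟨i, -, hi⟩ := Finset.exists_ne_zero_of_sum_ne_zero hs
  exact ⟨i, hi⟩

/-- The distance from `p`, clamped to `[A, 2 * A]`. -/
noncomputable def clampDst (P : C6Presentation S) (p : P.Grp) (A : ℕ) (x : P.Grp) : ℤ :=
  max A (min (P.dst p x) (2 * A))

theorem abs_clampDst_sub_le (p : P.Grp) (A : ℕ) (x y : P.Grp) :
    |clampDst P p A x - clampDst P p A y| ≤ P.dst x y := by
  have h1 := P.dst_triangle p x y
  have h2 := P.dst_triangle p y x
  rw [P.dst_comm y x] at h2
  unfold clampDst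
  rw [abs_le]
  omega

end

/-! ### Faces with nonzero flux -/

section

variable {S : Type} {P : C6Presentation S} {M : MapData S P.Grp} {O : List ℕ}
  {F : Multiset (List ℕ)} {b : List ℕ}

theorem clampDst_eq {p x y : P.Grp} {A : ℕ} (hA : 1 ≤ A) (hxy : P.dst x y ≤ 1)
    (hy : ¬ (A ≤ P.dst p y ∧ P.dst p y ≤ 2 * A)) :
    clampDst P p A x = clampDst P p A y := by
  have h1 := P.dst_triangle p x y
  have h2 := P.dst_triangle p y x
  rw [P.dst_comm y x] at h2
  unfold clampDst
  omega

theorem IsMap.dst_src_inv_le {cs : Multiset (List ℕ)} (h : IsMap P M cs) {d : ℕ}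
    (hd : d ∈ darts cs) : P.dst (M.pos (M.src d)) (M.pos (M.src (M.inv d))) ≤ 1 := by
  rw [h.pos_inv d hd]
  have := P.dst_mul_elt_le (M.pos (M.src d)) [M.lab d]
  rwa [P.elt_cons, P.elt_nil, mul_one, List.length_singleton] at this

/-- If the flux of the clamped distance through a face is nonzero and the face is more than a third
exterior, then a long part of the face lies on the boundary. -/
theorem Diagram.le_extCount_of_flux (D : Diagram P M O F) {α : Set P.Grp}
    (hα : IsGeodesic P.gens α) {N : ℕ → ℕ} (hN : MeetsIn P α N) {D₀ : ℕ} (hD₀ : 12 ≤ D₀)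
    (hT : ∀ L, D₀ ≤ L → 24 * N L ≤ L) {A n : ℕ} (hA : 1 ≤ A) {p : P.Grp}
    (hαO : ∀ j ≤ n, M.pos (M.src (cyc O j)) ∈ α)
    (hside : ∀ j, n ≤ j → j ≤ O.length → ∀ z ∈ nhd P α D₀, A ≤ P.dst p z → P.dst p z ≤ 2 * A →
      A ≤ D₀ + 2 * P.dst (M.pos (M.src (cyc O j))) z)
    (hb : b ∈ F) (hs : (b.map (flux M (nhd P α D₀) (clampDst P p A))).sum ≠ 0)
    (hgood : b.length < 3 * extCount M O b) : A ≤ D₀ + 12 * extCount M O b := by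
  have hbF := (Multiset.mem_cons_of_mem hb : b ∈ O ::ₘ F)
  have hne := D.ne b hb
  have hdart : ∀ i, cyc b i ∈ darts (O ::ₘ F) := fun i => GSC.mem_darts.2 ⟨b, hbF, cyc_mem hne i⟩
  set near : ℕ → Prop := fun i => Ext M O b i ∧ O.idxOf (M.inv (cyc b i)) < n with hnear
  have hmem : ∀ i, near i → M.pos (M.src (cyc b i)) ∈ α := by
    rintro i ⟨hi, hj⟩
    have h1 := hαO _ (Nat.succ_le_of_lt hj)
    rw [← D.isMap.src_inv_cyc (Multiset.mem_cons_self _ _) D.outer_ne, cyc_idxOf hi,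
      D.isMap.inv_inv _ (hdart i)] at h1
    exact h1
  have hcnt : cnt near b.length ≤ 2 * N b.length + 1 := by
    have h1 := D.cnt_nhd_le hα hN hb 0 le_rfl
    refine le_trans (Finset.sum_le_sum fun i _ => ind_mono fun h => ?_) h1
    exact ⟨_, hmem i h, by rw [P.dst_self]⟩
  have hsplit : extCount M O b = cnt near b.length + cnt (fun i => Ext M O b i ∧ ¬ near i) b.length := by
    unfold extCount cnt
    rw [← Finset.sum_add_distrib]
    exact Finset.sum_congr rfl fun i _ => ind_eq_add fun h => h.1
  have hfar : 6 * cnt near b.length < b.length := by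
    by_contra! hle
    have hL : b.length ≤ D₀ := by
      by_contra! h
      have := hT _ h.le
      omega
    have hpos : 0 < cnt near b.length := by
      have := List.length_pos_of_ne_nil hne
      omega
    obtain ⟨i, -, hi⟩ := exists_of_cnt_pos hpos
    exact hs (sum_flux_eq_zero D.isMap hbF hne fun j =>
      ⟨_, hmem i hi, (D.dst_face_le hb j i).trans hL⟩)
  have hpos : 0 < cnt (fun i => Ext M O b i ∧ ¬ near i) b.length := by omega
  obtain ⟨i, -, hi, hi'⟩ := exists_of_cnt_pos hpos
  have hj : n ≤ O.idxOf (M.inv (cyc b i)) := by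
    by_contra! h
    exact hi' ⟨hi, h⟩
  obtain ⟨k, hk⟩ := exists_flux_ne_zero hs
  have hz : ∃ z ∈ nhd P α D₀, (A ≤ P.dst p z ∧ P.dst p z ≤ 2 * A) ∧
      ∃ t, z = M.pos (M.src (cyc b t)) := by
    unfold flux at hk
    split_ifs at hk with hU
    · by_contra! hno
      have hz2 := fun h => hno _ hU.2 h (k + 1) (by rw [D.isMap.src_inv_cyc hbF hne])
      exact hk (sub_eq_zero.2 (clampDst_eq hA (D.isMap.dst_src_inv_le (hdart k)) hz2).symm)
    · exact absurd rfl hk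
  obtain ⟨z, hzU, ⟨hz1, hz2⟩, t, rfl⟩ := hz
  have h1 := hside _ hj (List.idxOf_lt_length_of_mem hi).le _ hzU hz1 hz2
  rw [cyc_idxOf hi, D.isMap.src_inv_cyc hbF hne] at h1
  have h2 := D.dst_face_le hb (i + 1) t
  omega

theorem Diagram.outer_flux_eq (D : Diagram P M O F) {α : Set P.Grp} {D₀ : ℕ}
    {A n : ℕ} (hA : D₀ < A) {p : P.Grp} (hn : n ≤ O.length)
    (hαO : ∀ j ≤ n, M.pos (M.src (cyc O j)) ∈ α) (hp : M.pos (M.src (cyc O 0)) = p)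
    (hpn : 2 * A ≤ P.dst p (M.pos (M.src (cyc O n))))
    (hside : ∀ j, n ≤ j → j ≤ O.length → ∀ z ∈ nhd P α D₀, A ≤ P.dst p z → P.dst p z ≤ 2 * A →
      A ≤ D₀ + 2 * P.dst (M.pos (M.src (cyc O j))) z) :
    (O.map (flux M (nhd P α D₀) (clampDst P p A))).sum = A := by
  have hO := (Multiset.mem_cons_self O F)
  have hdart : ∀ i, cyc O i ∈ darts (O ::ₘ F) := fun i =>
    GSC.mem_darts.2 ⟨O, hO, cyc_mem D.outer_ne i⟩
  have hU : ∀ j ≤ n, M.pos (M.src (cyc O j)) ∈ nhd P α D₀ := fun j hj =>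
    ⟨_, hαO j hj, by rw [P.dst_self]; omega⟩
  have hnot : ∀ j, n ≤ j → j ≤ O.length → M.pos (M.src (cyc O j)) ∈ nhd P α D₀ →
      ¬ (A ≤ P.dst p (M.pos (M.src (cyc O j))) ∧ P.dst p (M.pos (M.src (cyc O j))) ≤ 2 * A) := by
    rintro j hj hj' hjU ⟨h1, h2⟩
    have := hside j hj hj' _ hjU h1 h2
    rw [P.dst_self] at this
    omega
  rw [sum_map_eq_sum_cyc, ← Finset.sum_range_add_sum_Ico _ hn]
  have e1 : ∀ i ∈ Finset.range n, flux M (nhd P α D₀) (clampDst P p A) (cyc O i) =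
      clampDst P p A (M.pos (M.src (cyc O (i + 1)))) - clampDst P p A (M.pos (M.src (cyc O i))) := by
    intro i hi
    rw [Finset.mem_range] at hi
    unfold flux
    rw [D.isMap.src_inv_cyc hO D.outer_ne, if_pos ⟨hU i hi.le, hU (i + 1) hi⟩]
  have e2 : ∀ i ∈ Finset.Ico n O.length, flux M (nhd P α D₀) (clampDst P p A) (cyc O i) = 0 := by
    intro i hi
    rw [Finset.mem_Ico] at hi
    have hd := D.isMap.dst_src_inv_le (hdart i)
    unfold flux
    rw [D.isMap.src_inv_cyc hO D.outer_ne] at hd ⊢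
    split_ifs with h
    · rw [sub_eq_zero]
      exact (clampDst_eq (by omega) hd
        (hnot (i + 1) (by omega) hi.2 h.2)).symm
    · rfl
  rw [Finset.sum_congr rfl e1, Finset.sum_eq_zero e2,
    Finset.sum_range_sub fun i => clampDst P p A (M.pos (M.src (cyc O i))), hp]
  unfold clampDst
  rw [P.dst_self]
  omega

theorem Diagram.sq_le_of_flux (D : Diagram P M O F) {α : Set P.Grp}
    (hα : IsGeodesic P.gens α) {N : ℕ → ℕ} (hN : MeetsIn P α N) {D₀ : ℕ} (hD₀ : 12 ≤ D₀)
    (hT : ∀ L, D₀ ≤ L → 24 * N L ≤ L) {A n l : ℕ} (hA : 2 * D₀ ≤ A) {p : P.Grp}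
    (hn : n ≤ O.length)
    (hαO : ∀ j ≤ n, M.pos (M.src (cyc O j)) ∈ α) (hp : M.pos (M.src (cyc O 0)) = p)
    (hpn : 2 * A ≤ P.dst p (M.pos (M.src (cyc O n))))
    (hside : ∀ j, n ≤ j → j ≤ O.length → ∀ z ∈ nhd P α D₀, A ≤ P.dst p z → P.dst p z ≤ 2 * A →
      A ≤ D₀ + 2 * P.dst (M.pos (M.src (cyc O j))) z)
    (hbad : (F.map fun b => ind (3 * extCount M O b ≤ b.length)).sum ≤ 12)
    (hl : ∀ b ∈ F, b.length ≤ l) :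
    A * A ≤ (2 * (N l + 26 * D₀) + 1) * (12 * A + 24 * O.length) := by
  set B := 2 * (N l + 26 * D₀) + 1
  have h0 := D.sum_flux (U := nhd P α D₀) (f := clampDst P p A)
  rw [D.outer_flux_eq (by omega) hn hαO hp hpn hside] at h0
  have hface : ∀ b ∈ F, (A : ℤ) * -(b.map (flux M (nhd P α D₀) (clampDst P p A))).sum ≤
      ((B * (A * ind (3 * extCount M O b ≤ b.length) + 24 * extCount M O b) : ℕ) : ℤ) := by
    intro b hb
    rcases eq_or_ne (b.map (flux M (nhd P α D₀) (clampDst P p A))).sum 0 with hs | hs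
    · rw [hs]; simp only [neg_zero, mul_zero]; positivity
    have h1 := abs_sum_flux_le (U := nhd P α D₀) D.isMap (Multiset.mem_cons_of_mem hb) (D.ne b hb)
      (abs_clampDst_sub_le p A)
    have h2 := D.cnt_nhd_le hα hN hb D₀ (hl b hb)
    have h3 : -(b.map (flux M (nhd P α D₀) (clampDst P p A))).sum ≤ B :=
      (neg_le_abs _).trans (h1.trans (by exact_mod_cast h2))
    have h4 : A ≤ A * ind (3 * extCount M O b ≤ b.length) + 24 * extCount M O b := by
      by_cases hg : 3 * extCount M O b ≤ b.length
      · rw [ind_pos hg]; omega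
      · have := D.le_extCount_of_flux hα hN hD₀ hT (by omega) hαO hside hb hs (by omega)
        rw [ind_neg hg]
        omega
    calc (A : ℤ) * -(b.map (flux M (nhd P α D₀) (clampDst P p A))).sum
        ≤ (A : ℤ) * B := mul_le_mul_of_nonneg_left h3 (by positivity)
      _ = B * A := mul_comm _ _
      _ ≤ _ := by exact_mod_cast Nat.mul_le_mul_left B h4
  have h5 : (A : ℤ) * A = (F.map fun b => (A : ℤ) *
      -(b.map (flux M (nhd P α D₀) (clampDst P p A))).sum).sum := by
    rw [Multiset.sum_map_mul_left, Multiset.sum_map_neg]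
    rw [eq_neg_of_add_eq_zero_left h0]
  have h6 := Multiset.sum_map_le_sum_map _ _ hface
  rw [← h5] at h6
  have h7 : (F.map fun b => ((B * (A * ind (3 * extCount M O b ≤ b.length) +
      24 * extCount M O b) : ℕ) : ℤ)).sum = ((B * (A * (F.map fun b =>
      ind (3 * extCount M O b ≤ b.length)).sum + 24 * (F.map (extCount M O)).sum) : ℕ) : ℤ) := by
    rw [← Multiset.sum_map_mul_left, ← Multiset.sum_map_mul_left, ← Multiset.sum_map_add,
      ← Multiset.sum_map_mul_left, Nat.cast_multiset_sum, Multiset.map_map]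
    rfl
  rw [h7] at h6
  have h8 := D.sum_extCount_le
  have h9 : A * A ≤ B * (A * (F.map fun b => ind (3 * extCount M O b ≤ b.length)).sum +
      24 * (F.map (extCount M O)).sum) := by exact_mod_cast h6
  refine h9.trans (Nat.mul_le_mul_left B ?_)
  have := Nat.mul_le_mul_left A hbad
  omega

end

/-! ### Piecewise geodesic boundaries -/

section

variable {S : Type} {P : C6Presentation S} {M : MapData S P.Grp} {O : List ℕ}
  {F : Multiset (List ℕ)} {b : List ℕ}

/-- Between two consecutive places in `K`, the word `w` is geodesic. -/
def GeoAway (P : C6Presentation S) (K : ℕ → Prop) (w : Word S) : Prop :=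
  ∀ p k, 1 ≤ k → p + k ≤ w.length → (∀ j, p < j → j < p + k → ¬ K j) →
    GeoWord P ((w.drop p).take k)

theorem GeoWord.geoAway {w : Word S} (h : GeoWord P w) (K : ℕ → Prop) : GeoAway P K w :=
  fun p k _ _ _ => (h.drop p).take k

theorem GeoWord.append_geoAway {u v : Word S} {K : ℕ → Prop} (hu : GeoWord P u)
    (hv : GeoAway P (fun j => K (u.length + j)) v) (hK : K u.length) : GeoAway P K (u ++ v) := by
  intro p k hk hpk hno
  rw [List.length_append] at hpk
  rcases le_or_gt (p + k) u.length with h | h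
  · rw [List.drop_append_of_le_length (by omega),
      List.take_append_of_le_length (by rw [List.length_drop]; omega)]
    exact (hu.drop p).take k
  · have hp : u.length ≤ p := by
      by_contra! hlt
      exact hno _ hlt h hK
    rw [List.drop_append, List.drop_eq_nil_of_le hp, List.nil_append]
    refine hv _ _ hk (by omega) fun j hj hj' => hno _ (by omega) (by omega)

theorem Diagram.card_bad_le_of_geoAway (D : Diagram P M O F) {K : ℕ → Prop} (hK : K 0)
    (h : GeoAway P K (O.map M.lab)) :
    12 + (F.map fun b => ind (3 * extCount M O b ≤ b.length)).sum ≤ 6 * cnt K O.length := by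
  refine D.card_bad_le hK (fun r hr p k hk hkr hpk he hno => ?_) fun j hj he => ?_
  · exact two_mul_le_of_geoWord (u := []) (x := []) hr (by simpa using h p k hk hpk hno) hkr he
  · by_contra hno
    have h1 := h j 2 (by omega) (by omega) fun i hi hi' => by
      obtain rfl : i = j + 1 := by omega
      exact hno
    refine h1.not_cancelAt 0 ⟨(O.map M.lab)[j], ?_, ?_⟩
    · rw [List.getElem?_take_of_lt (by omega), List.getElem?_drop, List.getElem?_eq_getElem]
      rfl
    · rw [List.getElem?_take_of_lt (by omega), List.getElem?_drop, ← he]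
      exact List.getElem?_eq_getElem hj

theorem cnt_mem_le (s : Finset ℕ) (n : ℕ) : cnt (fun j => j ∈ s) n ≤ s.card := by
  rw [cnt_eq_card]
  exact Finset.card_le_card fun j hj => (Finset.mem_filter.1 hj).2

theorem Diagram.card_bad_le_of_quad (D : Diagram P M O F) {u₁ u₂ u₃ u₄ : Word S}
    (h₁ : GeoWord P u₁) (h₂ : GeoWord P u₂) (h₃ : GeoWord P u₃) (h₄ : GeoWord P u₄)
    (hO : O.map M.lab = u₁ ++ (u₂ ++ (u₃ ++ u₄))) :
    (F.map fun b => ind (3 * extCount M O b ≤ b.length)).sum ≤ 12 := by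
  set s : Finset ℕ := {0, u₁.length, u₁.length + u₂.length,
    u₁.length + (u₂.length + u₃.length)} with hs
  have h := D.card_bad_le_of_geoAway (K := fun j => j ∈ s) (by simp [hs]) (by
    rw [hO]
    exact h₁.append_geoAway (h₂.append_geoAway (h₃.append_geoAway (h₄.geoAway _) (by simp [hs]))
      (by simp [hs])) (by simp [hs]))
  have h1 := cnt_mem_le s O.length
  have h2 : s.card ≤ 4 := Finset.card_le_four
  omega

theorem dst_le_of_between {Y : Set P.Grp} {x z p : P.Grp} (hz : P.dst x z + P.dst z p ≤ P.dst x p)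
    (hx : ∀ u ∈ Y, P.dst x p ≤ P.dst x u) : ∀ u ∈ Y, P.dst z p ≤ P.dst z u := by
  intro u hu
  have h1 := hx u hu
  have h2 := P.dst_triangle x z u
  omega

end

/-! ### Contraction of projections -/

section

variable {S : Type} {P : C6Presentation S}

/-- `N` grows sublinearly. -/
def NatSublinear (N : ℕ → ℕ) : Prop := ∀ k, ∃ T, ∀ L, T ≤ L → k * N L ≤ L

/-- Nearest-point projections to a geodesic meeting relators sublinearly are strongly contracting in
the sublinear sense. -/
theorem contraction {α : Set P.Grp} (hα : IsGeodesic P.gens α) {N : ℕ → ℕ} (hN : MeetsIn P α N)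
    (hsub : NatSublinear N) (k : ℕ) :
    ∃ R₀, ∀ x x' p p', p ∈ α → p' ∈ α → (∀ u ∈ α, P.dst x p ≤ P.dst x u) →
      (∀ u ∈ α, P.dst x' p' ≤ P.dst x' u) → R₀ ≤ P.dst x p → 10 * P.dst x x' ≤ P.dst x p →
      k * P.dst p p' ≤ P.dst x p := by
  obtain ⟨T, hT⟩ := hsub 24
  set D₀ := max T 12 with hD₀
  set c := 4 + 12 * k with hc
  set m := 12 + 24 * c with hm
  obtain ⟨T', hT'⟩ := hsub (8 * c * m)
  set A₀ := 2 + 2 * D₀ + T' + 2 * ((52 * D₀ + 1) * m) with hA₀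
  refine ⟨k * (3 * A₀), fun x x' p p' hp hp' hx hx' hR he => ?_⟩
  by_contra! hlt
  set n := P.dst p p' with hn
  set A := n / 3 with hA
  have hnA : 3 * A₀ < n := lt_of_mul_lt_mul_left' (hR.trans_lt hlt)
  have hAA : A₀ ≤ A := by omega
  obtain ⟨a, ha, hae, haα⟩ := exists_geoWord_in hα hp hp'
  obtain ⟨v', hv'l, hv'e⟩ := P.exists_word_dst p' x'
  obtain ⟨β, hβl, hβe⟩ := P.exists_word_dst x' x
  obtain ⟨v, hvl, hve⟩ := P.exists_word_dst x p
  have geo : ∀ {g h : P.Grp} {w : Word S}, w.length = P.dst g h → g * P.elt w = h → GeoWord P w := by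
    intro g h w h1 h2
    rw [GeoWord, h1, ← h2, C6Presentation.dst, inv_mul_cancel_left]
  have hv' := geo hv'l hv'e
  have hβ := geo hβl hβe
  have hv := geo hvl hve
  have hal : a.length = n := by
    have := ha.dst_take p (Nat.zero_le _) le_rfl
    rw [List.take_length, hae, List.take_zero, P.elt_nil, mul_one] at this
    omega
  set w := a ++ (v' ++ (β ++ v)) with hw
  have hwlen : w.length = n + (v'.length + (β.length + v.length)) := by simp [hw, hal]
  have hw1 : P.elt w = 1 := by
    have : p * P.elt w = p := by
      simp only [hw, P.elt_append, ← mul_assoc, hae, hv'e, hβe, hve]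
    simpa using this
  obtain ⟨M, O, F, D, hO, hpos, hF⟩ := exists_filling_at (by
    intro h; rw [h, List.length_nil] at hwlen; omega) hw1 p
  have hOl : O.length = w.length := by rw [← hO, List.length_map]
  have hposj : ∀ j ≤ O.length, M.pos (M.src (cyc O j)) = p * P.elt (w.take j) := fun j hj => by
    rw [D.isMap.pos_cyc_take (Multiset.mem_cons_self _ _) D.outer_ne hj, hpos, hO]
  have htri1 := P.dst_triangle p x p'
  have htri2 := P.dst_triangle x x' p'
  have htri3 := P.dst_triangle x' x p
  have hx'p := hx' p hp
  rw [P.dst_comm p x] at htri1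
  rw [P.dst_comm x' x] at htri3 hβl
  rw [P.dst_comm p' x'] at hv'l
  have hwk : w.length ≤ c * A := by
    have : k * n ≤ k * (4 * A) := Nat.mul_le_mul_left k (by omega)
    rw [hc]
    have e : (4 + 12 * k) * A = 4 * A + 3 * (k * (4 * A)) := by ring
    omega
  have hside : ∀ j, n ≤ j → j ≤ O.length → ∀ z ∈ nhd P α D₀, A ≤ P.dst p z → P.dst p z ≤ 2 * A →
      A ≤ D₀ + 2 * P.dst (M.pos (M.src (cyc O j))) z := by
    intro j hj hj' z ⟨u, hu, hzu⟩ hz1 hz2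
    rw [hposj j hj']
    set y := p * P.elt (w.take j) with hy
    have hyu := P.dst_triangle y z u
    have hpz := P.dst_triangle p z p'
    have hzp' := P.dst_triangle z y p'
    have hzp := P.dst_triangle z y p
    rw [P.dst_comm z y] at hzp' hzp
    rw [P.dst_comm z p] at hzp
    have hsplit : y = p * P.elt (a.take j) * P.elt (v'.take (j - n)) *
        P.elt (β.take (j - n - v'.length)) * P.elt (v.take (j - n - v'.length - β.length)) := by
      rw [hy, hw, List.take_append, List.take_append, List.take_append, P.elt_append, P.elt_append,
        P.elt_append, hal]
      simp only [mul_assoc]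
    rw [List.take_of_length_le (by omega : a.length ≤ j), hae] at hsplit
    by_cases c1 : j - n ≤ v'.length
    · have hyv : y = p' * P.elt (v'.take (j - n)) := by
        rw [hsplit, Nat.sub_eq_zero_of_le c1]; simp
      have h1 := hv'.dst_take p' (Nat.zero_le _) c1
      have h2 := hv'.dst_take p' c1 le_rfl
      rw [List.take_zero, P.elt_nil, mul_one, ← hyv] at h1
      rw [List.take_length, hv'e, ← hyv] at h2
      rw [P.dst_comm p' y] at h1
      rw [P.dst_comm y x'] at h2
      have h3 := dst_le_of_between (by omega) hx' u hu (z := y)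
      omega
    rw [List.take_of_length_le (by omega : v'.length ≤ j - n), hv'e] at hsplit
    by_cases c2 : j - n - v'.length ≤ β.length
    · have hyv : y = x' * P.elt (β.take (j - n - v'.length)) := by
        rw [hsplit, Nat.sub_eq_zero_of_le c2]; simp
      have h2 := hβ.dst_take x' c2 le_rfl
      rw [List.take_length, hβe, ← hyv, P.dst_comm] at h2
      have h3 := hx u hu
      have h4 := P.dst_triangle x y u
      omega
    rw [List.take_of_length_le (by omega : β.length ≤ _), hβe] at hsplit
    have c3 : j - n - v'.length - β.length ≤ v.length := by omega
    have h1 := hv.dst_take x (Nat.zero_le _) c3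
    have h2 := hv.dst_take x c3 le_rfl
    rw [List.take_zero, P.elt_nil, mul_one, ← hsplit] at h1
    rw [List.take_length, hve, ← hsplit] at h2
    have h3 := dst_le_of_between (by omega) hx u hu (z := y)
    omega
  have hmain := D.sq_le_of_flux hα hN (by omega : 12 ≤ D₀) (fun L hL => hT L (by omega))
    (by omega : 2 * D₀ ≤ A) (by omega : n ≤ O.length)
    (fun j hj => by
      rw [hposj j (by omega), hw, List.take_append_of_le_length (by omega)]
      exact haα j) hpos
    (by
      rw [hposj n (by omega), hw, ← hal, List.take_left, hae]
      omega) hside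
    (D.card_bad_le_of_quad ha hv' hβ hv hO) (l := 2 * (c * A)) fun b hb => (hF b hb).trans (by omega)
  have h1 : 12 * A + 24 * O.length ≤ m * A := by
    have : m * A = 12 * A + 24 * (c * A) := by rw [hm]; ring
    omega
  have h2 : A ≤ (2 * (N (2 * (c * A)) + 26 * D₀) + 1) * m := by
    refine Nat.le_of_mul_le_mul_right ?_ (by omega : 0 < A)
    calc A * A ≤ _ := hmain
      _ ≤ _ := Nat.mul_le_mul_left _ h1
      _ = _ := by ring
  have h3 := hT' (2 * (c * A)) (by
    have : A ≤ c * A := Nat.le_mul_of_pos_left _ (by omega)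
    omega)
  have h4 : 4 * (N (2 * (c * A)) * m) ≤ A := by
    refine Nat.le_of_mul_le_mul_left (?_ : 2 * c * _ ≤ 2 * c * _) (by omega)
    calc _ = _ := by ring
      _ ≤ _ := h3
      _ = _ := by ring
  have h5 : (2 * (N (2 * (c * A)) + 26 * D₀) + 1) * m =
      2 * (N (2 * (c * A)) * m) + (52 * D₀ + 1) * m := by ring
  omega

end

/-! ### Projections of quasi-geodesics -/

section

variable {S : Type} {P : C6Presentation S}

theorem exists_excursion_start {D : ℕ → ℕ} {s κ : ℕ} (h0 : D 0 ≤ κ) (hD : ∀ t, D (t + 1) ≤ D t + s)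
    (i : ℕ) (hi : κ ≤ D i) : ∃ a ≤ i, D a ≤ κ + s ∧ ∀ l, a ≤ l → l ≤ i → κ ≤ D l := by
  induction i with
  | zero => exact ⟨0, le_rfl, by omega, fun l _ hl => by rwa [Nat.le_zero.1 hl]⟩
  | succ i ih =>
    by_cases h : κ ≤ D i
    · obtain ⟨a, ha, h1, h2⟩ := ih h
      refine ⟨a, by omega, h1, fun l hl hl' => ?_⟩
      rcases Nat.le_succ_iff.1 hl' with h3 | rfl
      · exact h2 l hl h3
      · exact hi
    · refine ⟨i + 1, le_rfl, ?_, fun l hl hl' => ?_⟩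
      · have := hD i
        omega
      · rwa [le_antisymm hl' hl]

/-- Away from `α`, the projection of a Lipschitz path moves slowly. -/
theorem proj_path_le {α : Set P.Grp} {k R₀ : ℕ}
    (hcon : ∀ x x' p p', p ∈ α → p' ∈ α → (∀ u ∈ α, P.dst x p ≤ P.dst x u) →
      (∀ u ∈ α, P.dst x' p' ≤ P.dst x' u) → R₀ ≤ P.dst x p → 10 * P.dst x x' ≤ P.dst x p →
      k * P.dst p p' ≤ P.dst x p)
    {Q Y : ℕ → P.Grp} (hY : ∀ t, Y t ∈ α) (hnear : ∀ t, ∀ u ∈ α, P.dst (Q t) (Y t) ≤ P.dst (Q t) u)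
    {s κ : ℕ} (hκ : R₀ ≤ κ) (hκs : 10 * s ≤ κ) {b : ℕ}
    (hQ : ∀ i j, i ≤ j → j ≤ b → P.dst (Q i) (Q j) ≤ s * (j - i))
    (d j : ℕ) (hj : j + d = b) (hex : ∀ l, j ≤ l → l ≤ b → κ ≤ P.dst (Q l) (Y l)) :
    k * P.dst (Y j) (Y b) ≤ 20 * s * d + 2 * P.dst (Q b) (Y b) := by
  induction d using Nat.strong_induction_on generalizing j with
  | _ d ih =>
    by_cases hall : ∀ l, j ≤ l → l ≤ b → 10 * P.dst (Q j) (Q l) ≤ P.dst (Q j) (Y j)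
    · have h1 := hall b (by omega) le_rfl
      have h2 := hcon _ _ _ _ (hY j) (hY b) (hnear j) (hnear b)
        (hκ.trans (hex j le_rfl (by omega))) h1
      have h3 := hnear j _ (hY b)
      have h4 := P.dst_triangle (Q j) (Q b) (Y b)
      omega
    · classical
      push Not at hall
      obtain ⟨hl1, hl2, hl3⟩ := Nat.find_spec hall
      set l' := Nat.find hall with hl'
      have hne : l' ≠ j := by
        intro h
        rw [h, P.dst_self] at hl3
        omega
      obtain ⟨l, hl⟩ : ∃ l, l' = l + 1 := ⟨l' - 1, by omega⟩
      have hjl : j < l := by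
        by_contra! h
        obtain rfl : l = j := by omega
        have h1 := hQ l (l + 1) (by omega) (by omega)
        rw [hl] at hl3
        have h2 := hex l le_rfl (by omega)
        rw [Nat.add_sub_cancel_left, mul_one] at h1
        omega
      have hmin := Nat.find_min hall (m := l) (by omega)
      push Not at hmin
      have h1 := hcon _ _ _ _ (hY j) (hY l) (hnear j) (hnear l)
        (hκ.trans (hex j le_rfl (by omega))) (hmin hjl.le (by omega))
      have h2 := hQ j l' (by omega) (by omega)
      have h3 := ih (d - (l - j)) (by omega) l (by omega) fun i hi => hex i (by omega)
      have h4 := Nat.mul_le_mul_left k (P.dst_triangle (Y j) (Y l) (Y b))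
      have h5 : s * (l' - j) ≤ s * (2 * (l - j)) := Nat.mul_le_mul_left s (by omega)
      have h6 : 20 * s * d = 20 * s * (d - (l - j)) + 10 * (s * (2 * (l - j))) := by
        obtain ⟨t, ht⟩ : ∃ t, d = t + (l - j) := ⟨d - (l - j), by omega⟩
        rw [ht, Nat.add_sub_cancel]
        ring
      rw [mul_add] at h4
      omega

theorem dst_proj_le {α : Set P.Grp} (hcon : ∀ k, ∃ R₀, ∀ x x' p p', p ∈ α → p' ∈ α →
      (∀ u ∈ α, P.dst x p ≤ P.dst x u) → (∀ u ∈ α, P.dst x' p' ≤ P.dst x' u) →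
      R₀ ≤ P.dst x p → 10 * P.dst x x' ≤ P.dst x p → k * P.dst p p' ≤ P.dst x p) {s : ℕ}
    (hs : 1 ≤ s) : ∃ B, ∀ (Q Y : ℕ → P.Grp) (T : ℕ), (∀ t, Y t ∈ α) →
      (∀ t, ∀ u ∈ α, P.dst (Q t) (Y t) ≤ P.dst (Q t) u) → Q 0 ∈ α → Q T ∈ α →
      (∀ i j, i ≤ j → j ≤ T → P.dst (Q i) (Q j) ≤ s * (j - i)) →
      (∀ i j, i ≤ j → j ≤ T → j - i ≤ s * (P.dst (Q i) (Q j) + s)) →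
      ∀ i ≤ T, P.dst (Q i) (Y i) ≤ B := by
  obtain ⟨R₀, hR₀⟩ := hcon (40 * (s * s))
  set κ := max R₀ (10 * s) with hκ
  set B₀ := s * (2 * (40 * (s * s)) * (κ + s) + 2 * (κ + s) + 40 * (s * s) * s) with hB₀
  refine ⟨κ + s + s * B₀, fun Q Y T hY hnear hQ0 hQT hQ1 hQ2 i hi => ?_⟩
  by_cases hiκ : P.dst (Q i) (Y i) < κ
  · omega
  push Not at hiκ
  have hstep : ∀ i j, i ≤ j → j ≤ T →
      P.dst (Q i) (Y i) ≤ P.dst (Q j) (Y j) + s * (j - i) ∧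
      P.dst (Q j) (Y j) ≤ P.dst (Q i) (Y i) + s * (j - i) := by
    intro i j hij hj
    have h1 := hnear j _ (hY i)
    have h2 := hnear i _ (hY j)
    have h3 := P.dst_triangle (Q i) (Q j) (Y j)
    have h4 := P.dst_triangle (Q j) (Q i) (Y i)
    rw [P.dst_comm (Q j) (Q i)] at h4
    have h5 := hQ1 i j hij hj
    omega
  have hzero : ∀ t, Q t ∈ α → P.dst (Q t) (Y t) = 0 := fun t ht => by
    have := hnear t _ ht
    rwa [P.dst_self, Nat.le_zero] at this
  obtain ⟨a, ha, ha1, ha2⟩ := exists_excursion_start (s := s) (κ := κ)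
    (D := fun t => if t ≤ T then P.dst (Q t) (Y t) else 0)
    (by simp [hzero 0 hQ0]) (fun t => by
      by_cases h : t + 1 ≤ T
      · have h1 := (hstep t (t + 1) (by omega) h).2
        rw [Nat.add_sub_cancel_left, mul_one] at h1
        simpa only [if_pos h, if_pos (by omega : t ≤ T)] using h1
      · simp [h]) i (by simpa [hi] using hiκ)
  obtain ⟨c, hc, hc1, hc2⟩ := exists_excursion_start (s := s) (κ := κ)
    (D := fun t => P.dst (Q (T - t)) (Y (T - t)))
    (by simp [hzero T hQT]) (fun t => by
      by_cases h : t + 1 ≤ T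
      · have h1 := (hstep (T - (t + 1)) (T - t) (by omega) (by omega)).1
        rwa [(by omega : T - t - (T - (t + 1)) = 1), mul_one] at h1
      · simp only [(by omega : T - (t + 1) = T - t)]
        omega) (T - i) (by simpa [Nat.sub_sub_self hi] using hiκ)
  simp only [if_pos (by omega : a ≤ T)] at ha1
  set b := T - c with hb
  have hex : ∀ l, a ≤ l → l ≤ b → κ ≤ P.dst (Q l) (Y l) := by
    intro l hl hl'
    rcases le_total l i with h | h
    · have := ha2 l hl h
      rwa [if_pos (by omega)] at this
    · have := hc2 (T - l) (by omega) (by omega)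
      simpa only [Nat.sub_sub_self (by omega : l ≤ T)] using this
  have h1 := proj_path_le hR₀ hY hnear (by omega : R₀ ≤ κ) (by omega : 10 * s ≤ κ) (b := b)
    (fun i j hij hj => hQ1 i j hij (by omega)) (b - a) a (by omega) hex
  have h2 := hQ2 a b (by omega) (by omega)
  have h3 : P.dst (Q a) (Q b) ≤ (κ + s) + P.dst (Y a) (Y b) + (κ + s) := by
    have e1 := P.dst_triangle (Q a) (Y a) (Q b)
    have e2 := P.dst_triangle (Y a) (Y b) (Q b)
    rw [P.dst_comm (Y b) (Q b)] at e2
    omega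
  have h4 : b - a ≤ B₀ := by
    have e1 : 40 * (s * s) * (b - a) ≤ s * (2 * (40 * (s * s)) * (κ + s) +
        (20 * s * (b - a) + 2 * (κ + s)) + 40 * (s * s) * s) := by
      calc 40 * (s * s) * (b - a)
          ≤ 40 * (s * s) * (s * ((κ + s) + P.dst (Y a) (Y b) + (κ + s) + s)) :=
            Nat.mul_le_mul_left _ (h2.trans (Nat.mul_le_mul_left s (by omega)))
        _ = s * (2 * (40 * (s * s)) * (κ + s) + 40 * (s * s) * P.dst (Y a) (Y b) +
              40 * (s * s) * s) := by ring
        _ ≤ _ := Nat.mul_le_mul_left s (by omega)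
    have e2 : 40 * (s * s) * (b - a) = 20 * (s * s) * (b - a) + 20 * (s * s) * (b - a) := by ring
    have e3 : s * (2 * (40 * (s * s)) * (κ + s) +
        (20 * s * (b - a) + 2 * (κ + s)) + 40 * (s * s) * s) = 20 * (s * s) * (b - a) + B₀ := by
      rw [hB₀]; ring
    have e4 : b - a ≤ 20 * (s * s) * (b - a) :=
      Nat.le_mul_of_pos_left _ (by positivity)
    omega
  have h5 := (hstep a i ha hi).2
  have h6 : s * (i - a) ≤ s * B₀ := Nat.mul_le_mul_left s (by omega)
  omega

theorem abs_cast_add_sub (m : ℤ) {i j : ℕ} (hij : i ≤ j) :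
    |((m + i : ℤ) : ℝ) - ((m + j : ℤ) : ℝ)| = ((j - i : ℕ) : ℝ) := by
  have : (i : ℝ) ≤ j := by exact_mod_cast hij
  rw [abs_sub_comm, abs_of_nonneg] <;> push_cast [Nat.cast_sub hij] <;> linarith

theorem isMorse_of_meetsIn {α : Set P.Grp} (hα : IsGeodesic P.gens α) {N : ℕ → ℕ}
    (hN : MeetsIn P α N) (hsub : NatSublinear N) : IsMorse P.gens α := by
  have h := fun s : ℕ => dst_proj_le (contraction hα hN hsub) (s := s + 1) (by omega)
  choose B hB using h
  refine ⟨fun L A => B ⌈L + A⌉₊, fun L A hL hA q m n hmn hqm hqn hq i hi hi' => ?_⟩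
  set s : ℕ := ⌈L + A⌉₊ + 1 with hs
  have hsr : L + A ≤ s := (Nat.le_ceil _).trans (by rw [hs]; push_cast; linarith)
  choose Y hY hYn using exists_nearest (P := P) ⟨_, hqm⟩
  have key := hB ⌈L + A⌉₊ (fun t => q (m + t)) (fun t => Y (q (m + t))) (n - m).toNat
    (fun t => hY _) (fun t => hYn _) (by simpa using hqm)
    (by rw [Int.toNat_of_nonneg (by omega)]; simpa using hqn)
    (fun i j hij hj => by
      rcases hij.eq_or_lt with rfl | hlt
      · rw [P.dst_self]; exact Nat.zero_le _
      have h1 := (hq (m + i) (m + j) (by omega) (by omega) (by omega) (by omega)).2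
      rw [P.wdist_eq] at h1
      have h2 : |((m + i : ℤ) : ℝ) - ((m + j : ℤ) : ℝ)| = ((j - i : ℕ) : ℝ) := abs_cast_add_sub m hij
      have h3 : (1 : ℝ) ≤ ((j - i : ℕ) : ℝ) := by exact_mod_cast (by omega : 1 ≤ j - i)
      rw [h2] at h1
      have h4 : (P.dst (q (m + i)) (q (m + j)) : ℝ) ≤ (s : ℝ) * ((j - i : ℕ) : ℝ) := by nlinarith
      exact_mod_cast h4)
    (fun i j hij hj => by
      have h1 := (hq (m + i) (m + j) (by omega) (by omega) (by omega) (by omega)).1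
      rw [P.wdist_eq] at h1
      have h2 : |((m + i : ℤ) : ℝ) - ((m + j : ℤ) : ℝ)| = ((j - i : ℕ) : ℝ) := abs_cast_add_sub m hij
      rw [h2, sub_le_iff_le_add, inv_mul_le_iff₀ (by linarith)] at h1
      have h4 : ((j - i : ℕ) : ℝ) ≤ (s : ℝ) * (P.dst (q (m + i)) (q (m + j)) + s) := by
        refine h1.trans (mul_le_mul (by linarith) (by linarith) (by positivity) (by positivity))
      exact_mod_cast h4)
    (i - m).toNat (by omega)
  have hi2 : m + ((i - m).toNat : ℤ) = i := by omega
  simp only [hi2] at key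
  change sInf _ ≤ (B ⌈L + A⌉₊ : ℝ)
  refine (csInf_le ⟨0, ?_⟩ (Set.mem_image_of_mem _ (hY (q i)))).trans ?_
  · rintro _ ⟨y, -, rfl⟩
    rw [P.wdist_eq]
    positivity
  · rw [P.wdist_eq]
    exact_mod_cast key

end

/-! ### Relators meeting Morse geodesics -/

section

variable {S : Type} {P : C6Presentation S}

theorem dst_relator {r : Word S} (hr : r ∈ P.rels) (x : P.Grp) {i j : ℕ} (hij : i ≤ j)
    (hj : j ≤ r.length) :
    P.dst (x * P.elt (r.take i)) (x * P.elt (r.take j)) = min (j - i) (r.length - (j - i)) := by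
  have e : r.take j = r.take i ++ (r.drop i).take (j - i) := by
    rw [← List.take_add, Nat.add_sub_cancel' hij]
  rw [P.dst_mul_left, e, P.elt_append, C6Presentation.dst, inv_mul_cancel_left]
  have h1 : (r.drop i).take (j - i) ++ ((r.drop i).drop (j - i) ++ r.take i) ∈ P.rels := by
    have := P.rotate_mem r hr i
    rwa [List.rotate_eq_drop_append_take (hij.trans hj), ← List.take_append_drop (j - i) (r.drop i),
      List.append_assoc] at this
  rw [len_arc h1]
  simp only [List.length_append, List.length_take, List.length_drop]
  congr 1 <;> omega

/-- Arcs of relators with endpoints on a Morse set that are not too long stay close to it. -/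
theorem near_of_isMorse {α : Set P.Grp} {μ : ℝ → ℝ → ℝ}
    (hμ : ∀ L A : ℝ, 1 ≤ L → 0 ≤ A → ∀ (q : ℤ → P.Grp) (m n : ℤ), m ≤ n → q m ∈ α → q n ∈ α →
      (∀ i j : ℤ, m ≤ i → i ≤ n → m ≤ j → j ≤ n →
        L⁻¹ * |(i : ℝ) - (j : ℝ)| - A ≤ wdist P.gens (q i) (q j) ∧
        wdist P.gens (q i) (q j) ≤ L * |(i : ℝ) - (j : ℝ)| + A) →
      ∀ i : ℤ, m ≤ i → i ≤ n → setDist P.gens (q i) α ≤ μ L A)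
    {r : Word S} (hr : r ∈ P.rels) {x : P.Grp} (hx : x ∈ α) {p k : ℕ}
    (hp : p ≤ r.length) (hy : x * P.elt (r.take p) ∈ α) (hk : 1 ≤ k)
    (hkp : r.length ≤ k * (r.length - p)) {t : ℕ} (ht : t ≤ p) :
    ∃ z ∈ α, P.dst (x * P.elt (r.take t)) z ≤ ⌊μ k 0⌋₊ := by
  obtain ⟨z, hz, hzn⟩ := exists_nearest ⟨x, hx⟩ (x * P.elt (r.take t))
  refine ⟨z, hz, Nat.le_floor ?_⟩
  have hk' : (1 : ℝ) ≤ k := by exact_mod_cast hk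
  have harc : ∀ i j : ℕ, i ≤ j → j ≤ p →
      (j - i : ℕ) ≤ k * P.dst (x * P.elt (r.take i)) (x * P.elt (r.take j)) ∧
      P.dst (x * P.elt (r.take i)) (x * P.elt (r.take j)) ≤ k * (j - i : ℕ) := by
    intro i j hij hj
    rw [dst_relator hr x hij (hj.trans hp)]
    have h1 : j - i ≤ k * (j - i) := Nat.le_mul_of_pos_left _ hk
    refine ⟨?_, (min_le_left _ _).trans h1⟩
    rcases min_choice (j - i) (r.length - (j - i)) with h | h <;> rw [h]
    · exact h1
    · exact le_trans (by omega) (hkp.trans (Nat.mul_le_mul_left k (by omega)))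
  have h1 := hμ k 0 hk' le_rfl (fun i => x * P.elt (r.take i.toNat)) 0 p (by positivity)
    (by simpa using hx) (by simpa using hy) (fun i j hi hi' hj hj' => by
      lift i to ℕ using hi
      lift j to ℕ using hj
      simp only [Int.toNat_natCast, P.wdist_eq, add_zero, sub_zero, Int.cast_natCast]
      rw [inv_mul_le_iff₀ (by linarith)]
      rcases le_total i j with h | h
      · have h2 := harc i j h (by omega)
        rw [abs_sub_comm, ← Nat.cast_sub h, Nat.abs_cast]
        exact_mod_cast h2
      · have h2 := harc j i h (by omega)
        rw [P.dst_comm, ← Nat.cast_sub h, Nat.abs_cast]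
        exact_mod_cast h2) t (by positivity) (by exact_mod_cast ht)
  simp only [Int.toNat_natCast] at h1
  refine le_trans (le_csInf ⟨_, Set.mem_image_of_mem _ hx⟩ ?_) h1
  rintro _ ⟨u, hu, rfl⟩
  rw [P.wdist_eq]
  exact_mod_cast hzn u hu

theorem dst_le_of_equidistant {α : Set P.Grp} (hα : IsGeodesic P.gens α) {x y z₁ z₂ m₁ m₂ : P.Grp}
    (hx : x ∈ α) (hy : y ∈ α) (hz₁ : z₁ ∈ α) (hz₂ : z₂ ∈ α) {D : ℕ} (hd₁ : P.dst m₁ z₁ ≤ D)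
    (hd₂ : P.dst m₂ z₂ ≤ D) (hxy : 2 * D + 1 < P.dst x y)
    (h₁ : P.dst x m₁ ≤ P.dst m₁ y + 1) (h₁' : P.dst m₁ y ≤ P.dst x m₁ + 1)
    (h₂ : P.dst x m₂ ≤ P.dst y m₂ + 1) (h₂' : P.dst y m₂ ≤ P.dst x m₂ + 1) :
    P.dst m₁ m₂ ≤ 4 * D + 2 := by
  obtain ⟨I, γ, -, hγ, rfl⟩ := hα
  have hdst : ∀ {u v : P.Grp} {a b : ℤ}, a ∈ I → b ∈ I → γ a = u → γ b = v →
      P.dst u v = (a - b).natAbs := by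
    rintro _ _ a b ha hb rfl rfl
    have := hγ a ha b hb
    rw [P.wdist_eq] at this
    have h2 : ((P.dst (γ a) (γ b) : ℤ) : ℝ) = ((|a - b| : ℤ) : ℝ) := by
      push_cast; exact this
    have h3 : (P.dst (γ a) (γ b) : ℤ) = |a - b| := by exact_mod_cast h2
    rw [Int.abs_eq_natAbs] at h3
    exact_mod_cast h3
  obtain ⟨ax, hax, hax'⟩ := hx
  obtain ⟨ay, hay, hay'⟩ := hy
  obtain ⟨a₁, ha₁, ha₁'⟩ := hz₁
  obtain ⟨a₂, ha₂, ha₂'⟩ := hz₂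
  have c0 := hdst hax hay hax' hay'
  have c1 := hdst hax ha₁ hax' ha₁'
  have c2 := hdst hay ha₁ hay' ha₁'
  have c3 := hdst hax ha₂ hax' ha₂'
  have c4 := hdst hay ha₂ hay' ha₂'
  have c5 := hdst ha₁ ha₂ ha₁' ha₂'
  have t1 := P.dst_triangle x z₁ m₁
  have t1' := P.dst_triangle x m₁ z₁
  have t2 := P.dst_triangle y z₁ m₁
  have t2' := P.dst_triangle y m₁ z₁
  have t3 := P.dst_triangle x z₂ m₂
  have t3' := P.dst_triangle x m₂ z₂
  have t4 := P.dst_triangle y z₂ m₂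
  have t4' := P.dst_triangle y m₂ z₂
  have t5 := P.dst_triangle m₁ z₁ m₂
  have t6 := P.dst_triangle z₁ z₂ m₂
  rw [P.dst_comm z₁ m₁] at t1 t2
  rw [P.dst_comm z₂ m₂] at t3 t4 t6
  rw [P.dst_comm y m₁] at t2 t2'
  have s1 : (ax - a₁).natAbs ≤ (ay - a₁).natAbs + 2 * D + 1 := by omega
  have s2 : (ay - a₁).natAbs ≤ (ax - a₁).natAbs + 2 * D + 1 := by omega
  have s3 : (ax - a₂).natAbs ≤ (ay - a₂).natAbs + 2 * D + 1 := by omega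
  have s4 : (ay - a₂).natAbs ≤ (ax - a₂).natAbs + 2 * D + 1 := by omega
  have s5 : (a₁ - a₂).natAbs ≤ 2 * D + 1 := by omega
  omega

theorem length_le_of_isMorse {α : Set P.Grp} (hα : IsGeodesic P.gens α) (hM : IsMorse P.gens α)
    (k : ℕ) : ∃ T, ∀ g, ∀ r ∈ P.rels, ∀ x ∈ relatorCycle P g r ∩ α, ∀ y ∈ relatorCycle P g r ∩ α,
      r.length ≤ k * P.dst x y → r.length ≤ T := by
  obtain ⟨μ, hμ⟩ := hM
  set D := ⌊μ k 0⌋₊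
  refine ⟨k * (2 * D + 1) + 8 * D + 10, ?_⟩
  have key : ∀ r ∈ P.rels, ∀ x ∈ α, ∀ p ≤ r.length, x * P.elt (r.take p) ∈ α →
      r.length ≤ k * P.dst x (x * P.elt (r.take p)) →
      r.length ≤ k * (2 * D + 1) + 8 * D + 10 := by
    intro r hr x hx p hp hy hk
    rcases Nat.eq_zero_or_pos k with rfl | hk0
    · omega
    have hx0 : x * P.elt (r.take 0) = x := by simp
    have hx1 : x * P.elt (r.take r.length) = x := by rw [List.take_length, P.elt_rel hr, mul_one]
    have d0 := dst_relator hr x (Nat.zero_le p) hp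
    have d1 := dst_relator hr x (Nat.zero_le (p / 2)) (by omega)
    have d2 := dst_relator hr x (by omega : p / 2 ≤ p) hp
    have d3 := dst_relator hr x (by omega : p ≤ p + (r.length - p) / 2) (by omega)
    have d4 := dst_relator hr x (by omega : p + (r.length - p) / 2 ≤ r.length) le_rfl
    have d5 := dst_relator hr x (by omega : p / 2 ≤ p + (r.length - p) / 2) (by omega)
    rw [hx0] at d0 d1
    rw [hx1] at d4
    rw [d0] at hk
    have hk₁ : r.length ≤ k * (r.length - p) :=
      hk.trans (Nat.mul_le_mul_left k (min_le_right _ _))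
    have hk₂ : r.length ≤ k * (r.length - (r.length - p)) :=
      hk.trans (Nat.mul_le_mul_left k ((min_le_left _ _).trans (by rw [Nat.sub_sub_self hp]; rfl)))
    obtain ⟨z₁, hz₁, hd₁⟩ := near_of_isMorse hμ hr hx hp hy hk0 hk₁ (Nat.div_le_self p 2)
    have hrot : ∀ s ≤ r.length - p, x * P.elt (r.take p) * P.elt ((r.rotate p).take s) =
        x * P.elt (r.take (p + s)) := fun s hs => by
      rw [List.rotate_eq_drop_append_take hp,
        List.take_append_of_le_length (by rwa [List.length_drop]), mul_assoc,
        ← P.elt_append, ← List.take_add]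
    have hx₂ := hrot _ le_rfl
    rw [Nat.add_sub_cancel' hp, hx1] at hx₂
    obtain ⟨z₂, hz₂, hd₂⟩ := near_of_isMorse hμ (P.rotate_mem r hr p) hy
      (p := r.length - p) (by rw [List.length_rotate]; omega) (by rw [hx₂]; exact hx) hk0
      (by rw [List.length_rotate]; exact hk₂) (Nat.div_le_self _ 2)
    rw [hrot _ (Nat.div_le_self _ 2)] at hd₂
    rw [P.dst_comm _ x] at d4
    clear hrot hx₂ hx0 hx1 hk₁ hk₂
    generalize x * P.elt (r.take p) = y at *
    generalize x * P.elt (r.take (p / 2)) = m₁ at *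
    generalize x * P.elt (r.take (p + (r.length - p) / 2)) = m₂ at *
    by_contra! hbig
    have hmin : 2 * D + 1 < min (p - 0) (r.length - (p - 0)) := by
      refine lt_of_mul_lt_mul_left' (a := k) (lt_of_lt_of_le ?_ hk)
      omega
    have hclose := dst_le_of_equidistant hα hx hy hz₁ hz₂ hd₁ hd₂ (by rw [d0]; exact hmin)
      (by omega) (by omega) (by omega) (by omega)
    omega
  intro g r hr x hx y hy hk
  obtain ⟨i, hi, hxi⟩ := mem_relatorCycle.1 hx.1
  obtain ⟨j, hj, hyj⟩ := mem_relatorCycle.1 hy.1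
  have main : ∀ i j x y, i ≤ j → j ≤ r.length → x = g * P.elt (r.take i) →
      y = g * P.elt (r.take j) → x ∈ α → y ∈ α → r.length ≤ k * P.dst x y →
      r.length ≤ k * (2 * D + 1) + 8 * D + 10 := by
    intro i j x y hij hj hxi hyj hx hy hk
    have e : y = x * P.elt ((r.rotate i).take (j - i)) := by
      rw [List.rotate_eq_drop_append_take (by omega),
        List.take_append_of_le_length (by rw [List.length_drop]; omega), hxi, hyj, mul_assoc,
        ← P.elt_append, ← List.take_add, Nat.add_sub_cancel' hij]
    have := key (r.rotate i) (P.rotate_mem r hr i) x hx (j - i) (by rw [List.length_rotate]; omega)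
      (e ▸ hy) (by rw [List.length_rotate, ← e]; exact hk)
    rwa [List.length_rotate] at this
  rcases le_total i j with h | h
  · exact main i j x y h hj hxi hyj hx.2 hy.2 hk
  · exact main j i y x h hi hyj hxi hy.2 hx.2 (by rwa [P.dst_comm])

end

/-! ### The Morse property and intersections with relator cycles -/

section

variable {S : Type} {P : C6Presentation S} {α : Set P.Grp}

theorem dst_le_of_mem_relatorCycle {r : Word S} (hr : r ∈ P.rels) {g x y : P.Grp}
    (hx : x ∈ relatorCycle P g r) (hy : y ∈ relatorCycle P g r) : P.dst x y ≤ r.length := by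
  obtain ⟨i, hi, rfl⟩ := mem_relatorCycle.1 hx
  obtain ⟨j, hj, rfl⟩ := mem_relatorCycle.1 hy
  rcases le_total i j with h | h
  · rw [dst_relator hr g h hj]; omega
  · rw [P.dst_comm, dst_relator hr g h hi]; omega

theorem dst_le_setDiam {r : Word S} (hr : r ∈ P.rels) {g x y : P.Grp}
    (hx : x ∈ relatorCycle P g r ∩ α) (hy : y ∈ relatorCycle P g r ∩ α) :
    (P.dst x y : ℝ) ≤ setDiam P.gens (relatorCycle P g r ∩ α) := by
  refine le_csSup ⟨r.length, ?_⟩ ⟨x, hx, y, hy, rfl⟩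
  rintro _ ⟨u, hu, v, hv, rfl⟩
  rw [P.wdist_eq]
  exact_mod_cast dst_le_of_mem_relatorCycle hr hu.1 hv.1

theorem setDiam_le {A : Set P.Grp} (hA : A.Nonempty) {t : ℝ}
    (h : ∀ x ∈ A, ∀ y ∈ A, (P.dst x y : ℝ) ≤ t) : setDiam P.gens A ≤ t := by
  obtain ⟨x, hx⟩ := hA
  refine csSup_le ⟨_, x, hx, x, hx, rfl⟩ ?_
  rintro _ ⟨u, hu, v, hv, rfl⟩
  exact h u hu v hv

theorem setDiam_nonneg (A : Set P.Grp) : 0 ≤ setDiam P.gens A := by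
  refine Real.sSup_nonneg ?_
  rintro _ ⟨u, -, v, -, rfl⟩
  rw [P.wdist_eq]
  positivity

theorem NatSublinear.of_tendsto {ρ : ℝ → ℝ} (h : Tendsto (fun r => ρ r / r) atTop (nhds 0)) :
    NatSublinear fun n : ℕ => ⌊ρ n⌋₊ := by
  intro k
  have h1 := (h.comp tendsto_natCast_atTop_atTop).eventually
    (gt_mem_nhds (by positivity : (0 : ℝ) < 1 / (k + 1)))
  obtain ⟨T, hT⟩ := eventually_atTop.1 h1
  refine ⟨max T 1, fun L hL => ?_⟩
  have h2 := hT L (le_of_max_le_left hL)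
  have hL0 : (0 : ℝ) < L := by exact_mod_cast (le_of_max_le_right hL)
  simp only [Function.comp_apply] at h2
  rw [div_lt_div_iff₀ hL0 (by positivity), one_mul] at h2
  rcases Nat.eq_zero_or_pos ⌊ρ L⌋₊ with h0 | h0
  · simp [h0]
  have h3 : (⌊ρ L⌋₊ : ℝ) ≤ ρ L := Nat.floor_le (by
    by_contra! hneg
    rw [Nat.floor_of_nonpos hneg.le] at h0
    omega)
  have h4 : (k : ℝ) * ⌊ρ L⌋₊ ≤ L := by nlinarith [(by positivity : (0 : ℝ) ≤ ⌊ρ L⌋₊)]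
  exact_mod_cast h4

/-- In a classical C'(1/6) group, with
`ρ(t) = sup { diam(Γ₀ ∩ α) : Γ₀ an embedded relator cycle, |Γ₀| ≤ t, Γ₀ ∩ α ≠ ∅ }`,
a geodesic `α` is Morse if and only if `ρ` is sublinear. -/
theorem statement1 {S : Type} (P : C6Presentation S) (α : Set P.Grp)
    (hα : IsGeodesic P.gens α) (ρ : ℝ → ℝ)
    (hρ : ∀ t : ℝ, ρ t =
      sSup {D : ℝ | ∃ (g : P.Grp) (r : Word S), r ∈ P.rels ∧ (r.length : ℝ) ≤ t ∧
        (relatorCycle P g r ∩ α).Nonempty ∧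
        D = setDiam P.gens (relatorCycle P g r ∩ α)}) :
    IsMorse P.gens α ↔ Sublinear ρ := by
  have hbdd : ∀ t : ℝ, BddAbove {D : ℝ | ∃ (g : P.Grp) (r : Word S), r ∈ P.rels ∧
      (r.length : ℝ) ≤ t ∧ (relatorCycle P g r ∩ α).Nonempty ∧
      D = setDiam P.gens (relatorCycle P g r ∩ α)} := by
    refine fun t => ⟨t, ?_⟩
    rintro _ ⟨g, r, hr, hrt, hne, rfl⟩
    refine setDiam_le hne fun x hx y hy => le_trans ?_ hrt
    exact_mod_cast dst_le_of_mem_relatorCycle hr hx.1 hy.1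
  have hnonneg : ∀ t, 0 ≤ ρ t := by
    intro t
    rw [hρ]
    refine Real.sSup_nonneg ?_
    rintro _ ⟨g, r, -, -, -, rfl⟩
    exact setDiam_nonneg _
  constructor
  · intro hM
    refine ⟨fun t t' htt => ?_, Eventually.of_forall hnonneg, ?_⟩
    · rw [hρ t]
      refine Real.sSup_le ?_ (hnonneg t')
      rintro _ ⟨g, r, hr, hrt, hne, rfl⟩
      rw [hρ t']
      exact le_csSup (hbdd t') ⟨g, r, hr, hrt.trans htt, hne, rfl⟩
    · rw [Metric.tendsto_atTop]
      intro ε hε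
      obtain ⟨k, hk⟩ := exists_nat_gt (2 / ε)
      obtain ⟨T, hT⟩ := length_le_of_isMorse hα hM k
      have hk0 : (0 : ℝ) < k := (by positivity : (0 : ℝ) < 2 / ε).trans hk
      refine ⟨k * T + 1, fun t ht => ?_⟩
      have ht0 : 0 < t := by
        have : (0 : ℝ) ≤ k * T := by positivity
        linarith
      have key : ρ t ≤ t / k := by
        rw [hρ]
        refine Real.sSup_le ?_ (by positivity)
        rintro _ ⟨g, r, hr, hrt, hne, rfl⟩
        refine setDiam_le hne fun x hx y hy => ?_
        rw [le_div_iff₀ hk0]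
        by_cases h : r.length ≤ k * P.dst x y
        · have h1 : (P.dst x y : ℝ) ≤ T := by
            exact_mod_cast (dst_le_of_mem_relatorCycle hr hx.1 hy.1).trans
              (hT g r hr x hx y hy h)
          nlinarith
        · have h1 : (k : ℝ) * P.dst x y ≤ r.length := by exact_mod_cast (not_le.1 h).le
          linarith
      rw [Real.dist_eq, sub_zero, abs_of_nonneg (div_nonneg (hnonneg t) ht0.le),
        div_lt_iff₀ ht0]
      refine key.trans_lt ?_
      rw [div_lt_iff₀ hk0]
      rw [div_lt_iff₀ hε] at hk
      nlinarith
  · rintro ⟨-, -, hlim⟩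
    refine isMorse_of_meetsIn hα (N := fun n => ⌊ρ n⌋₊) (fun g r hr n hn x hx y hy => ?_)
      (NatSublinear.of_tendsto hlim)
    refine Nat.le_floor ((dst_le_setDiam hr hx hy).trans ?_)
    rw [hρ]
    exact le_csSup (hbdd n) ⟨g, r, hr, by exact_mod_cast hn, ⟨x, hx⟩, rfl⟩

end

end GSC
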